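/- Let δ ∈ (0,1) and let 𝕋 be a finite family of δ-tubes in ℝ⁴ pointing in δ-separated directions. Then for every ε > 0 there exists a constant C_ε such that ∫_{ℝ⁴} ( ∑_{T′,T″,T‴ ∈ 𝕋} χ_{T′}(x) χ_{T″}(x) χ_{T‴}(x) |V(T′) ∧ V(T″) ∧ V(T‴)|^{12/13} )^{13/27} dx ≤ C_ε δ^{−1/3−ε} (δ³ · #𝕋)^{4/3}. -/

import Mathlib

open MeasureTheory InnerProductGeometry
open scoped ENNReal RealInnerProductSpace

noncomputable section

/-- A δ-tube in ℝ⁴: the closed δ-neighborhood of a unit line segment with base point `y`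
and (unit) direction `v`. -/
def tube (δ : ℝ) (y v : EuclideanSpace ℝ (Fin 4)) : Set (EuclideanSpace ℝ (Fin 4)) :=
  {x | ∃ t ∈ Set.Icc (0 : ℝ) 1, dist x (y + t • v) ≤ δ}

/-- |v₁ ∧ v₂ ∧ v₃|: the square root of the determinant of the Gram matrix, i.e. the
3-dimensional volume of the parallelepiped spanned by v₁, v₂, v₃. -/
def wedge3 (a b c : EuclideanSpace ℝ (Fin 4)) : ℝ :=
  Real.sqrt (Matrix.det
    !![⟪a, a⟫, ⟪a, b⟫, ⟪a, c⟫; ⟪b, a⟫, ⟪b, b⟫, ⟪b, c⟫; ⟪c, a⟫, ⟪c, b⟫, ⟪c, c⟫])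

/-! ## The Borsuk–Ulam theorem via mod-2 chains -/

section BorsukUlam

variable {V : Type*}

/-- Boundary of an ordered simplex, as a mod-2 chain (augmented complex). -/
def simplexBd : List V → (List V →₀ ZMod 2)
  | [] => 0
  | v :: l => Finsupp.single l 1 + (simplexBd l).mapDomain (List.cons v)

/-- Linear extension of a map on ordered simplices. -/
abbrev chainLift {M : Type*} [AddCommMonoid M] [Module (ZMod 2) M] (f : List V → M) :
    (List V →₀ ZMod 2) →ₗ[ZMod 2] M :=
  Finsupp.linearCombination (ZMod 2) f

abbrev coneMap (v : V) : (List V →₀ ZMod 2) →ₗ[ZMod 2] (List V →₀ ZMod 2) :=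
  Finsupp.lmapDomain (ZMod 2) (ZMod 2) (List.cons v)

lemma simplexBd_cons (v : V) (l : List V) :
    simplexBd (v :: l) = Finsupp.single l 1 + coneMap v (simplexBd l) := rfl

lemma chainLift_single {M : Type*} [AddCommMonoid M] [Module (ZMod 2) M] (f : List V → M)
    (l : List V) : chainLift f (Finsupp.single l 1) = f l := by
  simp [chainLift]

lemma chain_add_self {M : Type*} [AddCommGroup M] [Module (ZMod 2) M] (c : M) : c + c = 0 := by
  have : ((1 : ZMod 2) + 1) • c = 0 := by
    rw [show (1 : ZMod 2) + 1 = 0 from rfl, zero_smul]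
  simpa [add_smul] using this

lemma chainLift_bd_cone (v : V) (c : List V →₀ ZMod 2) :
    chainLift simplexBd (coneMap v c) = c + coneMap v (chainLift simplexBd c) := by
  induction c using Finsupp.induction_linear with
  | zero => simp
  | add f g hf hg => rw [map_add, map_add, hf, hg, map_add, map_add]; abel
  | single l a =>
    simp only [Finsupp.lmapDomain_apply, Finsupp.mapDomain_single,
      Finsupp.linearCombination_single, simplexBd, Finsupp.mapDomain_smul, smul_add]
    simp

lemma chainLift_bd_bd (l : List V) : chainLift simplexBd (simplexBd l) = 0 := by
  induction l with
  | nil => simp [simplexBd]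
  | cons v l ih =>
    rw [simplexBd_cons, map_add, chainLift_single, chainLift_bd_cone, ih]
    simp [chain_add_self]

/-- Cup product of the coboundaries of the functions in the first argument. -/
def cupCochain : List (V → ZMod 2) → List V → ZMod 2
  | [], [_] => 1
  | s :: ss, u :: v :: l => (s u + s v) * cupCochain ss (v :: l)
  | _, _ => 0

lemma cupCochain_nil (ss : List (V → ZMod 2)) : cupCochain ss [] = 0 := by
  cases ss <;> rfl

lemma chainLift_cone {M : Type*} [AddCommMonoid M] [Module (ZMod 2) M] (f : List V → M) (v : V)
    (c : List V →₀ ZMod 2) :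
    chainLift f (coneMap v c) = chainLift (fun l => f (v :: l)) c := by
  simp [chainLift, Finsupp.lmapDomain_apply, Finsupp.linearCombination_mapDomain,
    Function.comp_def]

lemma chainLift_mul (a : ZMod 2) (f : List V → ZMod 2) (c : List V →₀ ZMod 2) :
    chainLift (fun l => a * f l) c = a * chainLift f c := by
  simp only [chainLift, Finsupp.linearCombination_apply, Finsupp.sum, Finset.mul_sum, smul_eq_mul]
  exact Finset.sum_congr rfl fun _ _ => by ring

lemma chainLift_zero {M : Type*} [AddCommMonoid M] [Module (ZMod 2) M] (f : List V → M)
    (hf : ∀ l, f l = 0) (c : List V →₀ ZMod 2) :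
    chainLift f c = 0 := by
  simp [chainLift, Finsupp.linearCombination_apply, hf]

lemma cupCochain_bd (ss : List (V → ZMod 2)) (l : List V) :
    chainLift (cupCochain ss) (simplexBd l) = 0 := by
  induction ss generalizing l with
  | nil =>
    match l with
    | [] => simp [simplexBd]
    | [u] => simp [simplexBd, cupCochain]
    | [u, v] =>
      simp only [simplexBd, Finsupp.mapDomain_single, Finsupp.mapDomain_zero, map_add, add_zero, chainLift_single, cupCochain]
      rfl
    | u :: v :: w :: l =>
      simp only [simplexBd_cons, map_add, chainLift_single, chainLift_cone, cupCochain]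
      rw [chainLift_zero _ fun l => by rfl]
      simp
  | cons s ss ih =>
    match l with
    | [] => simp [simplexBd]
    | [u] => simp [simplexBd, cupCochain]
    | [u, v] => simp [simplexBd, cupCochain]
    | u :: v :: z :: w =>
      have h := ih (v :: z :: w)
      rw [simplexBd_cons, map_add, chainLift_single, chainLift_cone] at h
      rw [simplexBd_cons, simplexBd_cons]
      simp only [map_add, chainLift_single, chainLift_cone, cupCochain]
      rw [chainLift_mul (s u + s v) (fun l => cupCochain ss (v :: l))]
      have h2 := chain_add_self (s z)
      have h3 := chain_add_self (cupCochain ss (z :: w))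
      linear_combination (s u + s v) * h + h2 * cupCochain ss (z :: w)

lemma cupCochain_cons_bd (s : V → ZMod 2) (ss : List (V → ZMod 2)) (t : List V → ZMod 2)
    (ht : ∀ v l, t (v :: l) = s v * cupCochain ss (v :: l)) (ht0 : t [] = 0) (l : List V) :
    chainLift t (simplexBd l) = cupCochain (s :: ss) l := by
  match l with
  | [] => simp [simplexBd, cupCochain]
  | [u] => simp [simplexBd, cupCochain, ht0]
  | u :: v :: w =>
    have h := cupCochain_bd ss (u :: v :: w)
    rw [simplexBd_cons, map_add, chainLift_single, chainLift_cone] at h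
    rw [simplexBd_cons, map_add, chainLift_single, chainLift_cone]
    simp only [ht, cupCochain]
    rw [chainLift_mul (s u) (fun l => cupCochain ss (u :: l))]
    have h3 := chain_add_self (cupCochain ss (v :: w))
    linear_combination (s u) * h - s u * h3

lemma exists_ne_of_cupCochain_ne_zero (ss : List (V → ZMod 2)) (l : List V)
    (h : cupCochain ss l ≠ 0) : ∀ s ∈ ss, ∃ u ∈ l, ∃ v ∈ l, s u ≠ s v := by
  induction ss generalizing l with
  | nil => simp
  | cons s ss ih =>
    match l with
    | [] => simp [cupCochain] at h
    | [u] => simp [cupCochain] at h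
    | u :: v :: l =>
      simp only [cupCochain] at h
      intro t ht
      rcases List.mem_cons.1 ht with rfl | ht
      · refine ⟨u, by simp, v, by simp, fun h' => h ?_⟩
        rw [h', chain_add_self, zero_mul]
      · obtain ⟨a, ha, b, hb, hab⟩ := ih (v :: l) (right_ne_zero_of_mul h) t ht
        exact ⟨a, List.mem_cons_of_mem _ ha, b, List.mem_cons_of_mem _ hb, hab⟩

end BorsukUlam

set_option linter.unusedSectionVars false

section Subdivision

variable {V : Type*}

lemma chainLift_lift {W M : Type*} [AddCommMonoid M] [Module (ZMod 2) M]
    (f : List W → M) (g : List V → (List W →₀ ZMod 2)) (c : List V →₀ ZMod 2) :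
    chainLift f (chainLift g c) = chainLift (fun l => chainLift f (g l)) c := by
  induction c using Finsupp.induction_linear with
  | zero => simp
  | add c d hc hd => simp only [map_add, hc, hd]
  | single l a => simp [Finsupp.linearCombination_single]

lemma chainLift_congr {M : Type*} [AddCommMonoid M] [Module (ZMod 2) M] {f g : List V → M}
    {c : List V →₀ ZMod 2} (h : ∀ l ∈ c.support, f l = g l) : chainLift f c = chainLift g c := by
  simp only [chainLift, Finsupp.linearCombination_apply]
  exact Finset.sum_congr rfl fun l hl => by simp only [h l hl]

lemma supp_chainLift {W : Type*} {p : List V → Prop} {q : List W → Prop}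
    {f : List V → (List W →₀ ZMod 2)} {c : List V →₀ ZMod 2} (hc : ∀ l ∈ c.support, p l)
    (hf : ∀ l, p l → ∀ m ∈ (f l).support, q m) : ∀ m ∈ (chainLift f c).support, q m := by
  classical
  intro m hm
  rw [chainLift, Finsupp.linearCombination_apply] at hm
  obtain ⟨l, hl, hm⟩ := Finset.mem_biUnion.1 (Finsupp.support_sum hm)
  exact hf l (hc l hl) m (Finsupp.support_smul hm)

lemma supp_coneMap {v : V} {c : List V →₀ ZMod 2} :
    ∀ m ∈ (coneMap v c).support, ∃ l ∈ c.support, m = v :: l := by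
  classical
  intro m hm
  rw [Finsupp.lmapDomain_apply] at hm
  obtain ⟨l, hl, rfl⟩ := Finset.mem_image.1 (Finsupp.mapDomain_support hm)
  exact ⟨l, hl, rfl⟩

lemma supp_simplexBd {l : List V} :
    ∀ m ∈ (simplexBd l).support, m.Sublist l ∧ m.length + 1 = l.length := by
  classical
  induction l with
  | nil => simp [simplexBd]
  | cons v l ih =>
    intro m hm
    rw [simplexBd_cons] at hm
    rcases Finset.mem_union.1 (Finsupp.support_add hm) with h | h
    · have := Finset.mem_singleton.1 (Finsupp.support_single_subset h)
      subst this
      simp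
    · obtain ⟨l', hl', rfl⟩ := supp_coneMap m h
      have := ih l' hl'
      exact ⟨this.1.cons_cons v, by simp [this.2]⟩

variable [AddCommGroup V] [Module ℝ V]

/-- Barycentre of an ordered simplex. -/
def barycentre (l : List V) : V := (l.length : ℝ)⁻¹ • l.sum

/-- Barycentric subdivision of a simplex with `n` vertices. -/
def subdiv : ℕ → List V → (List V →₀ ZMod 2)
  | 0, _ => Finsupp.single [] 1
  | n + 1, l => coneMap (barycentre l) (chainLift (subdiv n) (simplexBd l))

lemma bd_subdiv (n : ℕ) (l : List V) :
    chainLift simplexBd (subdiv (n + 1) l) = chainLift (subdiv n) (simplexBd l) := by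
  induction n generalizing l with
  | zero =>
    rw [subdiv, chainLift_bd_cone, chainLift_lift]
    rw [chainLift_zero (fun l : List V => chainLift simplexBd (subdiv 0 l))
      fun l => by simp [subdiv, simplexBd]]
    simp
  | succ n ih =>
    rw [subdiv, chainLift_bd_cone, chainLift_lift]
    simp only [ih]
    rw [← chainLift_lift, chainLift_bd_bd]
    simp

/-- The antipodal map on chains. -/
abbrev antipode : (List V →₀ ZMod 2) →ₗ[ZMod 2] (List V →₀ ZMod 2) :=
  chainLift fun l => Finsupp.single (l.map Neg.neg) 1

lemma antipode_cone (v : V) (c : List V →₀ ZMod 2) :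
    antipode (coneMap v c) = coneMap (-v) (antipode c) := by
  induction c using Finsupp.induction_linear with
  | zero => simp
  | add c d hc hd => simp only [map_add, hc, hd]
  | single l a => simp [Finsupp.linearCombination_single]

lemma bd_map_neg (l : List V) : simplexBd (l.map Neg.neg) = antipode (simplexBd l) := by
  induction l with
  | nil => simp [simplexBd]
  | cons v l ih =>
    rw [List.map_cons, simplexBd_cons, simplexBd_cons, map_add, antipode_cone, ih,
      chainLift_single]

lemma barycentre_map_neg (l : List V) : barycentre (l.map Neg.neg) = - barycentre l := by
  have : (l.map Neg.neg).sum = - l.sum := by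
    induction l with
    | nil => simp
    | cons v l ih => simp [ih]; abel
  simp [barycentre, this]

lemma subdiv_map_neg (n : ℕ) (l : List V) :
    subdiv n (l.map Neg.neg) = antipode (subdiv n l) := by
  induction n generalizing l with
  | zero => simp [subdiv]
  | succ n ih =>
    rw [subdiv, subdiv, antipode_cone, barycentre_map_neg, bd_map_neg, chainLift_lift,
      chainLift_lift]
    simp only [chainLift_single, ih]

lemma subdiv_antipode (n : ℕ) (c : List V →₀ ZMod 2) :
    chainLift (subdiv n) (antipode c) = antipode (chainLift (subdiv n) c) := by
  rw [chainLift_lift, chainLift_lift]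
  simp only [chainLift_single, subdiv_map_neg]

lemma antipode_antipode (c : List V →₀ ZMod 2) : antipode (antipode c) = c := by
  induction c using Finsupp.induction_linear with
  | zero => simp
  | add c d hc hd => simp only [map_add, hc, hd]
  | single l a => simp [Finsupp.linearCombination_single]

/-- Chains of hemispheres of the cross-polytope. -/
def hemisphere (e : ℕ → V) : ℕ → (List V →₀ ZMod 2)
  | 0 => Finsupp.single [e 0] 1
  | j + 1 => coneMap (e (j + 1)) (hemisphere e j + antipode (hemisphere e j))

lemma bd_antipode (c : List V →₀ ZMod 2) :
    chainLift simplexBd (antipode c) = antipode (chainLift simplexBd c) := by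
  rw [chainLift_lift, chainLift_lift]
  simp only [chainLift_single, bd_map_neg]

lemma bd_hemisphere (e : ℕ → V) (j : ℕ) :
    chainLift simplexBd (hemisphere e (j + 1)) = hemisphere e j + antipode (hemisphere e j) := by
  have key : chainLift simplexBd (hemisphere e j + antipode (hemisphere e j)) = 0 := by
    induction j with
    | zero =>
      rw [map_add, bd_antipode]
      simp [hemisphere, simplexBd]
      rw [← Finsupp.single_add]; exact Finsupp.single_zero _
    | succ j ih =>
      have h : chainLift simplexBd (hemisphere e (j + 1)) =
          hemisphere e j + antipode (hemisphere e j) := by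
        rw [hemisphere, chainLift_bd_cone, ih]; simp
      rw [map_add, bd_antipode, h, map_add, antipode_antipode, add_comm (antipode _),
        chain_add_self]
  rw [hemisphere, chainLift_bd_cone, key]; simp

/-- Iterated subdivision of a hemisphere. -/
def fineHemisphere (e : ℕ → V) (N j : ℕ) : List V →₀ ZMod 2 :=
  (chainLift (subdiv (j + 1)))^[N] (hemisphere e j)

lemma fineHemisphere_succ (e : ℕ → V) (N j : ℕ) :
    fineHemisphere e (N + 1) j = chainLift (subdiv (j + 1)) (fineHemisphere e N j) :=
  Function.iterate_succ_apply' _ _ _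

lemma bd_fineHemisphere (e : ℕ → V) (N j : ℕ) :
    chainLift simplexBd (fineHemisphere e N (j + 1)) =
      fineHemisphere e N j + antipode (fineHemisphere e N j) := by
  induction N with
  | zero => exact bd_hemisphere e j
  | succ N ih =>
    rw [fineHemisphere_succ, chainLift_lift]
    simp only [bd_subdiv]
    rw [← chainLift_lift, ih, map_add, subdiv_antipode, fineHemisphere_succ]

lemma fineHemisphere_zero (e : ℕ → V) (N : ℕ) :
    fineHemisphere e N 0 = Finsupp.single [e 0] 1 := by
  induction N with
  | zero => rfl
  | succ N ih =>
    rw [fineHemisphere_succ, ih, chainLift_single]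
    simp [subdiv, simplexBd, barycentre]

lemma cupCochain_map_neg {ss : List (V → ZMod 2)} (hs : ∀ s ∈ ss, ∀ v ≠ 0, s (-v) = s v + 1)
    {l : List V} (hl : ∀ v ∈ l, v ≠ 0) : cupCochain ss (l.map Neg.neg) = cupCochain ss l := by
  induction ss generalizing l with
  | nil =>
    match l with
    | [] => rfl
    | [u] => rfl
    | u :: v :: l => rfl
  | cons s ss ih =>
    match l with
    | [] => rfl
    | [u] => rfl
    | u :: v :: l =>
      have h := ih (fun t ht => hs t (by simp [ht])) (l := v :: l)
        (fun w hw => hl w (List.mem_cons_of_mem _ hw))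
      simp only [List.map_cons, cupCochain] at h ⊢
      rw [h, hs s (by simp) u (hl u (by simp)), hs s (by simp) v (hl v (by simp))]
      have := chain_add_self (1 : ZMod 2)
      linear_combination (cupCochain ss (v :: l)) * this

lemma cupCochain_fineHemisphere (e : ℕ → V) (N : ℕ) (ss : List (V → ZMod 2))
    (hs : ∀ s ∈ ss, ∀ v ≠ 0, s (-v) = s v + 1)
    (h0 : ∀ j ≤ ss.length, ∀ l ∈ (fineHemisphere e N j).support, ∀ v ∈ l, v ≠ 0) :
    chainLift (cupCochain ss) (fineHemisphere e N ss.length) = 1 := by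
  induction ss with
  | nil => simp [fineHemisphere_zero, cupCochain]
  | cons s ss ih =>
    have ih := ih (fun t ht => hs t (by simp [ht])) (fun j hj => h0 j (by simp; omega))
    set t : List V → ZMod 2 := fun l => match l with
      | [] => 0
      | v :: l => s v * cupCochain ss (v :: l) with ht
    have h1 : ∀ l, cupCochain (s :: ss) l = chainLift t (simplexBd l) := fun l =>
      (cupCochain_cons_bd s ss t (fun v l => rfl) rfl l).symm
    rw [List.length_cons, funext h1, ← chainLift_lift, bd_fineHemisphere, map_add, chainLift_lift]
    simp only [chainLift_single]
    rw [← ih]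
    simp only [Finsupp.linearCombination_apply, Finsupp.sum]
    rw [← Finset.sum_add_distrib]
    refine Finset.sum_congr rfl fun l hl => ?_
    have hl0 := h0 ss.length (by simp) l hl
    rw [← smul_add]
    congr 1
    match l with
    | [] => simp [ht, cupCochain_nil]
    | v :: l =>
      have h := cupCochain_map_neg (fun t ht => hs t (List.mem_cons_of_mem _ ht)) hl0
      simp only [List.map_cons] at h
      simp only [ht, List.map_cons, h, hs s (by simp) v (hl0 v (by simp))]
      have := chain_add_self (s v)
      linear_combination (cupCochain ss (v :: l)) * this

end Subdivision

section Mesh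

variable {V : Type*} [NormedAddCommGroup V] [NormedSpace ℝ V]

lemma barycentre_mem_of_convex {S : Set V} (hS : Convex ℝ S) {l : List V} (hl : l ≠ [])
    (h : ∀ v ∈ l, v ∈ S) : barycentre l ∈ S := by
  have key : barycentre l = ∑ i : Fin l.length, (l.length : ℝ)⁻¹ • l.get i := by
    rw [barycentre, ← Finset.smul_sum]
    congr 1
    conv_lhs => rw [← List.ofFn_get l, List.sum_ofFn]
  have hpos : (0 : ℝ) < l.length := by exact_mod_cast List.length_pos_iff.2 hl
  rw [key]
  refine hS.sum_mem (fun i _ => by positivity) ?_ (fun i _ => h _ (List.get_mem l i))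
  simp [hpos.ne']

lemma dist_barycentre_le {l : List V} {r : ℝ} {n : ℕ} (hl : l.length = n + 1)
    (h : ∀ u ∈ l, ∀ v ∈ l, dist u v ≤ r) {v : V} (hv : v ∈ l) :
    dist (barycentre l) v ≤ n / (n + 1) * r := by
  obtain ⟨l₁, l₂, rfl⟩ := List.append_of_mem hv
  have hn : (l₁.length : ℝ) + l₂.length = n := by
    have : l₁.length + l₂.length = n := by simp at hl; omega
    exact_mod_cast this
  have hpos : (0 : ℝ) < n + 1 := by positivity
  have key : ∀ m : List V, (∀ u ∈ m, dist u v ≤ r) →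
      ‖m.sum - (m.length : ℝ) • v‖ ≤ m.length * r := by
    intro m hm
    induction m with
    | nil => simp
    | cons a m ih =>
      have h1 := ih fun u hu => hm u (List.mem_cons_of_mem _ hu)
      have h2 := hm a (by simp)
      rw [dist_eq_norm] at h2
      have : (a :: m).sum - ((a :: m).length : ℝ) • v
          = (a - v) + (m.sum - (m.length : ℝ) • v) := by
        simp [add_smul]; abel
      rw [this]
      refine (norm_add_le _ _).trans ?_
      simp only [List.length_cons, Nat.cast_add, Nat.cast_one]
      linarith
  have h1 := key l₁ fun u hu => h u (by simp [hu]) v hv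
  have h2 := key l₂ fun u hu => h u (by simp [hu]) v hv
  have : barycentre (l₁ ++ v :: l₂) - v = ((n : ℝ) + 1)⁻¹ •
      ((l₁.sum - (l₁.length : ℝ) • v) + (l₂.sum - (l₂.length : ℝ) • v)) := by
    have e : v = ((n : ℝ) + 1)⁻¹ • ((((l₁.length : ℝ) + l₂.length) + 1) • v) := by
      rw [hn, smul_smul, inv_mul_cancel₀ hpos.ne', one_smul]
    calc barycentre (l₁ ++ v :: l₂) - v = ((n : ℝ) + 1)⁻¹ • (l₁ ++ v :: l₂).sum - v := by
          rw [barycentre, hl]; push_cast; rfl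
      _ = ((n : ℝ) + 1)⁻¹ • (l₁ ++ v :: l₂).sum -
          ((n : ℝ) + 1)⁻¹ • ((((l₁.length : ℝ) + l₂.length) + 1) • v) := by rw [← e]
      _ = _ := by
          rw [← smul_sub]
          congr 1
          simp only [List.sum_append, List.sum_cons, add_smul, one_smul]
          abel
  rw [dist_eq_norm, this, norm_smul, norm_inv, Real.norm_of_nonneg hpos.le]
  have h3 := norm_add_le (l₁.sum - (l₁.length : ℝ) • v) (l₂.sum - (l₂.length : ℝ) • v)
  have h4 : ‖(l₁.sum - (l₁.length : ℝ) • v) + (l₂.sum - (l₂.length : ℝ) • v)‖ ≤ n * r := by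
    rw [← hn]; linarith
  calc ((n : ℝ) + 1)⁻¹ * _ ≤ ((n : ℝ) + 1)⁻¹ * (n * r) := by gcongr
    _ = n / (n + 1) * r := by ring

lemma subdiv_supp {S : Set V} (hS : Convex ℝ S) {k : ℕ} {r : ℝ} (n : ℕ) (hn : n ≤ k + 1)
    {l : List V} (hl : l.length = n) (hlS : ∀ v ∈ l, v ∈ S)
    (hr : ∀ u ∈ l, ∀ v ∈ l, dist u v ≤ r) :
    ∀ m ∈ (subdiv n l).support, m.length = n ∧ (∀ v ∈ m, v ∈ S) ∧
      ∀ u ∈ m, ∀ v ∈ m, dist u v ≤ k / (k + 1) * r := by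
  induction n generalizing l S with
  | zero =>
    intro m hm
    have := Finset.mem_singleton.1 (Finsupp.support_single_subset hm)
    subst this
    simp
  | succ n ih =>
    intro m hm
    obtain ⟨m', hm', rfl⟩ := supp_coneMap m hm
    have hlne : l ≠ [] := by rintro rfl; simp at hl
    obtain ⟨v₀, hv₀⟩ := List.exists_mem_of_ne_nil l hlne
    have hr0 : 0 ≤ r := by simpa using hr v₀ hv₀ v₀ hv₀
    have hfrac : (n : ℝ) / (n + 1) ≤ k / (k + 1) := by
      have : (n : ℝ) ≤ k := by exact_mod_cast Nat.le_of_succ_le_succ hn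
      rw [div_le_div_iff₀ (by positivity) (by positivity)]
      nlinarith
    have hb : ∀ v ∈ l, dist (barycentre l) v ≤ k / (k + 1) * r := fun v hv =>
      (dist_barycentre_le hl hr hv).trans (by gcongr)
    have h3 : m'.length = n ∧ (∀ v ∈ m', v ∈ S ∩ Metric.closedBall (barycentre l) (k / (k + 1) * r))
        ∧ ∀ u ∈ m', ∀ v ∈ m', dist u v ≤ k / (k + 1) * r := by
      refine supp_chainLift (p := fun f => f.Sublist l ∧ f.length + 1 = l.length)
        (q := fun m' => m'.length = n ∧
          (∀ v ∈ m', v ∈ S ∩ Metric.closedBall (barycentre l) (k / (k + 1) * r)) ∧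
            ∀ u ∈ m', ∀ v ∈ m', dist u v ≤ k / (k + 1) * r) supp_simplexBd ?_ m' hm'
      rintro f ⟨hf1, hf2⟩
      refine ih (hS.inter (convex_closedBall _ _)) (by omega) (by omega)
        (fun v hv => ⟨hlS v (hf1.subset hv), ?_⟩)
        (fun u hu v hv => hr u (hf1.subset hu) v (hf1.subset hv))
      rw [Metric.mem_closedBall, dist_comm]
      exact hb v (hf1.subset hv)
    obtain ⟨h4, h5, h6⟩ := h3
    refine ⟨by simp [h4], ?_, ?_⟩
    · intro v hv
      rcases List.mem_cons.1 hv with rfl | hv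
      · exact barycentre_mem_of_convex hS hlne hlS
      · exact (h5 v hv).1
    · intro u hu v hv
      rcases List.mem_cons.1 hu with rfl | hu <;> rcases List.mem_cons.1 hv with rfl | hv
      · rw [dist_self]; positivity
      · rw [dist_comm]; exact (h5 v hv).2
      · exact (h5 u hu).2
      · exact h6 u hu v hv

end Mesh

section BU

/-- A closed facet of the cross-polytope. -/
def crossFacet {k : ℕ} (σ : Fin k → ℝ) : Set (Fin k → ℝ) :=
  {a | (∀ i, 0 ≤ σ i * a i) ∧ ∑ i, σ i * a i = 1}

lemma convex_crossFacet {k : ℕ} (σ : Fin k → ℝ) : Convex ℝ (crossFacet σ) := by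
  intro a ha b hb s t hs ht hst
  refine ⟨fun i => ?_, ?_⟩
  · have h1 := mul_nonneg hs (ha.1 i)
    have h2 := mul_nonneg ht (hb.1 i)
    simp only [Pi.add_apply, Pi.smul_apply, smul_eq_mul]
    linarith
  · have h1 := ha.2
    have h2 := hb.2
    calc ∑ i, σ i * (s • a + t • b) i = s * ∑ i, σ i * a i + t * ∑ i, σ i * b i := by
          rw [Finset.mul_sum, Finset.mul_sum, ← Finset.sum_add_distrib]
          refine Finset.sum_congr rfl fun i _ => ?_
          simp only [Pi.add_apply, Pi.smul_apply, smul_eq_mul]; ring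
      _ = 1 := by rw [h1, h2]; linarith

lemma crossFacet_sum_abs {k : ℕ} {σ : Fin k → ℝ} (hσ : ∀ i, σ i = 1 ∨ σ i = -1)
    {a : Fin k → ℝ} (ha : a ∈ crossFacet σ) : ∑ i, |a i| = 1 := by
  rw [← ha.2]
  refine Finset.sum_congr rfl fun i _ => ?_
  rw [← abs_of_nonneg (ha.1 i), abs_mul]
  rcases hσ i with h | h <;> simp [h]

/-- The vertices of the cross-polytope. -/
def crossVertex (k : ℕ) (j : ℕ) : Fin (k + 1) → ℝ := fun i => if (i : ℕ) = j then 1 else 0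

lemma crossVertex_mem {k j : ℕ} (hj : j ≤ k) {σ : Fin (k + 1) → ℝ}
    (h : ∀ i : Fin (k + 1), (i : ℕ) = j → σ i = 1) : crossVertex k j ∈ crossFacet σ := by
  refine ⟨fun i => ?_, ?_⟩
  · unfold crossVertex; split_ifs with hi <;> simp [h i, *]
  · rw [Finset.sum_eq_single ⟨j, Nat.lt_succ_of_le hj⟩]
    · simp [crossVertex, h]
    · intro i _ hi
      have : (i : ℕ) ≠ j := fun h => hi (Fin.ext h)
      simp [crossVertex, this]
    · simp

lemma hemisphere_supp {k j : ℕ} (hj : j ≤ k) :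
    ∀ l ∈ (hemisphere (crossVertex k) j).support, l.length = j + 1 ∧
      ∃ σ : Fin (k + 1) → ℝ, (∀ i, σ i = 1 ∨ σ i = -1) ∧
        (∀ i : Fin (k + 1), j < (i : ℕ) → σ i = 1) ∧ ∀ v ∈ l, v ∈ crossFacet σ ∧
          ∀ i : Fin (k + 1), j < (i : ℕ) → v i = 0 := by
  classical
  induction j with
  | zero =>
    intro l hl
    have := Finset.mem_singleton.1 (Finsupp.support_single_subset hl)
    subst this
    refine ⟨rfl, fun _ => 1, fun _ => Or.inl rfl, fun _ _ => rfl, ?_⟩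
    intro v hv
    rw [List.mem_singleton.1 hv]
    refine ⟨crossVertex_mem hj fun _ _ => rfl, fun i hi => ?_⟩
    simp [crossVertex, hi.ne']
  | succ j ih =>
    have ih := ih (by omega)
    intro l hl
    obtain ⟨m, hm, rfl⟩ := supp_coneMap l hl
    let q : List (Fin (k + 1) → ℝ) → Prop := fun m => m.length = j + 1 ∧
      ∃ σ : Fin (k + 1) → ℝ, (∀ i, σ i = 1 ∨ σ i = -1) ∧
        (∀ i : Fin (k + 1), j < (i : ℕ) → σ i = 1) ∧ ∀ v ∈ m, v ∈ crossFacet σ ∧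
          ∀ i : Fin (k + 1), j < (i : ℕ) → v i = 0
    have hm' : q m := by
      rcases Finset.mem_union.1 (Finsupp.support_add hm) with h | h
      · exact ih m h
      · refine supp_chainLift (p := q) (q := q) ih ?_ m h
        rintro p ⟨hp, σ, h1, h2, h3⟩ q hq
        have := Finset.mem_singleton.1 (Finsupp.support_single_subset hq)
        subst this
        refine ⟨by simp [hp], fun i => if j < (i : ℕ) then 1 else - σ i, fun i => ?_,
          fun i hi => by simp [hi], ?_⟩
        · by_cases hi : j < (i : ℕ)
          · simp [hi]
          · rcases h1 i with h | h <;> simp [hi, h]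
        · intro v hv
          obtain ⟨w, hw, rfl⟩ := List.mem_map.1 hv
          obtain ⟨h4, h5⟩ := h3 w hw
          have e : ∀ i : Fin (k + 1),
              (if j < (i : ℕ) then 1 else - σ i) * (-w) i = σ i * w i := by
            intro i
            split_ifs with h
            · simp [h5 i h]
            · simp
          refine ⟨⟨fun i => by rw [e]; exact h4.1 i, ?_⟩, fun i hi => by simp [h5 i hi]⟩
          rw [Finset.sum_congr rfl fun i _ => e i]
          exact h4.2
    obtain ⟨h0, σ, h1, h2, h3⟩ := hm'
    refine ⟨by simp [h0], σ, h1, fun i hi => h2 i (by omega), ?_⟩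
    intro v hv
    rcases List.mem_cons.1 hv with rfl | hv
    · refine ⟨crossVertex_mem hj fun i hi => h2 i (by omega), fun i hi => ?_⟩
      simp [crossVertex, hi.ne']
    · exact ⟨(h3 v hv).1, fun i hi => (h3 v hv).2 i (by omega)⟩

lemma fineHemisphere_supp {k j : ℕ} (hj : j ≤ k) (N : ℕ) :
    ∀ l ∈ (fineHemisphere (crossVertex k) N j).support, l.length = j + 1 ∧
      (∃ σ : Fin (k + 1) → ℝ, (∀ i, σ i = 1 ∨ σ i = -1) ∧ ∀ v ∈ l, v ∈ crossFacet σ) ∧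
      ∀ u ∈ l, ∀ v ∈ l, dist u v ≤ (k / (k + 1) : ℝ) ^ N * 2 := by
  induction N with
  | zero =>
    intro l hl
    obtain ⟨h1, σ, h2, h3, h4⟩ := hemisphere_supp hj l hl
    refine ⟨h1, ⟨σ, h2, fun v hv => (h4 v hv).1⟩, fun u hu v hv => ?_⟩
    have key : ∀ w ∈ l, ‖w‖ ≤ 1 := by
      intro w hw
      rw [pi_norm_le_iff_of_nonneg zero_le_one]
      intro i
      rw [Real.norm_eq_abs, ← crossFacet_sum_abs h2 (h4 w hw).1]
      exact Finset.single_le_sum (f := fun i => |w i|) (fun _ _ => abs_nonneg _)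
        (Finset.mem_univ i)
    rw [dist_eq_norm, pow_zero, one_mul]
    linarith [norm_sub_le u v, key u hu, key v hv]
  | succ N ih =>
    rw [fineHemisphere_succ]
    refine supp_chainLift ih ?_
    rintro l ⟨h1, ⟨σ, h2, h3⟩, h4⟩ m hm
    obtain ⟨h5, h6, h7⟩ := subdiv_supp (k := k) (convex_crossFacet σ) (j + 1) (by omega) h1 h3 h4 m hm
    exact ⟨h5, ⟨σ, h2, h6⟩, fun u hu v hv => (h7 u hu v hv).trans_eq (by ring)⟩

lemma exists_odd_sign (V : Type*) [AddCommGroup V] [Module ℝ V] :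
    ∃ t : V → ZMod 2, ∀ v ≠ 0, t (-v) = t v + 1 := by
  classical
  refine ⟨fun v => if WellOrderingRel v (-v) then 1 else 0, fun v hv => ?_⟩
  have hne : v ≠ -v := fun h => hv (by
    have h2 : (2 : ℝ) • v = 0 := by
      rw [two_smul]; nth_rewrite 2 [h]; abel
    simpa using h2)
  rcases trichotomous_of WellOrderingRel v (-v) with h | h | h
  · have h' : ¬ WellOrderingRel (-v) v := asymm_of WellOrderingRel h
    simp only [neg_neg, h, h', if_true, if_false]; rfl
  · exact absurd h hne
  · have h' : ¬ WellOrderingRel v (-v) := asymm_of WellOrderingRel h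
    simp only [neg_neg, h, h', if_true, if_false]; rfl

/-- **Borsuk–Ulam**, for the `ℓ¹`-sphere. -/
theorem borsuk_ulam {k : ℕ} (g : (Fin (k + 1) → ℝ) → (Fin k → ℝ)) (hg : Continuous g)
    (hodd : ∀ a, g (-a) = - g a) : ∃ a, ∑ i, |a i| = 1 ∧ g a = 0 := by
  classical
  by_contra! hne
  set K : Set (Fin (k + 1) → ℝ) := {a | ∑ i, |a i| = 1} with hK
  have hKc : IsCompact K := by
    refine (isCompact_closedBall (0 : Fin (k + 1) → ℝ) 1).of_isClosed_subset
      (isClosed_eq (by fun_prop) continuous_const) fun a ha => ?_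
    rw [mem_closedBall_zero_iff, pi_norm_le_iff_of_nonneg zero_le_one]
    intro i
    rw [Real.norm_eq_abs, ← (show ∑ i, |a i| = 1 from ha)]
    exact Finset.single_le_sum (f := fun i => |a i|) (fun _ _ => abs_nonneg _)
      (Finset.mem_univ i)
  have hKne : K.Nonempty :=
    ⟨crossVertex k 0, crossFacet_sum_abs (σ := fun _ => 1) (fun _ => Or.inl rfl)
      (crossVertex_mem (Nat.zero_le k) fun _ _ => rfl)⟩
  obtain ⟨a₀, ha₀, hmin⟩ := hKc.exists_isMinOn hKne hg.norm.continuousOn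
  have hm : 0 < ‖g a₀‖ := norm_pos_iff.2 (hne a₀ ha₀)
  obtain ⟨η, hη, hunif⟩ := Metric.uniformContinuousOn_iff.1
    (hKc.uniformContinuousOn_of_continuous hg.continuousOn) (‖g a₀‖ / 2) (half_pos hm)
  obtain ⟨N, hN⟩ := exists_pow_lt_of_lt_one (half_pos hη)
    (show (k / (k + 1) : ℝ) < 1 by rw [div_lt_one (by positivity)]; linarith)
  obtain ⟨t, ht⟩ := exists_odd_sign (Fin (k + 1) → ℝ)
  set s : Fin k → (Fin (k + 1) → ℝ) → ZMod 2 := fun i a =>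
    if 0 < g a i then 1 else if g a i < 0 then 0 else t a with hs
  have hsodd : ∀ i, ∀ v ≠ 0, s i (-v) = s i v + 1 := by
    intro i v hv
    rcases lt_trichotomy (g v i) 0 with h | h | h
    · simp [hs, hodd, h, not_lt.2 h.le]
    · simp [hs, hodd, h, ht v hv]
    · simp [hs, hodd, h, not_lt.2 h.le]; rfl
  have h1 := cupCochain_fineHemisphere (crossVertex k) N (List.ofFn s)
    (by
      intro σ hσ v hv
      obtain ⟨i, rfl⟩ := (List.mem_ofFn' s σ).1 hσ
      exact hsodd i v hv)
    (by
      intro j hj l hl v hv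
      rw [List.length_ofFn] at hj
      obtain ⟨-, ⟨σ, h1, h2⟩, -⟩ := fineHemisphere_supp hj N l hl
      rintro rfl
      have := crossFacet_sum_abs h1 (h2 0 hv)
      simp at this)
  rw [List.length_ofFn] at h1
  obtain ⟨l, hl, hl1⟩ : ∃ l ∈ (fineHemisphere (crossVertex k) N k).support,
      cupCochain (List.ofFn s) l ≠ 0 := by
    by_contra! h
    rw [chainLift_congr (g := fun _ => 0) h, chainLift_zero _ fun _ => rfl] at h1
    exact zero_ne_one h1
  obtain ⟨hlen, ⟨σ, hσ, hlσ⟩, hdist⟩ := fineHemisphere_supp le_rfl N l hl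
  have hlK : ∀ v ∈ l, v ∈ K := fun v hv => crossFacet_sum_abs hσ (hlσ v hv)
  obtain ⟨x, hx⟩ := List.exists_mem_of_ne_nil l (by rintro rfl; simp at hlen)
  have hclose : ∀ v ∈ l, ∀ i, |g x i - g v i| < ‖g a₀‖ / 2 := by
    intro v hv i
    have h2 := hunif x (hlK x hx) v (hlK v hv) (by linarith [hdist x hx v hv])
    rw [dist_eq_norm] at h2
    exact (norm_le_pi_norm (g x - g v) i).trans_lt h2
  have h3 : ‖g x‖ ≤ ‖g a₀‖ / 2 := by
    rw [pi_norm_le_iff_of_nonneg (half_pos hm).le]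
    intro i
    obtain ⟨u, hu, v, hv, huv⟩ := exists_ne_of_cupCochain_ne_zero _ l hl1 (s i)
      ((List.mem_ofFn' s (s i)).2 ⟨i, rfl⟩)
    have hu' := abs_lt.1 (hclose u hu i)
    have hv' := abs_lt.1 (hclose v hv i)
    have hsgn : (g u i ≤ 0 ∧ 0 ≤ g v i) ∨ (0 ≤ g u i ∧ g v i ≤ 0) := by
      by_contra! hcon
      apply huv
      simp only [hs]
      rcases lt_trichotomy (g u i) 0 with h | h | h
      · have := hcon.1 h.le
        simp [h, not_lt.2 h.le, this, not_lt.2 this.le]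
      · have h3 := hcon.1 h.le
        have h4 := hcon.2 h.ge
        linarith
      · have := hcon.2 h.le
        simp [h, this]
    rw [Real.norm_eq_abs, abs_le]
    rcases hsgn with h | h <;> constructor <;> linarith [hu'.1, hu'.2, hv'.1, hv'.2, h.1, h.2]
  have h4 : ‖g a₀‖ ≤ ‖g x‖ := hmin (hlK x hx)
  linarith

end BU

/-- Euclidean four-space. -/
abbrev E4 : Type := EuclideanSpace ℝ (Fin 4)

/-- Real polynomials in four variables. -/
abbrev Poly4 : Type := MvPolynomial (Fin 4) ℝ

/-- Evaluation of a polynomial at a point of `E4`. -/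
abbrev ev (x : E4) : Poly4 →+* ℝ := MvPolynomial.eval x.ofLp

lemma continuous_ev (P : Poly4) : Continuous fun x : E4 => ev x P :=
  (MvPolynomial.continuous_eval P).comp (PiLp.continuous_ofLp 2 _)

section HamSandwich

/-- An odd approximation to the sign function. -/
def softSign (s : ℝ) : ℝ := s / (1 + |s|)

lemma continuous_softSign : Continuous softSign :=
  continuous_id.div (by fun_prop) fun s => by positivity

lemma softSign_neg (s : ℝ) : softSign (-s) = - softSign s := by
  simp [softSign, neg_div]

lemma abs_softSign_le (s : ℝ) : |softSign s| ≤ 1 := by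
  rw [softSign, abs_div, div_le_one (by positivity)]
  exact (le_add_of_nonneg_left zero_le_one).trans (le_abs_self _)

lemma tendsto_softSign : Filter.Tendsto softSign Filter.atTop (nhds 1) := by
  have h3 : Filter.Tendsto (fun s : ℝ => 1 - (1 + s)⁻¹) Filter.atTop (nhds (1 - 0)) :=
    tendsto_const_nhds.sub (tendsto_inv_atTop_zero.comp
      (Filter.tendsto_atTop_add_const_left _ _ Filter.tendsto_id))
  rw [sub_zero] at h3
  refine h3.congr' ?_
  filter_upwards [Filter.eventually_ge_atTop 0] with s hs
  rw [softSign, abs_of_nonneg hs]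
  field_simp
  ring

lemma integrable_softSign_comp (μ : Measure E4) [IsFiniteMeasure μ] (P : Poly4) :
    Integrable (fun x => softSign (ev x P)) μ :=
  Integrable.of_bound (continuous_softSign.comp (continuous_ev P)).aestronglyMeasurable 1
    (Filter.Eventually.of_forall fun x => by
      rw [Real.norm_eq_abs]; exact abs_softSign_le _)

lemma two_mul_measure_pos_le {μ : Measure E4} [IsFiniteMeasure μ] {p : ℕ → Poly4} {P : Poly4}
    (hp : ∀ x : E4, Filter.Tendsto (fun n => ev x (p n)) Filter.atTop (nhds (ev x P)))
    (h0 : ∃ φ : ℕ → ℕ, StrictMono φ ∧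
      ∀ n, ∫ x, softSign (ev x (MvPolynomial.C (φ n : ℝ) * p n)) ∂μ = 0) :
    2 * μ {x | 0 < ev x P} ≤ μ Set.univ := by
  obtain ⟨φ, hφ, h0⟩ := h0
  set S : Set E4 := {x | 0 < ev x P} with hS
  have hSm : MeasurableSet S := (isOpen_lt continuous_const (continuous_ev P)).measurableSet
  have hlim : Filter.Tendsto
      (fun n => ∫ x in S, softSign (ev x (MvPolynomial.C (φ n : ℝ) * p n)) ∂μ)
      Filter.atTop (nhds (∫ x in S, (1 : ℝ) ∂μ)) := by
    refine tendsto_integral_of_dominated_convergence (fun _ => 1)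
      (fun n => (integrable_softSign_comp _ _).aestronglyMeasurable) (integrable_const _)
      (fun n => Filter.Eventually.of_forall fun x => by
        rw [Real.norm_eq_abs]; exact abs_softSign_le _) ?_
    refine (ae_restrict_iff' hSm).2 (Filter.Eventually.of_forall fun x hx => ?_)
    simp only [map_mul, MvPolynomial.eval_C]
    have h1 : Filter.Tendsto (fun n => (φ n : ℝ) * ev x (p n)) Filter.atTop Filter.atTop :=
      (tendsto_natCast_atTop_atTop.comp hφ.tendsto_atTop).atTop_mul_pos hx (hp x)
    exact tendsto_softSign.comp h1
  have hle : ∀ n, ∫ x in S, softSign (ev x (MvPolynomial.C (φ n : ℝ) * p n)) ∂μ ≤ μ.real Sᶜ := by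
    intro n
    have h1 := integral_add_compl hSm (integrable_softSign_comp μ (MvPolynomial.C (φ n : ℝ) * p n))
    rw [h0 n] at h1
    have h2 : ‖∫ x in Sᶜ, softSign (ev x (MvPolynomial.C (φ n : ℝ) * p n)) ∂μ‖ ≤ 1 * μ.real Sᶜ :=
      norm_setIntegral_le_of_norm_le_const (measure_lt_top _ _)
        (fun x _ => abs_softSign_le _)
    rw [one_mul, Real.norm_eq_abs] at h2
    linarith [(abs_le.1 h2).1]
  have h3 : μ.real S ≤ μ.real Sᶜ := by
    have := le_of_tendsto hlim (Filter.Eventually.of_forall hle)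
    simpa using this
  have h4 : μ S ≤ μ Sᶜ := (ENNReal.toReal_le_toReal (measure_ne_top _ _) (measure_ne_top _ _)).1 h3
  calc 2 * μ S = μ S + μ S := two_mul _
    _ ≤ μ S + μ Sᶜ := by gcongr
    _ = μ Set.univ := measure_add_measure_compl hSm

/-- The polynomial ham sandwich theorem. -/
theorem ham_sandwich {k : ℕ} (μ : Fin k → Measure E4) [∀ j, IsFiniteMeasure (μ j)]
    (q : Fin (k + 1) → Poly4) :
    ∃ a : Fin (k + 1) → ℝ, a ≠ 0 ∧ ∀ j,
      2 * μ j {x | 0 < ev x (∑ i, MvPolynomial.C (a i) * q i)} ≤ μ j Set.univ ∧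
      2 * μ j {x | 0 < ev x (-∑ i, MvPolynomial.C (a i) * q i)} ≤ μ j Set.univ := by
  set p : (Fin (k + 1) → ℝ) → Poly4 := fun a => ∑ i, MvPolynomial.C (a i) * q i with hp
  have hpe : ∀ a x, ev x (p a) = ∑ i, a i * ev x (q i) := fun a x => by simp [hp]
  have hBU : ∀ n : ℕ, ∃ a : Fin (k + 1) → ℝ, ∑ i, |a i| = 1 ∧
      ∀ j, ∫ x, softSign (ev x (MvPolynomial.C (n : ℝ) * p a)) ∂(μ j) = 0 := by
    intro n
    obtain ⟨a, ha, ha0⟩ := borsuk_ulam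
      (fun a j => ∫ x, softSign (ev x (MvPolynomial.C (n : ℝ) * p a)) ∂(μ j))
      (by
        refine continuous_pi fun j => ?_
        refine continuous_of_dominated (bound := fun _ => 1)
          (fun a => (integrable_softSign_comp _ _).aestronglyMeasurable)
          (fun a => Filter.Eventually.of_forall fun x => by
            rw [Real.norm_eq_abs]; exact abs_softSign_le _) (integrable_const _)
          (Filter.Eventually.of_forall fun x => ?_)
        refine continuous_softSign.comp ?_
        simp only [map_mul, MvPolynomial.eval_C, hpe]
        fun_prop)
      (by
        intro a
        funext j
        simp only [Pi.neg_apply, ← integral_neg]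
        refine integral_congr_ae (Filter.Eventually.of_forall fun x => ?_)
        simp only [← softSign_neg, map_mul, MvPolynomial.eval_C, hpe, Pi.neg_apply, neg_mul,
          Finset.sum_neg_distrib, mul_neg])
    exact ⟨a, ha, fun j => congrFun ha0 j⟩
  choose a ha ha0 using hBU
  have hb : ∀ n, a n ∈ Metric.closedBall (0 : Fin (k + 1) → ℝ) 1 := by
    intro n
    rw [mem_closedBall_zero_iff, pi_norm_le_iff_of_nonneg zero_le_one]
    intro i
    rw [Real.norm_eq_abs, ← ha n]
    exact Finset.single_le_sum (f := fun i => |a n i|) (fun _ _ => abs_nonneg _)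
      (Finset.mem_univ i)
  obtain ⟨b, -, φ, hφ, hlim⟩ := (isCompact_closedBall (0 : Fin (k + 1) → ℝ) 1).tendsto_subseq hb
  have hlimi : ∀ i, Filter.Tendsto (fun n => a (φ n) i) Filter.atTop (nhds (b i)) :=
    fun i => (tendsto_pi_nhds.1 hlim) i
  have hpt : ∀ x, Filter.Tendsto (fun n => ev x (p (a (φ n)))) Filter.atTop (nhds (ev x (p b))) := by
    intro x
    simp only [hpe]
    exact tendsto_finsetSum _ fun i _ => (hlimi i).mul_const _
  refine ⟨b, ?_, fun j => ⟨?_, ?_⟩⟩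
  · rintro rfl
    have : Filter.Tendsto (fun n => ∑ i, |a (φ n) i|) Filter.atTop
        (nhds (∑ i : Fin (k + 1), |(0 : Fin (k + 1) → ℝ) i|)) :=
      tendsto_finsetSum _ fun i _ => (hlimi i).abs
    simp only [ha] at this
    have := tendsto_nhds_unique this tendsto_const_nhds
    simp at this
  · exact two_mul_measure_pos_le hpt ⟨φ, hφ, fun n => ha0 (φ n) j⟩
  · refine two_mul_measure_pos_le (p := fun n => - p (a (φ n))) ?_ ⟨φ, hφ, fun n => ?_⟩
    · intro x
      simpa only [map_neg] using (hpt x).neg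
    · have := ha0 (φ n) j
      simp only [mul_neg, map_neg, softSign_neg, integral_neg, this, neg_zero]

end HamSandwich

section Partition

/-- The sign attached to a Boolean. -/
def boolSign (b : Bool) : ℝ := if b then 1 else -1

/-- The cell where the first `L` polynomials have prescribed signs. -/
def signCell (Ps : ℕ → Poly4) {L : ℕ} (σ : Fin L → Bool) : Set E4 :=
  {x | ∀ l : Fin L, 0 < boolSign (σ l) * ev x (Ps l)}

lemma isOpen_signCell (Ps : ℕ → Poly4) {L : ℕ} (σ : Fin L → Bool) : IsOpen (signCell Ps σ) := by
  simp only [signCell, Set.ofPred_forall]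
  exact isOpen_iInter_of_finite fun l =>
    isOpen_lt continuous_const (continuous_const.mul (continuous_ev _))

lemma exists_coordinate_space {n : ℕ} (e : Fin n ↪ Fin 4) (l : ℕ) (hn : 0 < n) :
    ∃ q : Fin (2 ^ l + 1) → Poly4, ∀ a : Fin (2 ^ l + 1) → ℝ, a ≠ 0 →
      (∑ i, MvPolynomial.C (a i) * q i) ≠ 0 ∧
      (∑ i, MvPolynomial.C (a i) * q i).totalDegree ≤ n * 2 ^ (l / n + 1) ∧
      ∀ j ∉ Set.range e, MvPolynomial.pderiv j (∑ i, MvPolynomial.C (a i) * q i) = 0 := by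
  classical
  set m := 2 ^ (l / n + 1) with hm
  have hcard : Fintype.card (Fin (2 ^ l + 1)) ≤ Fintype.card (Fin n → Fin (m + 1)) := by
    rw [Fintype.card_fin, Fintype.card_fun, Fintype.card_fin, Fintype.card_fin]
    have h1 : l ≤ n * (l / n + 1) := by
      have := Nat.div_add_mod l n
      have := Nat.mod_lt l hn
      rw [mul_add]; omega
    calc 2 ^ l + 1 ≤ m ^ n + 1 := by
          rw [hm, ← pow_mul, mul_comm]
          gcongr
          · norm_num
      _ ≤ (m + 1) ^ n := Nat.pow_lt_pow_left (Nat.lt_succ_self m) hn.ne'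
  obtain ⟨s⟩ := Function.Embedding.nonempty_of_card_le hcard
  set ex : Fin (2 ^ l + 1) → (Fin n →₀ ℕ) := fun i =>
    Finsupp.equivFunOnFinite.symm fun t => (s i t : ℕ) with hex
  have hexinj : Function.Injective ex := by
    intro i j hij
    apply s.injective
    funext t
    have := DFunLike.congr_fun hij t
    simpa [hex, Fin.ext_iff] using this
  set Q : (Fin (2 ^ l + 1) → ℝ) → MvPolynomial (Fin n) ℝ := fun a =>
    ∑ i, MvPolynomial.monomial (ex i) (a i) with hQ
  have hsum : ∀ a : Fin (2 ^ l + 1) → ℝ,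
      ∑ i, MvPolynomial.C (a i) * MvPolynomial.rename e (MvPolynomial.monomial (ex i) (1 : ℝ)) =
        MvPolynomial.rename e (Q a) := by
    intro a
    rw [hQ, map_sum]
    refine Finset.sum_congr rfl fun i _ => ?_
    have h1 : MvPolynomial.monomial (ex i) (a i) =
        MvPolynomial.C (a i) * MvPolynomial.monomial (ex i) (1 : ℝ) := by
      rw [MvPolynomial.C_mul_monomial, mul_one]
    rw [h1, map_mul, MvPolynomial.rename_C]
  refine ⟨fun i => MvPolynomial.rename e (MvPolynomial.monomial (ex i) (1 : ℝ)), fun a ha => ?_⟩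
  rw [hsum]
  refine ⟨fun h0 => ha ?_, ?_, ?_⟩
  · have h1 : Q a = 0 := by
      apply MvPolynomial.rename_injective e e.injective
      rw [h0, map_zero]
    funext i
    have h2 := congrArg (MvPolynomial.coeff (ex i)) h1
    rw [hQ, MvPolynomial.coeff_sum] at h2
    simp only [MvPolynomial.coeff_monomial, MvPolynomial.coeff_zero, hexinj.eq_iff] at h2
    simpa using h2
  · refine (MvPolynomial.totalDegree_rename_le _ _).trans ?_
    refine MvPolynomial.totalDegree_finsetSum_le fun i _ => ?_
    refine (MvPolynomial.totalDegree_monomial_le _ _).trans ?_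
    rw [Finsupp.sum_fintype _ _ fun _ => rfl]
    calc ∑ t, ex i t ≤ ∑ _t : Fin n, m := Finset.sum_le_sum fun t _ => by
          have := (s i t).is_lt
          simp only [hex, Finsupp.equivFunOnFinite_symm_apply_apply]
          omega
      _ = n * m := by simp
  · intro j hj
    apply MvPolynomial.pderiv_eq_zero_of_notMem_vars
    intro hj'
    have := MvPolynomial.vars_rename e (Q a) hj'
    obtain ⟨t, -, rfl⟩ := Finset.mem_image.1 this
    exact hj ⟨t, rfl⟩

lemma exists_bisections {n : ℕ} (e : Fin n ↪ Fin 4) (hn : 0 < n) (μ : Measure E4)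
    [IsFiniteMeasure μ] (L : ℕ) : ∃ Ps : ℕ → Poly4,
      (∀ l < L, Ps l ≠ 0 ∧ (Ps l).totalDegree ≤ n * 2 ^ (l / n + 1) ∧
        ∀ j ∉ Set.range e, MvPolynomial.pderiv j (Ps l) = 0) ∧
      ∀ σ : Fin L → Bool, 2 ^ L * μ (signCell Ps σ) ≤ μ Set.univ := by
  classical
  induction L with
  | zero =>
    refine ⟨fun _ => 0, by simp, fun σ => ?_⟩
    simpa using measure_mono (Set.subset_univ _)
  | succ L ih =>
    obtain ⟨Ps, h1, h2⟩ := ih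
    obtain ⟨q, hq⟩ := exists_coordinate_space e L hn
    have hc : Fintype.card (Fin L → Bool) = 2 ^ L := by simp
    let eq := Fintype.equivFinOfCardEq hc
    obtain ⟨a, ha, hμ⟩ := ham_sandwich (fun j => μ.restrict (signCell Ps (eq.symm j))) q
    set P := ∑ i, MvPolynomial.C (a i) * q i with hP
    set Ps' : ℕ → Poly4 := fun l => if l = L then P else Ps l with hPs'
    have hlt : ∀ l < L, Ps' l = Ps l := fun l hl => by simp [hPs', hl.ne]
    have hL : Ps' L = P := by simp [hPs']
    refine ⟨Ps', fun l hl => ?_, fun σ => ?_⟩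
    · rcases Nat.lt_succ_iff_lt_or_eq.1 hl with h | rfl
      · rw [hlt l h]; exact h1 l h
      · rw [hL]; exact hq a ha
    · set τ : Fin L → Bool := fun l => σ l.castSucc with hτ
      have hcell : signCell Ps' σ =
          {x | 0 < boolSign (σ (Fin.last L)) * ev x P} ∩ signCell Ps τ := by
        ext x
        simp only [signCell, Set.mem_ofPred_eq, Set.mem_inter_iff, Fin.forall_fin_succ',
          Fin.val_castSucc, Fin.val_last, hL, hlt _ (Fin.is_lt _), hτ]
        exact and_comm
      have hms : MeasurableSet {x : E4 | 0 < boolSign (σ (Fin.last L)) * ev x P} :=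
        (isOpen_lt continuous_const (continuous_const.mul (continuous_ev _))).measurableSet
      have key : 2 * μ (signCell Ps' σ) ≤ μ (signCell Ps τ) := by
        have h3 := hμ (eq τ)
        simp only [Equiv.symm_apply_apply, Measure.restrict_apply_univ] at h3
        rw [hcell, ← Measure.restrict_apply hms]
        cases hσ : σ (Fin.last L)
        · simpa [boolSign] using h3.2
        · simpa [boolSign] using h3.1
      calc 2 ^ (L + 1) * μ (signCell Ps' σ) = 2 ^ L * (2 * μ (signCell Ps' σ)) := by ring
        _ ≤ 2 ^ L * μ (signCell Ps τ) := by gcongr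
        _ ≤ μ Set.univ := h2 τ

/-- Polynomial partitioning with `2 ^ (n * h)` cells, using only `n` of the coordinates. -/
theorem exists_partition {n : ℕ} (e : Fin n ↪ Fin 4) (hn : 0 < n) (μ : Measure E4)
    [IsFiniteMeasure μ] (h : ℕ) : ∃ Ps : ℕ → Poly4,
      (∏ l ∈ Finset.range (n * h), Ps l) ≠ 0 ∧
      (∏ l ∈ Finset.range (n * h), Ps l).totalDegree ≤ 32 * 2 ^ h ∧
      (∀ j ∉ Set.range e, MvPolynomial.pderiv j (∏ l ∈ Finset.range (n * h), Ps l) = 0) ∧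
      ∀ σ : Fin (n * h) → Bool, 2 ^ (n * h) * μ (signCell Ps σ) ≤ μ Set.univ := by
  obtain ⟨Ps, h1, h2⟩ := exists_bisections e hn μ (n * h)
  have hn4 : n ≤ 4 := by simpa using Fintype.card_le_of_embedding e
  refine ⟨Ps, ?_, ?_, ?_, h2⟩
  · exact Finset.prod_ne_zero_iff.2 fun l hl => (h1 l (Finset.mem_range.1 hl)).1
  · have hblock : ∀ h : ℕ, ∑ l ∈ Finset.range (n * h), n * 2 ^ (l / n + 1) ≤ 2 * n * n * 2 ^ h := by
      intro h
      induction h with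
      | zero => simp
      | succ h ih =>
        rw [Nat.mul_succ, Finset.sum_range_add]
        have : ∑ x ∈ Finset.range n, n * 2 ^ ((n * h + x) / n + 1) = n * n * 2 ^ (h + 1) := by
          rw [Finset.sum_congr rfl (g := fun _ => n * 2 ^ (h + 1))]
          · simp; ring
          · intro x hx
            rw [Nat.mul_add_div hn, Nat.div_eq_of_lt (Finset.mem_range.1 hx), add_zero]
        rw [this]
        calc _ ≤ 2 * n * n * 2 ^ h + n * n * 2 ^ (h + 1) := by gcongr
          _ = 2 * n * n * 2 ^ (h + 1) := by ring
    calc _ ≤ ∑ l ∈ Finset.range (n * h), (Ps l).totalDegree :=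
          MvPolynomial.totalDegree_finsetProd _ _
      _ ≤ ∑ l ∈ Finset.range (n * h), n * 2 ^ (l / n + 1) :=
          Finset.sum_le_sum fun l hl => (h1 l (Finset.mem_range.1 hl)).2.1
      _ ≤ 2 * n * n * 2 ^ h := hblock h
      _ ≤ 2 * 4 * 4 * 2 ^ h := by gcongr
  · intro j hj
    refine Finset.prod_induction _ (fun p => MvPolynomial.pderiv j p = 0) ?_ ?_
      fun l hl => (h1 l (Finset.mem_range.1 hl)).2.2 j hj
    · intro p q hp hq
      rw [MvPolynomial.pderiv_mul, hp, hq]; simp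
    · simp

end Partition

section Lines

/-- Restriction of a polynomial to the line `t ↦ y + t v`. -/
def lineRes (y v : E4) : Poly4 →ₐ[ℝ] Polynomial ℝ :=
  MvPolynomial.aeval fun i => Polynomial.C (y i) + Polynomial.C (v i) * Polynomial.X

lemma eval_lineRes (y v : E4) (P : Poly4) (t : ℝ) :
    (lineRes y v P).eval t = ev (y + t • v) P := by
  induction P using MvPolynomial.induction_on with
  | C a => simp [lineRes]
  | add p q hp hq => simp [hp, hq]
  | mul_X p i hp =>
    rw [map_mul, map_mul, Polynomial.eval_mul, hp]
    simp [lineRes, mul_comm t]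

lemma natDegree_lineRes_le (y v : E4) (P : Poly4) : (lineRes y v P).natDegree ≤ P.totalDegree := by
  have h : ∀ i, (Polynomial.C (y i) + Polynomial.C (v i) * Polynomial.X : Polynomial ℝ).natDegree ≤ 1 :=
    fun i => by
      rw [add_comm]; exact Polynomial.natDegree_linear_le
  have := MvPolynomial.aeval_natDegree_le (m := P.totalDegree) P le_rfl _ h
  simpa [lineRes] using this

lemma derivative_lineRes (y v : E4) (P : Poly4) :
    (lineRes y v P).derivative =
      ∑ i, Polynomial.C (v i) * lineRes y v (MvPolynomial.pderiv i P) := by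
  classical
  induction P using MvPolynomial.induction_on with
  | C a => simp [lineRes]
  | add p q hp hq => simp [hp, hq, mul_add, Finset.sum_add_distrib]
  | mul_X p j hp =>
    have hX : (lineRes y v (MvPolynomial.X j)).derivative = Polynomial.C (v j) := by
      simp [lineRes]
    have hpd : ∀ i, lineRes y v (MvPolynomial.pderiv i (p * MvPolynomial.X j)) =
        lineRes y v (MvPolynomial.pderiv i p) * lineRes y v (MvPolynomial.X j) +
          lineRes y v p * (if i = j then 1 else 0) := by
      intro i
      rw [MvPolynomial.pderiv_mul, map_add, map_mul, map_mul]
      congr 2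
      by_cases hij : i = j
      · subst hij; simp
      · rw [MvPolynomial.pderiv_X_of_ne (Ne.symm hij)]; simp [hij]
    rw [map_mul (lineRes y v), Polynomial.derivative_mul, hp, hX]
    simp only [hpd]
    generalize lineRes y v (MvPolynomial.X j) = x
    generalize lineRes y v p = q
    simp only [mul_add, Finset.sum_add_distrib, Finset.sum_mul]
    refine congrArg₂ (· + ·) (Finset.sum_congr rfl fun i _ => by ring) ?_
    simp [mul_comm]

lemma hasDerivAt_ev_line (y v : E4) (P : Poly4) (t : ℝ) :
    HasDerivAt (fun t => ev (y + t • v) P)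
      (∑ i, v i * ev (y + t • v) (MvPolynomial.pderiv i P)) t := by
  have h := (lineRes y v P).hasDerivAt t
  rw [derivative_lineRes] at h
  simp only [Polynomial.eval_finsetSum, Polynomial.eval_mul, Polynomial.eval_C, eval_lineRes] at h
  exact h

end Lines

section Good

/-- Iterated partial derivatives along a word. -/
def wordDeriv (P : Poly4) : List (Fin 4) → Poly4
  | [] => P
  | i :: w => MvPolynomial.pderiv i (wordDeriv P w)

lemma totalDegree_pderiv_le {σ : Type*} (p : MvPolynomial σ ℝ) (i : σ) :
    (MvPolynomial.pderiv i p).totalDegree ≤ p.totalDegree - 1 := by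
  classical
  conv_lhs => rw [p.as_sum, map_sum]
  refine MvPolynomial.totalDegree_finsetSum_le fun s hs => ?_
  rw [MvPolynomial.pderiv_monomial]
  by_cases h : s i = 0
  · simp [h]
  · refine (MvPolynomial.totalDegree_monomial_le _ _).trans ?_
    have h1 := MvPolynomial.le_totalDegree hs
    have h2 : Finsupp.single i 1 ≤ s := Finsupp.single_le_iff.2 (Nat.one_le_iff_ne_zero.2 h)
    have h3 : s = (s - Finsupp.single i 1) + Finsupp.single i 1 := (tsub_add_cancel_of_le h2).symm
    have h4 : (s.sum fun _ e => e) = ((s - Finsupp.single i 1).sum fun _ e => e) + 1 := by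
      conv_lhs => rw [h3]
      rw [Finsupp.sum_add_index' (fun _ => rfl) (fun _ _ _ => rfl),
        Finsupp.sum_single_index rfl]
    change ((s - Finsupp.single i 1).sum fun _ e => e) ≤ _
    omega

lemma totalDegree_wordDeriv_le (P : Poly4) (w : List (Fin 4)) :
    (wordDeriv P w).totalDegree ≤ P.totalDegree - w.length := by
  induction w with
  | nil => simp [wordDeriv]
  | cons i w ih =>
    have := totalDegree_pderiv_le (wordDeriv P w) i
    simp only [wordDeriv, List.length_cons]
    omega

lemma wordDeriv_eq_zero (P : Poly4) (w : List (Fin 4)) (h : P.totalDegree < w.length) :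
    wordDeriv P w = 0 := by
  match w with
  | [] => simp at h
  | i :: w =>
    have h1 := totalDegree_wordDeriv_le P w
    have h2 : (wordDeriv P w).totalDegree = 0 := by
      simp only [List.length_cons] at h
      omega
    rw [wordDeriv, MvPolynomial.totalDegree_eq_zero_iff_eq_C.1 h2]
    simp

/-- Points near which all derivatives of `P` vary slowly at scale `δ`. -/
def GoodPt (K δ : ℝ) (P : Poly4) (y : E4) : Prop :=
  ∀ w i, K * δ * |ev y (wordDeriv P (i :: w))| ≤ |ev y (wordDeriv P w)|

lemma abs_coord_le (h : E4) (i : Fin 4) : |h i| ≤ ‖h‖ := by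
  simpa using PiLp.norm_apply_le h i

lemma GoodPt.abs_sub_le {K δ : ℝ} {P : Poly4} {y : E4} (hy : GoodPt K δ P y) (hK : 24 ≤ K)
    (hδ : 0 < δ) (w : List (Fin 4)) {x : E4} (hx : dist x y ≤ 2 * δ) :
    |ev x (wordDeriv P w) - ev y (wordDeriv P w)| ≤ |ev y (wordDeriv P w)| / 2 := by
  obtain ⟨n, hn⟩ : ∃ n, P.totalDegree < w.length + n := ⟨P.totalDegree + 1, by omega⟩
  induction n generalizing w x with
  | zero => simp [wordDeriv_eq_zero P w hn]
  | succ n ih =>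
    set h : E4 := x - y with hh
    have hnorm : ‖h‖ ≤ 2 * δ := by rw [hh, ← dist_eq_norm]; exact hx
    set B := |ev y (wordDeriv P w)| with hB
    have hbound : ∀ t ∈ Set.Icc (0 : ℝ) 1,
        ‖∑ i, h i * ev (y + t • h) (MvPolynomial.pderiv i (wordDeriv P w))‖ ≤ B / 2 := by
      intro t ht
      have hd : dist (y + t • h) y ≤ 2 * δ := by
        rw [dist_eq_norm, add_sub_cancel_left, norm_smul, Real.norm_of_nonneg ht.1]
        calc t * ‖h‖ ≤ 1 * ‖h‖ := by gcongr; exact ht.2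
          _ ≤ 2 * δ := by linarith
      have hterm : ∀ i, ‖h i * ev (y + t • h) (MvPolynomial.pderiv i (wordDeriv P w))‖ ≤ B / 8 := by
        intro i
        have h1 := ih (i :: w) hd (by simp only [List.length_cons]; omega)
        have h2 := hy w i
        set u := ev y (wordDeriv P (i :: w)) with hu
        have h3 : |ev (y + t • h) (wordDeriv P (i :: w))| ≤ 3 / 2 * |u| := by
          have := abs_sub_abs_le_abs_sub (ev (y + t • h) (wordDeriv P (i :: w))) u
          linarith
        have h4 : 24 * δ * |u| ≤ B := le_trans (by gcongr) h2
        rw [norm_mul, Real.norm_eq_abs, Real.norm_eq_abs]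
        calc _ ≤ (2 * δ) * (3 / 2 * |u|) := by
              gcongr
              · exact (abs_coord_le h i).trans hnorm
              · exact h3
          _ ≤ B / 8 := by linarith
      calc _ ≤ ∑ i : Fin 4, B / 8 := norm_sum_le_of_le _ fun i _ => hterm i
        _ = B / 2 := by simp; ring
    have hmv := Convex.norm_image_sub_le_of_norm_hasDerivWithin_le
      (f := fun t : ℝ => ev (y + t • h) (wordDeriv P w)) (s := Set.Icc 0 1) (x := 0) (y := 1)
      (fun t _ => (hasDerivAt_ev_line y h (wordDeriv P w) t).hasDerivWithinAt) hbound
      (convex_Icc 0 1) (by simp) (by simp)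
    simpa [hh] using hmv

lemma exists_ev_ne_zero {P : Poly4} (hP : P ≠ 0) (y : E4) {r : ℝ} (hr : 0 < r) :
    ∃ x, dist x y ≤ r ∧ ev x P ≠ 0 := by
  by_contra! h
  apply hP
  refine MvPolynomial.funext_set (fun i => Set.Icc (y i - r / 2) (y i + r / 2))
    (fun i => Set.Icc_infinite (by linarith)) fun x hx => ?_
  rw [map_zero]
  have := h (WithLp.toLp 2 x) (by
    rw [EuclideanSpace.dist_eq, Real.sqrt_le_left hr.le]
    calc _ ≤ ∑ _i : Fin 4, (r / 2) ^ 2 := by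
          refine Finset.sum_le_sum fun i _ => ?_
          rw [Real.dist_eq, sq_le_sq, abs_abs, abs_of_pos (half_pos hr), abs_le]
          have := hx i (Set.mem_univ i)
          constructor <;> simp only <;> linarith [this.1, this.2]
      _ = r ^ 2 := by simp; ring)
  simpa using this

lemma GoodPt.ev_ne_zero {K δ : ℝ} {P : Poly4} {y : E4} (hy : GoodPt K δ P y) (hK : 24 ≤ K)
    (hδ : 0 < δ) (hP : P ≠ 0) {x : E4} (hx : dist x y ≤ 2 * δ) : ev x P ≠ 0 := by
  have hy0 : ev y P ≠ 0 := by
    intro h0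
    obtain ⟨z, hz, hz0⟩ := exists_ev_ne_zero hP y (by linarith : 0 < 2 * δ)
    have := hy.abs_sub_le hK hδ [] hz
    simp only [wordDeriv, h0, sub_zero, abs_zero, zero_div] at this
    exact hz0 (abs_nonpos_iff.1 this)
  intro h0
  have := hy.abs_sub_le hK hδ [] hx
  simp only [wordDeriv, h0, zero_sub, abs_neg] at this
  have := abs_pos.2 hy0
  linarith

lemma GoodPt.of_near {K δ : ℝ} {P : Poly4} {y : E4} (hy : GoodPt (3 * K) δ P y) (hK : 8 ≤ K)
    (hδ : 0 < δ) {x : E4} (hx : dist x y ≤ 2 * δ) : GoodPt K δ P x := by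
  intro w i
  have h1 := hy.abs_sub_le (by linarith) hδ w hx
  have h2 := hy.abs_sub_le (by linarith) hδ (i :: w) hx
  have h3 := hy w i
  have h4 := abs_sub_abs_le_abs_sub (ev x (wordDeriv P (i :: w))) (ev y (wordDeriv P (i :: w)))
  have h5 := abs_sub_abs_le_abs_sub (ev y (wordDeriv P w)) (ev x (wordDeriv P w))
  rw [abs_sub_comm] at h5
  have h6 : |ev x (wordDeriv P (i :: w))| ≤ 3 / 2 * |ev y (wordDeriv P (i :: w))| := by linarith
  have h7 : K * δ * |ev x (wordDeriv P (i :: w))| ≤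
      K * δ * (3 / 2 * |ev y (wordDeriv P (i :: w))|) := by gcongr
  linarith

lemma GoodPt.finite_words (K δ : ℝ) (P : Poly4) (y : E4) :
    GoodPt K δ P y ↔ ∀ w : List (Fin 4), w.length ≤ P.totalDegree → ∀ i,
      K * δ * |ev y (wordDeriv P (i :: w))| ≤ |ev y (wordDeriv P w)| := by
  refine ⟨fun h w _ i => h w i, fun h w i => ?_⟩
  by_cases hw : w.length ≤ P.totalDegree
  · exact h w hw i
  · rw [wordDeriv_eq_zero P (i :: w) (by simp; omega)]
    simp

lemma isClosed_goodPt (K δ : ℝ) (P : Poly4) : IsClosed {y | GoodPt K δ P y} := by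
  simp only [GoodPt, Set.ofPred_forall]
  exact isClosed_iInter fun w => isClosed_iInter fun i =>
    isClosed_le (continuous_const.mul (continuous_ev _).abs) (continuous_ev _).abs

end Good

section Tubes

lemma isCompact_tube (δ : ℝ) (y v : E4) : IsCompact (tube δ y v) := by
  have h : tube δ y v = (fun p : ℝ × E4 => y + p.1 • v + p.2) ''
      (Set.Icc (0 : ℝ) 1 ×ˢ Metric.closedBall (0 : E4) δ) := by
    ext x
    constructor
    · rintro ⟨t, ht, hx⟩
      refine ⟨(t, x - (y + t • v)), ⟨ht, ?_⟩, by simp⟩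
      rw [mem_closedBall_zero_iff, ← dist_eq_norm]; exact hx
    · rintro ⟨⟨t, z⟩, ⟨ht, hz⟩, rfl⟩
      refine ⟨t, ht, ?_⟩
      rw [mem_closedBall_zero_iff] at hz
      simpa [dist_eq_norm] using hz
  rw [h]
  exact (isCompact_Icc.prod (isCompact_closedBall _ _)).image (by fun_prop)

lemma measurableSet_tube (δ : ℝ) (y v : E4) : MeasurableSet (tube δ y v) :=
  (isCompact_tube δ y v).measurableSet

end Tubes

section Cells

lemma exists_root_of_mul_neg {f : ℝ → ℝ} (hf : Continuous f) {s t : ℝ} (hst : s ≤ t)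
    (h : f s * f t < 0) : ∃ u ∈ Set.Icc s t, f u = 0 := by
  rcases mul_neg_iff.1 h with ⟨h1, h2⟩ | ⟨h1, h2⟩
  · exact intermediate_value_Icc' hst hf.continuousOn ⟨h2.le, h1.le⟩
  · exact intermediate_value_Icc hst hf.continuousOn ⟨h1.le, h2.le⟩

/-- A line meets few sign cells. -/
lemma card_cells_on_line_le (Ps : ℕ → Poly4) (L : ℕ) (y v : E4) (S : Finset (Fin L → Bool))
    (hS : ∀ σ ∈ S, ∃ t : ℝ, y + t • v ∈ signCell Ps σ) :
    S.card ≤ (∏ l ∈ Finset.range L, Ps l).totalDegree + 1 := by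
  classical
  set P := ∏ l ∈ Finset.range L, Ps l with hP
  set r := lineRes y v P with hr
  have hex : ∀ σ, ∃ t : ℝ, σ ∈ S → y + t • v ∈ signCell Ps σ := by
    intro σ
    by_cases h : σ ∈ S
    · obtain ⟨t, ht⟩ := hS σ h; exact ⟨t, fun _ => ht⟩
    · exact ⟨0, fun h' => absurd h' h⟩
  choose t ht using hex
  have hne : ∀ σ ∈ S, r.eval (t σ) ≠ 0 := by
    intro σ hσ
    rw [hr, eval_lineRes, hP, map_prod, Finset.prod_ne_zero_iff]
    intro l hl h0
    have := ht σ hσ ⟨l, Finset.mem_range.1 hl⟩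
    simp [h0] at this
  set cnt : (Fin L → Bool) → ℕ := fun σ => (r.roots.toFinset.filter (· < t σ)).card with hcnt
  have hcntle : ∀ σ ∈ S, cnt σ ∈ Finset.range (P.totalDegree + 1) := by
    intro σ _
    rw [Finset.mem_range, Nat.lt_succ_iff]
    calc cnt σ ≤ r.roots.toFinset.card := Finset.card_filter_le _ _
      _ ≤ Multiset.card r.roots := Multiset.toFinset_card_le _
      _ ≤ r.natDegree := Polynomial.card_roots' r
      _ ≤ P.totalDegree := natDegree_lineRes_le y v P
  have key : ∀ σ ∈ S, ∀ τ ∈ S, t σ ≤ t τ → cnt σ = cnt τ → σ = τ := by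
    intro σ hσ τ hτ hle hc
    by_contra hστ
    obtain ⟨l, hl⟩ := Function.ne_iff.1 hστ
    have h1 := ht σ hσ l
    have h2 := ht τ hτ l
    have hneg : ev (y + t σ • v) (Ps l) * ev (y + t τ • v) (Ps l) < 0 := by
      cases hb : σ l <;> cases hb' : τ l <;> simp [hb, hb', boolSign] at h1 h2 hl <;> nlinarith
    obtain ⟨u, hu, hu0⟩ := exists_root_of_mul_neg (f := fun s : ℝ => ev (y + s • v) (Ps l))
      ((continuous_ev _).comp (by fun_prop)) hle hneg
    have hur : r.eval u = 0 := by
      rw [hr, eval_lineRes, hP, map_prod]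
      exact Finset.prod_eq_zero (Finset.mem_range.2 l.is_lt) hu0
    have hr0 : r ≠ 0 := fun h0 => hne σ hσ (by rw [h0, Polynomial.eval_zero])
    have hult : u < t τ := lt_of_le_of_ne hu.2 fun h => hne τ hτ (h ▸ hur)
    have hsub : r.roots.toFinset.filter (· < t σ) ⊆ r.roots.toFinset.filter (· < t τ) :=
      Finset.monotone_filter_right _ fun _ _ h => lt_of_lt_of_le h hle
    have heq := Finset.eq_of_subset_of_card_le hsub hc.ge
    have : u ∈ r.roots.toFinset.filter (· < t σ) := by
      rw [heq, Finset.mem_filter]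
      exact ⟨by simp [hr0, Polynomial.IsRoot, hur], hult⟩
    exact absurd (Finset.mem_filter.1 this).2 (not_lt.2 hu.1)
  have := Finset.card_le_card_of_injOn cnt hcntle (by
    intro σ hσ τ hτ h
    rcases le_total (t σ) (t τ) with hle | hle
    · exact key σ hσ τ hτ hle h
    · exact (key τ hτ σ hσ hle h.symm).symm)
  simpa using this

lemma exists_light_real {α : Type*} [Fintype α] (a : α → ℝ) (heavy : Fin 3 → Finset α) {Z M : ℝ}
    (hZ : 0 < Z) (ha : ∀ σ, 0 ≤ a σ) (h1 : Z ≤ 2 * ∑ σ, a σ)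
    (h2 : ∀ m, 12 * ∑ σ ∈ heavy m, a σ ≤ Z) (hM0 : 0 < M) (hM : (Fintype.card α : ℝ) ≤ M) :
    ∃ σ, (∀ m, σ ∉ heavy m) ∧ Z ≤ 4 * M * a σ := by
  classical
  by_contra! hcon
  have hsub : (Finset.univ : Finset α) ⊆
      ((heavy 0 ∪ heavy 1) ∪ heavy 2) ∪ Finset.univ.filter (fun σ => ∀ m, σ ∉ heavy m) := by
    intro σ _
    by_cases h : ∀ m, σ ∉ heavy m
    · simp [h]
    · push Not at h
      obtain ⟨m, hm⟩ := h
      fin_cases m <;> simp_all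
  have hun : ∀ s t : Finset α, ∑ σ ∈ s ∪ t, a σ ≤ ∑ σ ∈ s, a σ + ∑ σ ∈ t, a σ := by
    intro s t
    rw [← Finset.sum_union_inter]
    exact le_add_of_nonneg_right (Finset.sum_nonneg fun σ _ => ha σ)
  set Lt := Finset.univ.filter (fun σ => ∀ m, σ ∉ heavy m)
  have h3 : ∑ σ, a σ ≤ ∑ σ ∈ heavy 0, a σ + ∑ σ ∈ heavy 1, a σ + ∑ σ ∈ heavy 2, a σ +
      ∑ σ ∈ Lt, a σ := by
    refine (Finset.sum_le_sum_of_subset_of_nonneg hsub fun σ _ _ => ha σ).trans ?_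
    refine (hun _ _).trans ?_
    gcongr
    refine (hun _ _).trans ?_
    gcongr
    exact hun _ _
  have h4 : Z / 4 ≤ ∑ σ ∈ Lt, a σ := by linarith [h2 0, h2 1, h2 2]
  have h5 : Lt.Nonempty := by
    by_contra h
    rw [Finset.not_nonempty_iff_eq_empty.1 h, Finset.sum_empty] at h4
    linarith
  have h6 : ∑ σ ∈ Lt, a σ < ∑ σ ∈ Lt, Z / (4 * M) := by
    refine Finset.sum_lt_sum_of_nonempty h5 fun σ hσ => ?_
    rw [lt_div_iff₀ (by positivity)]
    linarith [hcon σ (Finset.mem_filter.1 hσ).2]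
  rw [Finset.sum_const, nsmul_eq_mul] at h6
  have h7 : (Lt.card : ℝ) ≤ M := le_trans (by exact_mod_cast Finset.card_le_univ _) hM
  have h8 : (Lt.card : ℝ) * (Z / (4 * M)) ≤ M * (Z / (4 * M)) := by gcongr
  have h9 : M * (Z / (4 * M)) = Z / 4 := by field_simp
  linarith

lemma exists_light {α : Type*} [Fintype α] (a : α → ℝ≥0∞) (heavy : Fin 3 → Finset α) {Z : ℝ≥0∞}
    {M : ℕ} (hZ : 0 < Z) (hZt : Z ≠ ⊤) (ha : ∀ σ, a σ ≠ ⊤) (h1 : Z ≤ 2 * ∑ σ, a σ)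
    (h2 : ∀ m, 12 * ∑ σ ∈ heavy m, a σ ≤ Z) (hM : Fintype.card α ≤ M) (hM0 : 0 < M) :
    ∃ σ, (∀ m, σ ∉ heavy m) ∧ Z ≤ 4 * M * a σ := by
  have hsum : ∀ s : Finset α, ∑ σ ∈ s, a σ ≠ ⊤ := fun s =>
    (ENNReal.sum_lt_top.2 fun σ _ => lt_top_iff_ne_top.2 (ha σ)).ne
  obtain ⟨σ, hσ, h⟩ := exists_light_real (fun σ => (a σ).toReal) heavy (Z := Z.toReal) (M := M)
    (ENNReal.toReal_pos hZ.ne' hZt) (fun _ => ENNReal.toReal_nonneg) (by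
      have := ENNReal.toReal_mono (ENNReal.mul_ne_top ENNReal.ofNat_ne_top (hsum _)) h1
      rwa [ENNReal.toReal_mul, ENNReal.toReal_sum fun σ _ => ha σ] at this) (fun m => by
      have := ENNReal.toReal_mono hZt (h2 m)
      rwa [ENNReal.toReal_mul, ENNReal.toReal_sum fun σ _ => ha σ] at this)
    (by exact_mod_cast hM0) (by exact_mod_cast hM)
  refine ⟨σ, hσ, ?_⟩
  rw [← ENNReal.toReal_le_toReal hZt (ENNReal.mul_ne_top
    (ENNReal.mul_ne_top ENNReal.ofNat_ne_top (ENNReal.natCast_ne_top _)) (ha σ))]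
  simpa using h

/-- Reduction of an integral to one cell of a polynomial partition. -/
theorem cell_reduction {ι : Type} [DecidableEq ι] {δ : ℝ} (hδ : 0 < δ) (y v : ι → E4)
    {n : ℕ} (e : Fin n ↪ Fin 4) (hn : 0 < n) (h : ℕ) (f : E4 → ℝ≥0∞)
    (hf : ∫⁻ x, f x ≠ ⊤) (A : Fin 3 → Finset ι) :
    ∃ P : Poly4, P ≠ 0 ∧ P.totalDegree ≤ 32 * 2 ^ h ∧
      (∀ j ∉ Set.range e, MvPolynomial.pderiv j P = 0) ∧
      (∫⁻ x, f x ≤ 2 * ∫⁻ x in {x | ¬ GoodPt 24 δ P x}, f x ∨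
        ∃ (G : Set E4) (A' : Fin 3 → Finset ι), MeasurableSet G ∧
          (∀ m, A' m ⊆ A m) ∧
          (∀ m, (A' m).card * 2 ^ (n * h) ≤ 12 * (32 * 2 ^ h + 1) * (A m).card) ∧
          (∀ x ∈ G, ∀ m, ∀ t ∈ A m, x ∈ tube δ (y t) (v t) → t ∈ A' m) ∧
          ∫⁻ x, f x ≤ 4 * 2 ^ (n * h) * ∫⁻ x in G, f x) := by
  classical
  set μ := (volume : Measure E4).withDensity f with hμ
  set Z := ∫⁻ x, f x with hZ
  have hμu : μ Set.univ = Z := by rw [hμ, withDensity_apply _ MeasurableSet.univ, Measure.restrict_univ]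
  have : IsFiniteMeasure μ := ⟨by rw [hμu]; exact lt_top_iff_ne_top.2 hf⟩
  obtain ⟨Ps, hP0, hdeg, hpd, hcell⟩ := exists_partition e hn μ h
  set P := ∏ l ∈ Finset.range (n * h), Ps l with hP
  refine ⟨P, hP0, hdeg, hpd, ?_⟩
  by_cases hbad : Z ≤ 2 * ∫⁻ x in {x | ¬ GoodPt 24 δ P x}, f x
  · exact Or.inl hbad
  right
  push Not at hbad
  set good : Set E4 := {x | GoodPt 24 δ P x} with hgood
  have hgm : MeasurableSet good := (isClosed_goodPt 24 δ P).measurableSet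
  set cell : (Fin (n * h) → Bool) → Set E4 := fun σ => good ∩ signCell Ps σ with hcelldef
  have hcm : ∀ σ, MeasurableSet (cell σ) := fun σ =>
    hgm.inter (isOpen_signCell Ps σ).measurableSet
  have hZg : Z ≤ 2 * ∫⁻ x in good, f x := by
    have h1 : (∫⁻ x in good, f x) + (∫⁻ x in goodᶜ, f x) = Z :=
      lintegral_add_compl (μ := (volume : Measure E4)) f hgm
    have h2 : (2 : ℝ≥0∞) * ∫⁻ x in goodᶜ, f x < Z := hbad
    by_contra hcon
    push Not at hcon
    have h3 := ENNReal.add_lt_add hcon h2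
    rw [← mul_add, h1, ← two_mul] at h3
    exact lt_irrefl _ h3
  -- the good points lie in the union of the cells
  have hcover : good ⊆ ⋃ σ, cell σ := by
    intro x hx
    have hx0 : ∀ l : Fin (n * h), ev x (Ps l) ≠ 0 := by
      have := GoodPt.ev_ne_zero hx le_rfl hδ hP0 (x := x) (by rw [dist_self]; linarith)
      rw [hP, map_prod, Finset.prod_ne_zero_iff] at this
      exact fun l => this l (Finset.mem_range.2 l.is_lt)
    refine Set.mem_iUnion.2 ⟨fun l => decide (0 < ev x (Ps l)), hx, fun l => ?_⟩
    rcases lt_or_gt_of_ne (hx0 l) with h1 | h1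
    · simp [boolSign, h1, not_lt.2 h1.le]
    · simp [boolSign, h1]
  have hgsum : ∫⁻ x in good, f x ≤ ∑ σ, ∫⁻ x in cell σ, f x := by
    calc _ ≤ ∫⁻ x in ⋃ σ, cell σ, f x := lintegral_mono_set hcover
      _ ≤ ∑' σ, ∫⁻ x in cell σ, f x := lintegral_iUnion_le _ _
      _ = _ := tsum_fintype _
  set A' : (Fin (n * h) → Bool) → Fin 3 → Finset ι := fun σ m =>
    (A m).filter fun t => (tube δ (y t) (v t) ∩ cell σ).Nonempty with hA'
  have hdouble : ∀ m, ∑ σ, (A' σ m).card ≤ (A m).card * (32 * 2 ^ h + 1) := by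
    intro m
    simp only [hA', Finset.card_filter]
    rw [Finset.sum_comm]
    refine (Finset.sum_le_card_nsmul _ _ (32 * 2 ^ h + 1) fun t _ => ?_).trans_eq
      (smul_eq_mul _ _)
    rw [← Finset.card_filter]
    refine (card_cells_on_line_le Ps (n * h) (y t) (v t) _ fun σ hσ => ?_).trans (by gcongr)
    obtain ⟨x, ⟨s, -, hs⟩, hxg, hxc⟩ := (Finset.mem_filter.1 hσ).2
    refine ⟨s, fun l => ?_⟩
    by_contra hcon
    have hneg : ev (x + (0 : ℝ) • (y t + s • v t - x)) (Ps l) *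
        ev (x + (1 : ℝ) • (y t + s • v t - x)) (Ps l) ≤ 0 := by
      have h1 := hxc l
      simp only [zero_smul, add_zero, one_smul, add_sub_cancel]
      cases hb : σ l <;> simp [hb, boolSign] at h1 hcon <;> nlinarith
    obtain ⟨u, hu, hu0⟩ : ∃ u ∈ Set.Icc (0 : ℝ) 1,
        ev (x + u • (y t + s • v t - x)) (Ps l) = 0 := by
      rcases hneg.lt_or_eq with h1 | h1
      · exact exists_root_of_mul_neg (f := fun u : ℝ => ev (x + u • (y t + s • v t - x)) (Ps l))
          ((continuous_ev _).comp (by fun_prop)) zero_le_one h1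
      · rcases mul_eq_zero.1 h1 with h2 | h2
        · exact ⟨0, by simp, h2⟩
        · exact ⟨1, by simp, h2⟩
    refine GoodPt.ev_ne_zero hxg le_rfl hδ hP0 (x := x + u • (y t + s • v t - x)) ?_ ?_
    · rw [dist_eq_norm, add_sub_cancel_left, norm_smul, Real.norm_of_nonneg hu.1, ← dist_eq_norm,
        dist_comm]
      nlinarith [hu.2, hu.1, dist_nonneg (x := x) (y := y t + s • v t)]
    · rw [hP, map_prod]
      exact Finset.prod_eq_zero (Finset.mem_range.2 l.is_lt) hu0
  set D := 32 * 2 ^ h + 1 with hD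
  set heavy : Fin 3 → Finset (Fin (n * h) → Bool) := fun m =>
    Finset.univ.filter fun σ => 12 * D * (A m).card < (A' σ m).card * 2 ^ (n * h) with hheavy
  have hheavyc : ∀ m, 12 * (heavy m).card ≤ 2 ^ (n * h) := by
    intro m
    rcases Nat.eq_zero_or_pos (A m).card with h0 | hpos
    · have : heavy m = ∅ := by
        rw [hheavy]
        refine Finset.filter_false_of_mem fun σ _ => ?_
        have : (A' σ m).card = 0 := by
          have := Finset.card_filter_le (A m) fun t => (tube δ (y t) (v t) ∩ cell σ).Nonempty
          simp only [hA']; omega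
        rw [this, h0]; simp
      rw [this]; simp
    · have h1 : (heavy m).card * (12 * D * (A m).card) ≤ (A m).card * D * 2 ^ (n * h) := by
        calc _ = ∑ σ ∈ heavy m, 12 * D * (A m).card := by rw [Finset.sum_const, smul_eq_mul]
          _ ≤ ∑ σ ∈ heavy m, (A' σ m).card * 2 ^ (n * h) :=
              Finset.sum_le_sum fun σ hσ => (Finset.mem_filter.1 hσ).2.le
          _ ≤ ∑ σ, (A' σ m).card * 2 ^ (n * h) :=
              Finset.sum_le_sum_of_subset (Finset.subset_univ _)
          _ = (∑ σ, (A' σ m).card) * 2 ^ (n * h) := by rw [Finset.sum_mul]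
          _ ≤ _ := by gcongr; exact hdouble m
      have hDpos : 0 < D := by omega
      have : (A m).card * D * (12 * (heavy m).card) ≤ (A m).card * D * 2 ^ (n * h) := by
        calc _ = (heavy m).card * (12 * D * (A m).card) := by ring
          _ ≤ _ := h1
      exact Nat.le_of_mul_le_mul_left this (by positivity)
  have hmass : ∀ σ, 2 ^ (n * h) * ∫⁻ x in cell σ, f x ≤ Z := by
    intro σ
    refine le_trans ?_ ((hcell σ).trans_eq hμu)
    gcongr
    rw [hμ, withDensity_apply _ (isOpen_signCell Ps σ).measurableSet]
    exact lintegral_mono_set Set.inter_subset_right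
  have hheavymass : ∀ m, 12 * ∑ σ ∈ heavy m, ∫⁻ x in cell σ, f x ≤ Z := by
    intro m
    have h1 : (12 : ℝ≥0∞) * 2 ^ (n * h) * ∑ σ ∈ heavy m, ∫⁻ x in cell σ, f x ≤ 2 ^ (n * h) * Z := by
      calc _ = 12 * ∑ σ ∈ heavy m, 2 ^ (n * h) * ∫⁻ x in cell σ, f x := by
            rw [mul_assoc, Finset.mul_sum]
        _ ≤ 12 * ∑ σ ∈ heavy m, Z := by gcongr with σ; exact hmass σ
        _ = ((12 * (heavy m).card : ℕ) : ℝ≥0∞) * Z := by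
            rw [Finset.sum_const, nsmul_eq_mul]; push_cast; ring
        _ ≤ ((2 ^ (n * h) : ℕ) : ℝ≥0∞) * Z := by gcongr; exact_mod_cast hheavyc m
        _ = _ := by push_cast; rfl
    have h2 : (2 : ℝ≥0∞) ^ (n * h) * (12 * ∑ σ ∈ heavy m, ∫⁻ x in cell σ, f x) ≤
        2 ^ (n * h) * Z := by
      calc _ = (12 : ℝ≥0∞) * 2 ^ (n * h) * ∑ σ ∈ heavy m, ∫⁻ x in cell σ, f x := by ring
        _ ≤ _ := h1
    exact (ENNReal.mul_le_mul_iff_right (by positivity)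
      (ENNReal.pow_ne_top ENNReal.ofNat_ne_top)).1 h2
  -- some light cell carries its share of the mass
  obtain ⟨σ, hσ, hσm⟩ : ∃ σ, (∀ m, σ ∉ heavy m) ∧
      Z ≤ 4 * 2 ^ (n * h) * ∫⁻ x in cell σ, f x := by
    have := exists_light (fun σ => ∫⁻ x in cell σ, f x) heavy (pos_of_gt hbad) hf
      (fun σ => ne_top_of_le_ne_top hf (setLIntegral_le_lintegral _ _))
      (hZg.trans (by gcongr)) hheavymass (M := 2 ^ (n * h)) (by simp) (by positivity)
    simpa only [Nat.cast_pow, Nat.cast_ofNat] using this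
  refine ⟨cell σ, A' σ, hcm σ, fun m => Finset.filter_subset _ _, fun m => ?_, ?_, hσm⟩
  · have := hσ m
    simp only [hheavy, Finset.mem_filter, Finset.mem_univ, true_and, not_lt] at this
    exact this
  · intro x hx m t ht hxt
    exact Finset.mem_filter.2 ⟨ht, x, hxt, hx⟩

end Cells

section LineIntegral

lemma min_one_le_rpow {u s : ℝ} (hu : 0 ≤ u) (hs : 0 ≤ s) (hs1 : s ≤ 1) : min 1 u ≤ u ^ s := by
  rcases le_total u 1 with h | h
  · rw [min_eq_right h]
    rcases hu.eq_or_lt with rfl | h0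
    · exact Real.rpow_nonneg le_rfl _
    · simpa using Real.rpow_le_rpow_of_exponent_ge h0 h hs1
  · rw [min_eq_left h]; exact Real.one_le_rpow h hs

lemma lintegral_abs_rpow_ne_top {ε : ℝ} (hε : 0 < ε) :
    ∫⁻ t in Set.Icc (-1 : ℝ) 1, ENNReal.ofReal (|t| ^ (ε - 1)) ≠ ⊤ := by
  have h1 : IntervalIntegrable (fun t : ℝ => |t| ^ (ε - 1)) volume 0 1 := by
    refine (intervalIntegral.intervalIntegrable_rpow' (r := ε - 1) (by linarith)).congr ?_
    intro t ht
    rw [Set.uIoc_of_le zero_le_one] at ht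
    simp only [abs_of_pos ht.1]
  have h2 : IntervalIntegrable (fun t : ℝ => |t| ^ (ε - 1)) volume (-1) 0 := by
    have := h1.comp_sub_left 0
    simp only [zero_sub, abs_neg, neg_zero] at this
    exact this.symm
  have h3 := h2.trans h1
  rw [intervalIntegrable_iff_integrableOn_Icc_of_le (by norm_num)] at h3
  exact (h3.lintegral_lt_top).ne

lemma exists_lintegral_min_le {ε : ℝ} (hε : 0 < ε) (hε1 : ε ≤ 1) :
    ∃ C > (0 : ℝ), ∀ δ > (0 : ℝ), ∀ a c : ℝ,
      ∫⁻ t in Set.Icc a (a + 10), ENNReal.ofReal (min 1 (δ / |t - c|)) ≤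
        ENNReal.ofReal (C * δ ^ (1 - ε)) := by
  set I := ∫⁻ t in Set.Icc (-1 : ℝ) 1, ENNReal.ofReal (|t| ^ (ε - 1)) with hI
  have hIt : I ≠ ⊤ := lintegral_abs_rpow_ne_top hε
  refine ⟨I.toReal + 10, by positivity, fun δ hδ a c => ?_⟩
  have hp : ∀ t : ℝ, ENNReal.ofReal (min 1 (δ / |t - c|)) ≤ ENNReal.ofReal (δ ^ (1 - ε)) *
      ((Set.Icc (-1 : ℝ) 1).indicator (fun t => ENNReal.ofReal (|t| ^ (ε - 1))) (t - c) + 1) := by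
    intro t
    have h0 : min 1 (δ / |t - c|) ≤ δ ^ (1 - ε) * |t - c| ^ (ε - 1) := by
      refine (min_one_le_rpow (by positivity) (by linarith : 0 ≤ 1 - ε) (by linarith)).trans_eq ?_
      rw [Real.div_rpow hδ.le (abs_nonneg _), div_eq_mul_inv, ← Real.rpow_neg (abs_nonneg _),
        neg_sub]
    refine (ENNReal.ofReal_le_ofReal h0).trans ?_
    rw [ENNReal.ofReal_mul (by positivity)]
    gcongr
    by_cases h : t - c ∈ Set.Icc (-1 : ℝ) 1
    · rw [Set.indicator_of_mem h]; exact le_self_add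
    · rw [Set.indicator_of_notMem h, zero_add]
      refine ENNReal.ofReal_le_one.2 (Real.rpow_le_one_of_one_le_of_nonpos ?_ (by linarith))
      by_contra hcon
      push Not at hcon
      exact h (abs_le.1 hcon.le)
  calc _ ≤ ∫⁻ t in Set.Icc a (a + 10), ENNReal.ofReal (δ ^ (1 - ε)) *
      ((Set.Icc (-1 : ℝ) 1).indicator (fun t => ENNReal.ofReal (|t| ^ (ε - 1))) (t - c) + 1) :=
        lintegral_mono hp
    _ = ENNReal.ofReal (δ ^ (1 - ε)) * ((∫⁻ t in Set.Icc a (a + 10),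
        (Set.Icc (-1 : ℝ) 1).indicator (fun t => ENNReal.ofReal (|t| ^ (ε - 1))) (t - c)) + 10) := by
        rw [lintegral_const_mul' _ _ ENNReal.ofReal_ne_top, lintegral_add_right _ measurable_const]
        simp
    _ ≤ ENNReal.ofReal (δ ^ (1 - ε)) * (I + 10) := by
        gcongr
        refine (setLIntegral_le_lintegral _ _).trans ?_
        rw [lintegral_sub_right_eq_self
          (fun t => (Set.Icc (-1 : ℝ) 1).indicator (fun t => ENNReal.ofReal (|t| ^ (ε - 1))) t) c,
          lintegral_indicator measurableSet_Icc]
    _ = _ := by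
        rw [mul_comm, ENNReal.ofReal_mul (by positivity), ENNReal.ofReal_add (by positivity)
          (by norm_num), ENNReal.ofReal_toReal hIt]
        norm_num

lemma min_one_norm_sum_le (s : Multiset ℂ) {δ : ℝ} (hδ : 0 < δ) (t : ℝ) (ht : ∀ z ∈ s, t ≠ z.re) :
    min 1 (δ * ‖(s.map fun z => 1 / ((t : ℂ) - z)).sum‖) ≤
      (s.map fun z => min 1 (δ / |t - z.re|)).sum := by
  induction s using Multiset.induction with
  | empty => simp
  | cons z s ih =>
    have ih' := ih fun w hw => ht w (Multiset.mem_cons_of_mem hw)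
    have hz : 0 < |t - z.re| := abs_pos.2 (sub_ne_zero.2 (ht z (Multiset.mem_cons_self z s)))
    rw [Multiset.map_cons, Multiset.map_cons, Multiset.sum_cons, Multiset.sum_cons]
    set q := (s.map fun z => 1 / ((t : ℂ) - z)).sum
    have h1 : ‖1 / ((t : ℂ) - z)‖ ≤ 1 / |t - z.re| := by
      rw [norm_div, norm_one]
      refine one_div_le_one_div_of_le hz ?_
      simpa using Complex.abs_re_le_norm ((t : ℂ) - z)
    have h2 : δ * ‖1 / ((t : ℂ) - z) + q‖ ≤ δ / |t - z.re| + δ * ‖q‖ := by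
      calc δ * ‖1 / ((t : ℂ) - z) + q‖ ≤ δ * (1 / |t - z.re| + ‖q‖) := by
            gcongr
            exact (norm_add_le _ _).trans (by gcongr)
        _ = _ := by ring
    have h3 : 0 ≤ δ / |t - z.re| := by positivity
    have h4 : 0 ≤ δ * ‖q‖ := by positivity
    rcases le_total 1 (δ / |t - z.re|) with h | h <;> rcases le_total 1 (δ * ‖q‖) with h' | h' <;>
      simp only [min_eq_left, min_eq_right, h, h'] at ih' ⊢ <;>
      first
        | linarith [min_le_left (1 : ℝ) (δ * ‖1 / ((t : ℂ) - z) + q‖)]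
        | linarith [min_le_right (1 : ℝ) (δ * ‖1 / ((t : ℂ) - z) + q‖)]

/-- The normalized logarithmic derivative of a real polynomial is controlled by its roots. -/
lemma logDeriv_le_sum {r : Polynomial ℝ} (hr : r ≠ 0) {δ : ℝ} (hδ : 0 < δ) (t : ℝ)
    (ht : ∀ z ∈ (r.map (algebraMap ℝ ℂ)).roots, t ≠ z.re) :
    δ * |r.derivative.eval t| / (|r.eval t| + δ * |r.derivative.eval t|) ≤
      ((r.map (algebraMap ℝ ℂ)).roots.map fun z => min 1 (δ / |t - z.re|)).sum := by
  set rc := r.map (algebraMap ℝ ℂ) with hrc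
  have hrc0 : rc ≠ 0 := (Polynomial.map_ne_zero_iff (algebraMap ℝ ℂ).injective).2 hr
  have hev : rc.eval (t : ℂ) = ((r.eval t : ℝ) : ℂ) :=
    (Polynomial.eval_map_algebraMap r (t : ℂ)).trans (Polynomial.aeval_ofReal r t)
  have hev' : rc.derivative.eval (t : ℂ) = ((r.derivative.eval t : ℝ) : ℂ) := by
    rw [hrc, Polynomial.derivative_map]
    exact (Polynomial.eval_map_algebraMap _ (t : ℂ)).trans (Polynomial.aeval_ofReal _ t)
  have hne : rc.eval (t : ℂ) ≠ 0 := fun h0 =>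
    ht t ((Polynomial.mem_roots hrc0).2 h0) (Complex.ofReal_re t).symm
  have ht0 : r.eval t ≠ 0 := by rw [hev] at hne; exact_mod_cast hne
  have hlog := Polynomial.Splits.eval_derivative_div_eval_of_ne_zero (IsAlgClosed.splits rc) hne
  have hpos : 0 < |r.eval t| := abs_pos.2 ht0
  refine le_trans ?_ (min_one_norm_sum_le rc.roots hδ t ht)
  rw [← hlog, hev, hev', norm_div, Complex.norm_real, Complex.norm_real, Real.norm_eq_abs,
    Real.norm_eq_abs]
  refine le_min ?_ ?_
  · rw [div_le_one (by positivity)]; linarith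
  · rw [← mul_div_assoc]
    gcongr
    have : 0 ≤ δ * |r.derivative.eval t| := by positivity
    linarith

lemma ofReal_multiset_sum_le {α : Type*} (g : α → ℝ) (s : Multiset α) :
    ENNReal.ofReal (s.map g).sum ≤ (s.map fun z => ENNReal.ofReal (g z)).sum := by
  induction s using Multiset.induction with
  | empty => simp
  | cons z s ih =>
    simp only [Multiset.map_cons, Multiset.sum_cons]
    exact ENNReal.ofReal_add_le.trans (by gcongr)

/-- Along a line, the normalized logarithmic derivative of a polynomial has small integral. -/
theorem exists_lintegral_logDeriv_le {ε : ℝ} (hε : 0 < ε) (hε1 : ε ≤ 1) (D : ℕ) :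
    ∃ C > (0 : ℝ), ∀ δ > (0 : ℝ), ∀ a : ℝ, ∀ r : Polynomial ℝ, r.natDegree ≤ D →
      ∫⁻ t in Set.Icc a (a + 10), ENNReal.ofReal
        (δ * |r.derivative.eval t| / (|r.eval t| + δ * |r.derivative.eval t|)) ≤
        ENNReal.ofReal (C * δ ^ (1 - ε)) := by
  obtain ⟨C, hC, hmain⟩ := exists_lintegral_min_le hε hε1
  refine ⟨(D + 1) * C, by positivity, fun δ hδ a r hr => ?_⟩
  by_cases hr0 : r = 0
  · simp [hr0]
  set s := (r.map (algebraMap ℝ ℂ)).roots with hs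
  have hae : ∀ᵐ t ∂(volume.restrict (Set.Icc a (a + 10))),
      ENNReal.ofReal (δ * |r.derivative.eval t| / (|r.eval t| + δ * |r.derivative.eval t|)) ≤
        (s.map fun z => ENNReal.ofReal (min 1 (δ / |t - z.re|))).sum := by
    refine ae_restrict_of_ae ?_
    have hfin : (((s.toFinset.image fun z => z.re) : Finset ℝ) : Set ℝ).Countable :=
      Finset.countable_toSet _
    filter_upwards [hfin.ae_notMem volume] with t ht
    have h1 := logDeriv_le_sum hr0 hδ t fun z hz h => ht (by
      simp only [Finset.coe_image, Set.mem_image, Finset.mem_coe, Multiset.mem_toFinset]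
      exact ⟨z, hz, h.symm⟩)
    refine (ENNReal.ofReal_le_ofReal h1).trans ?_
    exact ofReal_multiset_sum_le _ s
  refine (lintegral_mono_ae hae).trans ?_
  have hcard : Multiset.card s ≤ D :=
    (Polynomial.card_roots' _).trans ((Polynomial.natDegree_map_le).trans hr)
  have hsum : ∫⁻ t in Set.Icc a (a + 10), (s.map fun z => ENNReal.ofReal (min 1 (δ / |t - z.re|))).sum
      ≤ Multiset.card s * ENNReal.ofReal (C * δ ^ (1 - ε)) := by
    clear_value s
    clear hcard hae hs
    induction s using Multiset.induction with
    | empty => simp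
    | cons z s ih =>
      simp only [Multiset.map_cons, Multiset.sum_cons, Multiset.card_cons]
      rw [lintegral_add_left (by fun_prop), add_comm]
      push_cast
      rw [add_mul, one_mul]
      exact add_le_add ih (hmain δ hδ a z.re)
  refine hsum.trans ?_
  rw [mul_assoc, ENNReal.ofReal_mul (p := (D : ℝ) + 1) (by positivity)]
  gcongr
  rw [← ENNReal.ofReal_natCast]
  refine ENNReal.ofReal_le_ofReal ?_
  have : (Multiset.card s : ℝ) ≤ D := by exact_mod_cast hcard
  linarith

end LineIntegral

section Box

/-- A box with sides parallel to an orthonormal basis. -/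
def onbBox (b : OrthonormalBasis (Fin 4) ℝ E4) (α β : Fin 4 → ℝ) : Set E4 :=
  {x | ∀ j, ⟪b j, x⟫ ∈ Set.Icc (α j) (β j)}

lemma measurableSet_onbBox (b : OrthonormalBasis (Fin 4) ℝ E4) (α β : Fin 4 → ℝ) :
    MeasurableSet (onbBox b α β) := by
  rw [onbBox, Set.ofPred_forall]
  exact MeasurableSet.iInter fun j =>
    (isClosed_Icc.preimage (by fun_prop : Continuous fun x : E4 => ⟪b j, x⟫)).measurableSet

/-- The coordinates with respect to an orthonormal basis, with the `i`-th one split off. -/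
def onbSplit (b : OrthonormalBasis (Fin 4) ℝ E4) (i : Fin 4) : E4 ≃ᵐ ℝ × (Fin 3 → ℝ) :=
  (b.measurableEquiv.trans (MeasurableEquiv.toLp 2 (Fin 4 → ℝ)).symm).trans
    (MeasurableEquiv.piFinSuccAbove (fun _ => ℝ) i)

lemma measurePreserving_onbSplit (b : OrthonormalBasis (Fin 4) ℝ E4) (i : Fin 4) :
    MeasurePreserving (onbSplit b i) volume volume :=
  ((volume_preserving_piFinSuccAbove (fun _ => ℝ) i).comp
    ((PiLp.volume_preserving_ofLp (Fin 4)).comp b.measurePreserving_measurableEquiv))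

lemma onbSplit_apply (b : OrthonormalBasis (Fin 4) ℝ E4) (i : Fin 4) (x : E4) :
    onbSplit b i x = (⟪b i, x⟫, fun j => ⟪b (i.succAbove j), x⟫) := by
  simp only [← b.repr_apply_apply]
  rfl

lemma onbSplit_symm_apply (b : OrthonormalBasis (Fin 4) ℝ E4) (i : Fin 4) (t : ℝ)
    (w : Fin 3 → ℝ) : (onbSplit b i).symm (t, w) = (∑ j, w j • b (i.succAbove j)) + t • b i := by
  rw [MeasurableEquiv.symm_apply_eq, onbSplit_apply]
  ext j
  · simp [inner_add_right, inner_sum, inner_smul_right, b.inner_eq_ite]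
  · simp [inner_add_right, inner_sum, inner_smul_right, b.inner_eq_ite]

theorem setLIntegral_onbBox_le (b : OrthonormalBasis (Fin 4) ℝ E4) (i : Fin 4) (α β : Fin 4 → ℝ)
    {g : E4 → ℝ≥0∞} (hg : Measurable g) (M : ℝ≥0∞)
    (hM : ∀ z, ∫⁻ t in Set.Icc (α i) (β i), g (z + t • b i) ≤ M) :
    ∫⁻ x in onbBox b α β, g x ≤
      (∏ j : Fin 3, ENNReal.ofReal (β (i.succAbove j) - α (i.succAbove j))) * M := by
  rw [← lintegral_indicator (measurableSet_onbBox b α β),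
    ← (measurePreserving_onbSplit b i).symm.lintegral_comp_emb
      (onbSplit b i).symm.measurableEmbedding, Measure.volume_eq_prod, lintegral_prod_symm]
  · have hp : ∀ w : Fin 3 → ℝ, ∫⁻ t : ℝ, (onbBox b α β).indicator g ((onbSplit b i).symm (t, w)) ≤
        (Set.univ.pi fun j : Fin 3 => Set.Icc (α (i.succAbove j)) (β (i.succAbove j))).indicator
          (fun _ => M) w := by
      intro w
      have hmem : ∀ t, (onbSplit b i).symm (t, w) ∈ onbBox b α β ↔ t ∈ Set.Icc (α i) (β i) ∧
          ∀ j, w j ∈ Set.Icc (α (i.succAbove j)) (β (i.succAbove j)) := by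
        intro t
        have h1 := onbSplit_apply b i ((onbSplit b i).symm (t, w))
        rw [MeasurableEquiv.apply_symm_apply, Prod.ext_iff, funext_iff] at h1
        simp only at h1
        rw [onbBox, Set.mem_ofPred_eq, Fin.forall_iff_succAbove i, ← h1.1]
        simp only [← h1.2]
      by_cases hw : w ∈ Set.univ.pi fun j : Fin 3 =>
          Set.Icc (α (i.succAbove j)) (β (i.succAbove j))
      · rw [Set.indicator_of_mem hw]
        refine le_trans (le_of_eq ?_) (hM (∑ j, w j • b (i.succAbove j)))
        rw [← lintegral_indicator measurableSet_Icc]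
        refine lintegral_congr fun t => ?_
        by_cases ht : t ∈ Set.Icc (α i) (β i)
        · rw [Set.indicator_of_mem ht, Set.indicator_of_mem ((hmem t).2 ⟨ht, Set.mem_univ_pi.1 hw⟩),
            onbSplit_symm_apply]
        · rw [Set.indicator_of_notMem ht, Set.indicator_of_notMem fun h => ht ((hmem t).1 h).1]
      · rw [Set.indicator_of_notMem hw]
        refine le_of_eq ?_
        rw [lintegral_eq_zero_iff' ]
        · refine Filter.Eventually.of_forall fun t => ?_
          exact Set.indicator_of_notMem (fun h => hw (Set.mem_univ_pi.2 ((hmem t).1 h).2)) _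
        · exact ((hg.indicator (measurableSet_onbBox b α β)).comp
            ((onbSplit b i).symm.measurable.comp measurable_prodMk_right)).aemeasurable
    refine (lintegral_mono hp).trans ?_
    rw [lintegral_indicator (MeasurableSet.univ_pi fun _ => measurableSet_Icc), setLIntegral_const,
      volume_pi_pi, mul_comm]
    simp only [Real.volume_Icc, le_refl]
  · exact ((hg.indicator (measurableSet_onbBox b α β)).comp
      (onbSplit b i).symm.measurable).aemeasurable

lemma volume_onbBox (b : OrthonormalBasis (Fin 4) ℝ E4) (α β : Fin 4 → ℝ) :
    volume (onbBox b α β) = ∏ j, ENNReal.ofReal (β j - α j) := by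
  have h : onbBox b α β = (fun x => (b.measurableEquiv x).ofLp) ⁻¹'
      (Set.univ.pi fun j => Set.Icc (α j) (β j)) := by
    ext x
    simp only [onbBox, Set.mem_ofPred_eq, Set.mem_preimage, Set.mem_univ_pi, ← b.repr_apply_apply]
    rfl
  rw [h]
  refine (((PiLp.volume_preserving_ofLp (Fin 4)).comp
    b.measurePreserving_measurableEquiv).measure_preimage
    (MeasurableSet.univ_pi fun _ => measurableSet_Icc).nullMeasurableSet).trans ?_
  rw [volume_pi_pi]
  simp only [Real.volume_Icc]

end Box

section TubeBox

/-- The area of the parallelogram spanned by two vectors. -/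
def wedge2 (b c : E4) : ℝ := Real.sqrt (‖b‖ ^ 2 * ‖c‖ ^ 2 - ⟪b, c⟫ ^ 2)

lemma exists_onb_first {v : E4} (hv : ‖v‖ = 1) :
    ∃ b : OrthonormalBasis (Fin 4) ℝ E4, b 0 = v := by
  obtain ⟨b, hb⟩ := Orthonormal.exists_orthonormalBasis_extension_of_card_eq (𝕜 := ℝ) (E := E4)
    (ι := Fin 4) (by simp) (v := fun _ => v) (s := {0}) ⟨fun _ => hv, fun i j hij =>
      absurd (Subsingleton.elim i j) hij⟩
  exact ⟨b, hb 0 rfl⟩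

lemma exists_onb_pair {u w : E4} (hu : ‖u‖ = 1) (hw : 0 < wedge2 u w) :
    ∃ b : OrthonormalBasis (Fin 4) ℝ E4, b 0 = u ∧ w = ⟪u, w⟫ • u + wedge2 u w • b 1 := by
  set s := wedge2 u w with hs
  have hs2 : s ^ 2 = ‖w‖ ^ 2 - ⟪u, w⟫ ^ 2 := by
    rw [hs, wedge2, Real.sq_sqrt, hu]
    · ring
    · exact (Real.sqrt_pos.1 hw).le
  set z := s⁻¹ • (w - ⟪u, w⟫ • u) with hz
  have huu : ⟪u, u⟫ = 1 := by rw [real_inner_self_eq_norm_sq, hu]; norm_num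
  have huz : ⟪u, z⟫ = 0 := by
    rw [hz, inner_smul_right, inner_sub_right, inner_smul_right, huu]; ring
  have hz1 : ‖z‖ = 1 := by
    have h1 : ‖w - ⟪u, w⟫ • u‖ ^ 2 = s ^ 2 := by
      rw [norm_sub_sq_real, norm_smul, inner_smul_right, hu, real_inner_comm u w, hs2, mul_one,
        Real.norm_eq_abs, sq_abs]
      ring
    rw [hz, norm_smul, norm_inv, Real.norm_of_nonneg hw.le,
      (pow_left_inj₀ (norm_nonneg _) hw.le two_ne_zero).1 h1, inv_mul_cancel₀ hw.ne']
  obtain ⟨b, hb⟩ := Orthonormal.exists_orthonormalBasis_extension_of_card_eq (𝕜 := ℝ) (E := E4)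
    (ι := Fin 4) (by simp) (v := ![u, z, 0, 0]) (s := {0, 1}) (by
      rw [orthonormal_iff_ite]
      rintro ⟨i, hi⟩ ⟨j, hj⟩
      simp only [Set.mem_insert_iff, Set.mem_singleton_iff] at hi hj
      rcases hi with rfl | rfl <;> rcases hj with rfl | rfl <;>
        simp [hu, hz1, huz, real_inner_comm])
  refine ⟨b, by simpa using hb 0 (by simp), ?_⟩
  have h1 : b 1 = z := by simpa using hb 1 (by simp)
  rw [h1, hz, smul_smul, mul_inv_cancel₀ hw.ne', one_smul]
  abel

lemma abs_inner_sub_le {δ : ℝ} {e x p : E4} (he : ‖e‖ = 1) (h : dist x p ≤ δ) :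
    |⟪e, x⟫ - ⟪e, p⟫| ≤ δ := by
  rw [← inner_sub_right]
  refine (abs_real_inner_le_norm _ _).trans ?_
  rwa [he, one_mul, ← dist_eq_norm]

lemma abs_inner_sub_le_of_mem_tube {δ : ℝ} {e x y v : E4} (he : ‖e‖ = 1) (hv : ⟪e, v⟫ = 0)
    (h : x ∈ tube δ y v) : |⟪e, x⟫ - ⟪e, y⟫| ≤ δ := by
  obtain ⟨t, -, ht⟩ := h
  have := abs_inner_sub_le he ht
  rwa [inner_add_right, inner_smul_right, hv, mul_zero, add_zero] at this

lemma onb_succ_orth (b : OrthonormalBasis (Fin 4) ℝ E4) (j : Fin 3) :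
    ⟪b j.succ, b 0⟫ = 0 := by
  rw [b.inner_eq_ite, if_neg (Fin.succ_ne_zero j)]

/-- Integration over a tube, slice by slice. -/
theorem setLIntegral_tube_le {δ : ℝ} (hδ : 0 < δ) (hδ1 : δ ≤ 1) {y v : E4} (hv : ‖v‖ = 1)
    {g : E4 → ℝ≥0∞} (hg : Measurable g) (M : ℝ≥0∞)
    (hM : ∀ z : E4, ∀ a : ℝ, ∫⁻ t in Set.Icc a (a + 10), g (z + t • v) ≤ M) :
    ∫⁻ x in tube δ y v, g x ≤ ENNReal.ofReal (8 * δ ^ 3) * M := by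
  obtain ⟨b, hb⟩ := exists_onb_first hv
  set α : Fin 4 → ℝ := Fin.cons (⟪v, y⟫ - δ) fun j => ⟪b j.succ, y⟫ - δ with hα
  set β : Fin 4 → ℝ := Fin.cons (⟪v, y⟫ + 1 + δ) fun j => ⟪b j.succ, y⟫ + δ with hβ
  have hsub : tube δ y v ⊆ onbBox b α β := by
    intro x hx
    rw [onbBox, Set.mem_ofPred_eq, Fin.forall_fin_succ]
    constructor
    · obtain ⟨t, ht, hd⟩ := hx
      have h1 := abs_le.1 (abs_inner_sub_le hv hd)
      rw [inner_add_right, inner_smul_right, real_inner_self_eq_norm_sq, hv] at h1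
      simp only [hα, hβ, Fin.cons_zero, hb]
      constructor <;> linarith [h1.1, h1.2, ht.1, ht.2]
    · intro j
      have h1 := abs_le.1 (abs_inner_sub_le_of_mem_tube (b.norm_eq_one j.succ)
        (by rw [← hb]; exact onb_succ_orth b j) hx)
      simp only [hα, hβ, Fin.cons_succ]
      constructor <;> linarith [h1.1, h1.2]
  refine (lintegral_mono_set hsub).trans ((setLIntegral_onbBox_le b 0 α β hg M fun z => ?_).trans ?_)
  · rw [hb]
    refine le_trans (lintegral_mono_set ?_) (hM z (α 0))
    refine Set.Icc_subset_Icc_right ?_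
    simp only [hα, hβ, Fin.cons_zero]; linarith
  · gcongr
    simp only [hα, hβ, Fin.zero_succAbove, Fin.cons_succ]
    rw [Finset.prod_congr rfl fun j _ => by
      rw [show ⟪b j.succ, y⟫ + δ - (⟪b j.succ, y⟫ - δ) = 2 * δ by ring],
      Finset.prod_const, Finset.card_fin, ← ENNReal.ofReal_pow (by positivity)]
    exact (congrArg ENNReal.ofReal (by ring)).le

theorem volume_tube_inter_le {δ : ℝ} (hδ : 0 < δ) {y v : E4} (hv : ‖v‖ = 1) (z : E4) {ρ : ℝ}
    (hρ : 0 ≤ ρ) :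
    volume (tube δ y v ∩ Metric.closedBall z ρ) ≤ ENNReal.ofReal (16 * δ ^ 3 * ρ) := by
  obtain ⟨b, hb⟩ := exists_onb_first hv
  set α : Fin 4 → ℝ := Fin.cons (⟪v, z⟫ - ρ) fun j => ⟪b j.succ, y⟫ - δ with hα
  set β : Fin 4 → ℝ := Fin.cons (⟪v, z⟫ + ρ) fun j => ⟪b j.succ, y⟫ + δ with hβ
  have hsub : tube δ y v ∩ Metric.closedBall z ρ ⊆ onbBox b α β := by
    rintro x ⟨hx, hxz⟩
    rw [onbBox, Set.mem_ofPred_eq, Fin.forall_fin_succ]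
    constructor
    · have h1 := abs_le.1 (abs_inner_sub_le hv hxz)
      simp only [hα, hβ, Fin.cons_zero, hb]
      constructor <;> linarith [h1.1, h1.2]
    · intro j
      have h1 := abs_le.1 (abs_inner_sub_le_of_mem_tube (b.norm_eq_one j.succ)
        (by rw [← hb]; exact onb_succ_orth b j) hx)
      simp only [hα, hβ, Fin.cons_succ]
      constructor <;> linarith [h1.1, h1.2]
  refine (measure_mono hsub).trans ?_
  rw [volume_onbBox, Fin.prod_univ_succ]
  simp only [hα, hβ, Fin.cons_succ, Fin.cons_zero]
  rw [Finset.prod_congr rfl fun j _ => by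
      rw [show ⟪b j.succ, y⟫ + δ - (⟪b j.succ, y⟫ - δ) = 2 * δ by ring],
      Finset.prod_const, Finset.card_fin, ← ENNReal.ofReal_pow (by positivity),
      ← ENNReal.ofReal_mul (by linarith)]
  exact (congrArg ENNReal.ofReal (by ring)).le

theorem volume_tube_inter_tube_le {δ : ℝ} (hδ : 0 < δ) {y v y' v' : E4} (hv : ‖v‖ = 1)
    (hv' : ‖v'‖ = 1) :
    volume (tube δ y v ∩ tube δ y' v') * ENNReal.ofReal (wedge2 v v') ≤
      ENNReal.ofReal (32 * δ ^ 4) := by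
  have hnn0 : 0 ≤ wedge2 v v' := Real.sqrt_nonneg _
  rcases hnn0.eq_or_lt with h0 | hpos
  · rw [← h0]; simp
  obtain ⟨b, hb, hvb⟩ := exists_onb_pair hv hpos
  set s := wedge2 v v' with hs
  set c := ⟪v, v'⟫ with hc
  have hb01 : ⟪b 0, b 1⟫ = 0 := by rw [b.inner_eq_ite, if_neg (by decide)]
  have hbn : ∀ j, ⟪b j, b j⟫ = 1 := fun j => by rw [b.inner_eq_ite, if_pos rfl]
  have hc1 : |c| ≤ 1 := by
    have := abs_real_inner_le_norm v v'
    rwa [hv, hv', one_mul] at this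
  have hcs : c ^ 2 + s ^ 2 = 1 := by
    rw [hs, wedge2, Real.sq_sqrt (Real.sqrt_pos.1 hpos).le, hv, hv']; ring
  -- the vector of the plane orthogonal to `v'`
  set n : E4 := c • b 1 - s • b 0 with hn
  have hnv : ⟪n, v'⟫ = 0 := by
    rw [hvb, hn, ← hb]
    simp only [inner_sub_left, inner_add_right, inner_smul_left, inner_smul_right, hbn, hb01,
      real_inner_comm (b 0) (b 1)]
    simp; ring
  have hnn : ‖n‖ = 1 := by
    have h1 : ‖n‖ ^ 2 = 1 := by
      rw [← real_inner_self_eq_norm_sq, hn]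
      simp only [inner_sub_left, inner_sub_right, inner_smul_left, inner_smul_right, hbn, hb01,
        real_inner_comm (b 0) (b 1)]
      simp; nlinarith
    nlinarith [norm_nonneg n]
  set m := (c * ⟪b 1, y⟫ - ⟪n, y'⟫) / s with hm
  set α : Fin 4 → ℝ := Fin.cons (m - 2 * δ / s) fun j => ⟪b j.succ, y⟫ - δ with hα
  set β : Fin 4 → ℝ := Fin.cons (m + 2 * δ / s) fun j => ⟪b j.succ, y⟫ + δ with hβ
  have hsub : tube δ y v ∩ tube δ y' v' ⊆ onbBox b α β := by
    rintro x ⟨hx, hx'⟩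
    have hj : ∀ j : Fin 3, |⟪b j.succ, x⟫ - ⟪b j.succ, y⟫| ≤ δ := fun j =>
      abs_inner_sub_le_of_mem_tube (b.norm_eq_one j.succ)
        (by rw [← hb]; exact onb_succ_orth b j) hx
    rw [onbBox, Set.mem_ofPred_eq, Fin.forall_fin_succ]
    constructor
    · have h1 := abs_inner_sub_le_of_mem_tube hnn hnv hx'
      have h2 : |⟪b 1, x⟫ - ⟪b 1, y⟫| ≤ δ := hj 0
      have h3 : ⟪n, x⟫ = c * ⟪b 1, x⟫ - s * ⟪b 0, x⟫ := by
        rw [hn, inner_sub_left, inner_smul_left, inner_smul_left]; rfl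
      have h4 : |s * ⟪b 0, x⟫ - s * m| ≤ 2 * δ := by
        have : s * m = c * ⟪b 1, y⟫ - ⟪n, y'⟫ := by rw [hm, mul_div_cancel₀ _ hpos.ne']
        rw [this, show s * ⟪b 0, x⟫ - (c * ⟪b 1, y⟫ - ⟪n, y'⟫) =
          c * (⟪b 1, x⟫ - ⟪b 1, y⟫) - (⟪n, x⟫ - ⟪n, y'⟫) by rw [h3]; ring]
        refine (abs_sub _ _).trans ?_
        rw [abs_mul]
        nlinarith [abs_nonneg c, abs_nonneg (⟪b 1, x⟫ - ⟪b 1, y⟫)]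
      rw [← mul_sub, abs_mul, abs_of_pos hpos, ← le_div_iff₀' hpos] at h4
      have h5 := abs_le.1 h4
      simp only [hα, hβ, Fin.cons_zero]
      constructor <;> linarith [h5.1, h5.2]
    · intro j
      have h1 := abs_le.1 (hj j)
      simp only [hα, hβ, Fin.cons_succ]
      constructor <;> linarith [h1.1, h1.2]
  refine (mul_le_mul_left (measure_mono hsub) _).trans ?_
  rw [volume_onbBox, Fin.prod_univ_succ]
  simp only [hα, hβ, Fin.cons_succ, Fin.cons_zero]
  rw [Finset.prod_congr rfl fun j _ => by
      rw [show ⟪b j.succ, y⟫ + δ - (⟪b j.succ, y⟫ - δ) = 2 * δ by ring],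
      Finset.prod_const, Finset.card_fin, ← ENNReal.ofReal_pow (by positivity),
      ← ENNReal.ofReal_mul (by ring_nf; positivity), ← ENNReal.ofReal_mul (by ring_nf; positivity)]
  refine (congrArg ENNReal.ofReal ?_).le
  field_simp
  ring

end TubeBox

section Gram

lemma inner_eq_sum4 (a b : E4) : ⟪a, b⟫ = a 0 * b 0 + a 1 * b 1 + a 2 * b 2 + a 3 * b 3 := by
  simp [PiLp.inner_apply, Fin.sum_univ_four, mul_comm]

lemma abs_minor_le_wedge2 (b c : E4) {i j : Fin 4} (hij : i < j) :
    |b i * c j - b j * c i| ≤ wedge2 b c := by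
  refine Real.abs_le_sqrt ?_
  rw [← real_inner_self_eq_norm_sq, ← real_inner_self_eq_norm_sq, inner_eq_sum4, inner_eq_sum4,
    inner_eq_sum4]
  have h : (b 0 * b 0 + b 1 * b 1 + b 2 * b 2 + b 3 * b 3) *
      (c 0 * c 0 + c 1 * c 1 + c 2 * c 2 + c 3 * c 3) -
      (b 0 * c 0 + b 1 * c 1 + b 2 * c 2 + b 3 * c 3) ^ 2 =
      (b 0 * c 1 - b 1 * c 0) ^ 2 + (b 0 * c 2 - b 2 * c 0) ^ 2 + (b 0 * c 3 - b 3 * c 0) ^ 2 +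
      (b 1 * c 2 - b 2 * c 1) ^ 2 + (b 1 * c 3 - b 3 * c 1) ^ 2 + (b 2 * c 3 - b 3 * c 2) ^ 2 := by
    ring
  rw [h]
  have := sq_nonneg (b 0 * c 1 - b 1 * c 0)
  have := sq_nonneg (b 0 * c 2 - b 2 * c 0)
  have := sq_nonneg (b 0 * c 3 - b 3 * c 0)
  have := sq_nonneg (b 1 * c 2 - b 2 * c 1)
  have := sq_nonneg (b 1 * c 3 - b 3 * c 1)
  have := sq_nonneg (b 2 * c 3 - b 3 * c 2)
  fin_cases i <;> fin_cases j <;> simp at hij ⊢ <;> linarith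

/-- The cross product of three vectors. -/
def cross3 (a b c : E4) : Fin 4 → ℝ :=
  ![a 1 * (b 2 * c 3 - b 3 * c 2) - b 1 * (a 2 * c 3 - a 3 * c 2) + c 1 * (a 2 * b 3 - a 3 * b 2),
    -(a 0 * (b 2 * c 3 - b 3 * c 2) - b 0 * (a 2 * c 3 - a 3 * c 2) +
      c 0 * (a 2 * b 3 - a 3 * b 2)),
    a 0 * (b 1 * c 3 - b 3 * c 1) - b 0 * (a 1 * c 3 - a 3 * c 1) + c 0 * (a 1 * b 3 - a 3 * b 1),
    -(a 0 * (b 1 * c 2 - b 2 * c 1) - b 0 * (a 1 * c 2 - a 2 * c 1) +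
      c 0 * (a 1 * b 2 - a 2 * b 1))]

lemma wedge3_eq_sqrt (a b c : E4) : wedge3 a b c = Real.sqrt (∑ k, cross3 a b c k ^ 2) := by
  rw [wedge3]
  congr 1
  simp only [Matrix.det_fin_three, Fin.sum_univ_four, inner_eq_sum4, cross3]
  simp
  ring

lemma wedge3_le_sum_abs (a b c : E4) : wedge3 a b c ≤ ∑ k, |cross3 a b c k| := by
  rw [wedge3_eq_sqrt, ← Real.sqrt_sq (Finset.sum_nonneg fun k _ => abs_nonneg (cross3 a b c k))]
  refine Real.sqrt_le_sqrt ?_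
  rw [sq, Finset.sum_mul_sum]
  refine Finset.sum_le_sum fun k _ => ?_
  rw [← sq_abs, sq]
  exact Finset.single_le_sum (f := fun m => |cross3 a b c k| * |cross3 a b c m|)
    (fun m _ => by positivity) (Finset.mem_univ k)

lemma abs_three_le {x y z X Y Z p q r : ℝ} (hx : |x| ≤ X) (hy : |y| ≤ Y) (hz : |z| ≤ Z) :
    |p * x - q * y + r * z| ≤ |p| * X + |q| * Y + |r| * Z := by
  refine (abs_add_le _ _).trans (add_le_add ((abs_sub _ _).trans (add_le_add ?_ ?_)) ?_) <;>
    rw [abs_mul] <;> gcongr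

lemma abs_cross3_le_of_lt (a b c p : E4) {j k : Fin 4} (hjk : j < k) :
    |p j * cross3 a b c k - p k * cross3 a b c j| ≤
      |⟪a, p⟫| * wedge2 b c + |⟪b, p⟫| * wedge2 a c + |⟪c, p⟫| * wedge2 a b := by
  have key : ∀ i l : Fin 4, i < l →
      |⟪a, p⟫ * (b i * c l - b l * c i) - ⟪b, p⟫ * (a i * c l - a l * c i) +
        ⟪c, p⟫ * (a i * b l - a l * b i)| ≤
      |⟪a, p⟫| * wedge2 b c + |⟪b, p⟫| * wedge2 a c + |⟪c, p⟫| * wedge2 a b := fun i l hil =>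
    abs_three_le (abs_minor_le_wedge2 b c hil) (abs_minor_le_wedge2 a c hil)
      (abs_minor_le_wedge2 a b hil)
  have main : ∃ i l : Fin 4, i < l ∧ (p j * cross3 a b c k - p k * cross3 a b c j =
        ⟪a, p⟫ * (b i * c l - b l * c i) - ⟪b, p⟫ * (a i * c l - a l * c i) +
        ⟪c, p⟫ * (a i * b l - a l * b i) ∨ p j * cross3 a b c k - p k * cross3 a b c j =
        -(⟪a, p⟫ * (b i * c l - b l * c i) - ⟪b, p⟫ * (a i * c l - a l * c i) +
        ⟪c, p⟫ * (a i * b l - a l * b i))) := by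
    simp only [inner_eq_sum4, cross3]
    fin_cases j <;> fin_cases k <;> simp only [Fin.lt_def] at hjk
    all_goals try omega
    · exact ⟨2, 3, by decide, Or.inr (by simp; ring)⟩
    · exact ⟨1, 3, by decide, Or.inl (by simp; ring)⟩
    · exact ⟨1, 2, by decide, Or.inr (by simp; ring)⟩
    · exact ⟨0, 3, by decide, Or.inr (by simp; ring)⟩
    · exact ⟨0, 2, by decide, Or.inl (by simp; ring)⟩
    · exact ⟨0, 1, by decide, Or.inr (by simp; ring)⟩
  obtain ⟨i, l, hil, h | h⟩ := main
  · rw [h]; exact key i l hil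
  · rw [h, abs_neg]; exact key i l hil

lemma abs_cross3_le (a b c p : E4) (j k : Fin 4) :
    |p j * cross3 a b c k - p k * cross3 a b c j| ≤
      |⟪a, p⟫| * wedge2 b c + |⟪b, p⟫| * wedge2 a c + |⟪c, p⟫| * wedge2 a b := by
  rcases lt_trichotomy j k with h | rfl | h
  · exact abs_cross3_le_of_lt a b c p h
  · rw [sub_self, abs_zero]
    have hw : ∀ b c : E4, 0 ≤ wedge2 b c := fun _ _ => Real.sqrt_nonneg _
    have := hw b c; have := hw a c; have := hw a b
    positivity
  · rw [abs_sub_comm]; exact abs_cross3_le_of_lt a b c p h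

/-- Two transversal normal vectors control the triple wedge product by bilinear ones. -/
theorem wedge3_le_of_normals (a b c p q : E4) {j l : Fin 4} {κ : ℝ} (hκ : 0 < κ)
    (hp : ∀ k, |p k| ≤ 1) (hpj : κ ≤ |p j|) (hqj : q j = 0) (hql : κ ≤ |q l|) :
    wedge3 a b c ≤ 8 / κ ^ 2 * ((|⟪a, p⟫| + |⟪a, q⟫|) * wedge2 b c +
      (|⟪b, p⟫| + |⟪b, q⟫|) * wedge2 a c + (|⟪c, p⟫| + |⟪c, q⟫|) * wedge2 a b) := by
  have hw : ∀ b c : E4, 0 ≤ wedge2 b c := fun _ _ => Real.sqrt_nonneg _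
  set Ep := |⟪a, p⟫| * wedge2 b c + |⟪b, p⟫| * wedge2 a c + |⟪c, p⟫| * wedge2 a b with hEp
  set Eq := |⟪a, q⟫| * wedge2 b c + |⟪b, q⟫| * wedge2 a c + |⟪c, q⟫| * wedge2 a b with hEq
  have hEp0 : 0 ≤ Ep := by have := hw b c; have := hw a c; have := hw a b; positivity
  have hEq0 : 0 ≤ Eq := by have := hw b c; have := hw a c; have := hw a b; positivity
  set N := cross3 a b c
  have hκ1 : κ ≤ 1 := hpj.trans (hp j)
  have h1 : κ * |N j| ≤ Eq := by
    have := abs_cross3_le a b c q l j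
    rw [hqj, zero_mul, sub_zero, abs_mul] at this
    exact le_trans (by gcongr) this
  have h2 : ∀ k, κ * |N k| ≤ Ep + |N j| := by
    intro k
    have h3 := abs_cross3_le a b c p j k
    have h4 : |p j * N k| ≤ Ep + |p k * N j| := by
      have := abs_sub_abs_le_abs_sub (p j * N k) (p k * N j)
      linarith
    rw [abs_mul, abs_mul] at h4
    have h5 : κ * |N k| ≤ |p j| * |N k| := by gcongr
    have h6 : |p k| * |N j| ≤ 1 * |N j| := by gcongr; exact hp k
    linarith
  have h3 : ∀ k, |N k| ≤ (Ep + Eq) / κ ^ 2 := by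
    intro k
    rw [le_div_iff₀ (by positivity)]
    have h4 := h2 k
    nlinarith [abs_nonneg (N k), abs_nonneg (N j)]
  refine (wedge3_le_sum_abs a b c).trans ((Finset.sum_le_sum fun k _ => h3 k).trans ?_)
  rw [Finset.sum_const, Finset.card_univ, Fintype.card_fin, nsmul_eq_mul]
  have h5 : (8 : ℝ) / κ ^ 2 * ((|⟪a, p⟫| + |⟪a, q⟫|) * wedge2 b c +
      (|⟪b, p⟫| + |⟪b, q⟫|) * wedge2 a c + (|⟪c, p⟫| + |⟪c, q⟫|) * wedge2 a b) =
      8 * ((Ep + Eq) / κ ^ 2) := by rw [hEp, hEq]; ring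
  rw [h5]
  have : 0 ≤ (Ep + Eq) / κ ^ 2 := by positivity
  push_cast
  linarith

lemma wedge3_nonneg (a b c : E4) : 0 ≤ wedge3 a b c := Real.sqrt_nonneg _

end Gram

section BadPieces

lemma continuous_abs_ev (P : Poly4) : Continuous fun x : E4 => |ev x P| := (continuous_ev P).abs

lemma pderiv_comm' (i j : Fin 4) (P : Poly4) :
    MvPolynomial.pderiv i (MvPolynomial.pderiv j P) =
      MvPolynomial.pderiv j (MvPolynomial.pderiv i P) := by
  induction P using MvPolynomial.induction_on with
  | C a => simp
  | add p q hp hq => simp [hp, hq]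
  | mul_X p l hp =>
    simp only [MvPolynomial.pderiv_mul, map_add, hp]
    have h : ∀ a b : Fin 4, MvPolynomial.pderiv a
        (MvPolynomial.pderiv b (MvPolynomial.X l : Poly4)) = 0 := by
      intro a b
      by_cases hb : b = l
      · subst hb; simp
      · rw [MvPolynomial.pderiv_X_of_ne (Ne.symm hb), map_zero]
    rw [h, h]
    ring

lemma pderiv_wordDeriv_eq_zero {P : Poly4} {l : Fin 4} (h : MvPolynomial.pderiv l P = 0)
    (w : List (Fin 4)) : MvPolynomial.pderiv l (wordDeriv P w) = 0 := by
  induction w with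
  | nil => exact h
  | cons i w ih => rw [wordDeriv, pderiv_comm', ih, map_zero]

/-- Points where `R` is small compared with its gradient, whose `j`-th component dominates. -/
def badPiece (K δ : ℝ) (R : Poly4) (j : Fin 4) : Set E4 :=
  {x | |ev x R| < K * δ * |ev x (MvPolynomial.pderiv j R)| ∧
    ∀ l, |ev x (MvPolynomial.pderiv l R)| ≤ |ev x (MvPolynomial.pderiv j R)|}

lemma measurableSet_badPiece (K δ : ℝ) (R : Poly4) (j : Fin 4) :
    MeasurableSet (badPiece K δ R j) := by
  have h : badPiece K δ R j =
      {x | |ev x R| < K * δ * |ev x (MvPolynomial.pderiv j R)|} ∩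
      ⋂ l, {x | |ev x (MvPolynomial.pderiv l R)| ≤ |ev x (MvPolynomial.pderiv j R)|} := by
    ext x; simp [badPiece]
  rw [h]
  exact (measurableSet_lt (continuous_abs_ev _).measurable
    ((continuous_abs_ev _).measurable.const_mul _)).inter
    (MeasurableSet.iInter fun l => measurableSet_le (continuous_abs_ev _).measurable
      (continuous_abs_ev _).measurable)

/-- Words of length at most `D` in four letters. -/
abbrev Word (D : ℕ) := Σ n : Fin (D + 1), (Fin n → Fin 4)

lemma exists_mem_badPiece {K δ : ℝ} (hK : 0 < K) (hδ : 0 < δ) {P : Poly4} {D : ℕ}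
    (hD : P.totalDegree ≤ D) {x : E4} (hx : ¬ GoodPt K δ P x) :
    ∃ (w : Word D) (j : Fin 4), x ∈ badPiece K δ (wordDeriv P (List.ofFn w.2)) j := by
  rw [GoodPt.finite_words] at hx
  push Not at hx
  obtain ⟨w, hw, i, hi⟩ := hx
  obtain ⟨j, hj⟩ := Finite.exists_max
    fun l => |ev x (MvPolynomial.pderiv l (wordDeriv P w))|
  refine ⟨⟨⟨w.length, by omega⟩, w.get⟩, j, ?_⟩
  simp only [List.ofFn_get]
  refine ⟨hi.trans_le ?_, hj⟩
  exact mul_le_mul_of_nonneg_left (hj i) (by positivity)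

lemma exists_setLIntegral_bad_le (D : ℕ) : ∃ L : ℕ, 0 < L ∧ ∀ {K δ : ℝ}, 0 < K → 0 < δ →
    ∀ P : Poly4, P.totalDegree ≤ D → ∀ f : E4 → ℝ≥0∞, ∃ (R : Poly4) (j : Fin 4),
      R.totalDegree ≤ D ∧
      (∀ l, MvPolynomial.pderiv l P = 0 → MvPolynomial.pderiv l R = 0) ∧
      ∫⁻ x in {x | ¬ GoodPt K δ P x}, f x ≤ L * ∫⁻ x in badPiece K δ R j, f x := by
  classical
  refine ⟨Fintype.card (Word D × Fin 4), Fintype.card_pos_iff.2 ⟨⟨⟨0, Fin.elim0⟩, 0⟩⟩, ?_⟩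
  intro K δ hK hδ P hP f
  have : Nonempty (Word D × Fin 4) := ⟨⟨⟨0, Fin.elim0⟩, 0⟩⟩
  let s : Word D × Fin 4 → Set E4 := fun p => badPiece K δ (wordDeriv P (List.ofFn p.1.2)) p.2
  obtain ⟨p, hp⟩ := Finite.exists_max fun p => ∫⁻ x in s p, f x
  refine ⟨wordDeriv P (List.ofFn p.1.2), p.2,
    ((totalDegree_wordDeriv_le _ _).trans (Nat.sub_le _ _)).trans hP,
    fun l hl => pderiv_wordDeriv_eq_zero hl _, ?_⟩
  calc ∫⁻ x in {x | ¬ GoodPt K δ P x}, f x ≤ ∫⁻ x in ⋃ p, s p, f x := by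
        refine lintegral_mono_set fun x hx => ?_
        obtain ⟨w, j, h⟩ := exists_mem_badPiece hK hδ hP hx
        exact Set.mem_iUnion.2 ⟨(w, j), h⟩
    _ ≤ ∑' p, ∫⁻ x in s p, f x := lintegral_iUnion_le _ _
    _ = ∑ p, ∫⁻ x in s p, f x := tsum_fintype _
    _ ≤ Finset.univ.card • ∫⁻ x in s p, f x := Finset.sum_le_card_nsmul _ _ _ fun q _ => hp q
    _ = _ := by rw [nsmul_eq_mul, Finset.card_univ]

end BadPieces

section Normals

lemma inner_eq_sum (a b : E4) : ⟪a, b⟫ = ∑ i, a i * b i := by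
  rw [inner_eq_sum4, Fin.sum_univ_four]

/-- A bounded multiple of the gradient of `R`, close to a unit normal of the zero set. -/
def nrm (δ : ℝ) (R : Poly4) (x : E4) : E4 :=
  WithLp.toLp 2 fun k => δ * ev x (MvPolynomial.pderiv k R) /
    (|ev x R| + δ * ∑ i, |ev x (MvPolynomial.pderiv i R)|)

lemma nrm_apply (δ : ℝ) (R : Poly4) (x : E4) (k : Fin 4) :
    nrm δ R x k = δ * ev x (MvPolynomial.pderiv k R) /
    (|ev x R| + δ * ∑ i, |ev x (MvPolynomial.pderiv i R)|) := rfl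

lemma measurable_nrm_apply (δ : ℝ) (R : Poly4) (k : Fin 4) : Measurable fun x => nrm δ R x k := by
  simp only [nrm_apply]
  refine ((continuous_ev _).measurable.const_mul _).div
    ((continuous_abs_ev _).measurable.add (Measurable.const_mul ?_ _))
  exact Finset.measurable_fun_sum _ fun i _ => (continuous_abs_ev _).measurable

lemma abs_nrm_apply_le {δ : ℝ} (hδ : 0 < δ) (R : Poly4) (x : E4) (k : Fin 4) :
    |nrm δ R x k| ≤ 1 := by
  rw [nrm_apply, abs_div, abs_mul, abs_of_pos hδ]
  have h1 : |ev x (MvPolynomial.pderiv k R)| ≤ ∑ i, |ev x (MvPolynomial.pderiv i R)| :=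
    Finset.single_le_sum (f := fun i => |ev x (MvPolynomial.pderiv i R)|)
      (fun i _ => abs_nonneg _) (Finset.mem_univ k)
  have h2 : 0 ≤ |ev x R| := abs_nonneg _
  have h3 := mul_le_mul_of_nonneg_left h1 hδ.le
  refine div_le_one_of_le₀ (le_trans ?_ (le_abs_self _)) (abs_nonneg _)
  linarith

lemma le_abs_nrm_apply {K δ : ℝ} (hK : 0 < K) (hδ : 0 < δ) {R : Poly4} {j : Fin 4} {x : E4}
    (hx : x ∈ badPiece K δ R j) : 1 / (K + 4) ≤ |nrm δ R x j| := by
  obtain ⟨h1, h2⟩ := hx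
  rw [nrm_apply, abs_div, abs_mul, abs_of_pos hδ]
  have h3 : ∑ i, |ev x (MvPolynomial.pderiv i R)| ≤ 4 * |ev x (MvPolynomial.pderiv j R)| := by
    refine (Finset.sum_le_card_nsmul _ _ _ fun i _ => h2 i).trans ?_
    simp
  have h6 : |ev x (MvPolynomial.pderiv j R)| ≤ ∑ i, |ev x (MvPolynomial.pderiv i R)| :=
    Finset.single_le_sum (f := fun i => |ev x (MvPolynomial.pderiv i R)|)
      (fun i _ => abs_nonneg _) (Finset.mem_univ j)
  have h4 : 0 ≤ |ev x R| := abs_nonneg _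
  generalize ∑ i, |ev x (MvPolynomial.pderiv i R)| = S at *
  generalize |ev x (MvPolynomial.pderiv j R)| = g at *
  generalize |ev x R| = r at *
  have hg0 : 0 < g := by
    by_contra! h
    have : K * δ * g ≤ 0 := mul_nonpos_of_nonneg_of_nonpos (by positivity) h
    linarith
  have h7 := mul_le_mul_of_nonneg_left h3 hδ.le
  have h8 := mul_le_mul_of_nonneg_left h6 hδ.le
  have h9 : 0 < δ * g := by positivity
  rw [abs_of_nonneg (by linarith), div_le_div_iff₀ (by positivity) (by linarith)]
  linarith

lemma abs_inner_nrm_le {δ : ℝ} (hδ : 0 < δ) (R : Poly4) {v : E4} (hv : ‖v‖ = 1) (z : E4) (t : ℝ) :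
    |⟪v, nrm δ R (z + t • v)⟫| ≤ δ * |(lineRes z v R).derivative.eval t| /
      (|(lineRes z v R).eval t| + δ * |(lineRes z v R).derivative.eval t|) := by
  have h1 : (lineRes z v R).derivative.eval t =
      ∑ i, v i * ev (z + t • v) (MvPolynomial.pderiv i R) := by
    rw [derivative_lineRes]
    simp only [Polynomial.eval_finsetSum, Polynomial.eval_mul, Polynomial.eval_C, eval_lineRes]
  have h2 : ⟪v, nrm δ R (z + t • v)⟫ = δ * (lineRes z v R).derivative.eval t /
      (|ev (z + t • v) R| + δ * ∑ i, |ev (z + t • v) (MvPolynomial.pderiv i R)|) := by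
    rw [inner_eq_sum, h1, Finset.mul_sum, Finset.sum_div]
    refine Finset.sum_congr rfl fun i _ => ?_
    rw [nrm_apply]; ring
  have h3 : |(lineRes z v R).derivative.eval t| ≤
      ∑ i, |ev (z + t • v) (MvPolynomial.pderiv i R)| := by
    rw [h1]
    refine (Finset.abs_sum_le_sum_abs _ _).trans (Finset.sum_le_sum fun i _ => ?_)
    rw [abs_mul]
    have := abs_coord_le v i
    rw [hv] at this
    exact mul_le_of_le_one_left (abs_nonneg _) this
  rw [h2, eval_lineRes, abs_div, abs_mul, abs_of_pos hδ]
  set r' := |(lineRes z v R).derivative.eval t|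
  set S := ∑ i, |ev (z + t • v) (MvPolynomial.pderiv i R)|
  set r := |ev (z + t • v) R| with hr
  have hr0 : 0 ≤ r := abs_nonneg _
  have hr'0 : 0 ≤ r' := abs_nonneg _
  rcases hr'0.eq_or_lt with h | h
  · rw [← h]; simp
  · have := mul_le_mul_of_nonneg_left h3 hδ.le
    rw [abs_of_nonneg (by nlinarith)]
    exact div_le_div_of_nonneg_left (by positivity) (by positivity) (by linarith)

lemma measurable_abs_inner_nrm (δ : ℝ) (R : Poly4) (v : E4) :
    Measurable fun x => ENNReal.ofReal |⟪v, nrm δ R x⟫| := by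
  simp only [inner_eq_sum]
  refine ENNReal.measurable_ofReal.comp (continuous_abs.measurable.comp ?_)
  exact Finset.measurable_fun_sum _ fun i _ => (measurable_nrm_apply _ _ _).const_mul _

lemma exists_setLIntegral_tube_nrm_le {ε : ℝ} (hε : 0 < ε) (hε1 : ε ≤ 1) (D : ℕ) :
    ∃ C > 0, ∀ δ : ℝ, 0 < δ → δ ≤ 1 → ∀ (y v : E4), ‖v‖ = 1 → ∀ R : Poly4, R.totalDegree ≤ D →
      ∫⁻ x in tube δ y v, ENNReal.ofReal |⟪v, nrm δ R x⟫| ≤ ENNReal.ofReal (C * δ ^ (4 - ε)) := by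
  obtain ⟨C, hC, h⟩ := exists_lintegral_logDeriv_le hε hε1 D
  refine ⟨8 * C, by positivity, fun δ hδ hδ1 y v hv R hR => ?_⟩
  refine (setLIntegral_tube_le hδ hδ1 hv (measurable_abs_inner_nrm δ R v)
    (ENNReal.ofReal (C * δ ^ (1 - ε))) fun z a => ?_).trans ?_
  · refine (lintegral_mono fun t => ENNReal.ofReal_le_ofReal (abs_inner_nrm_le hδ R hv z t)).trans ?_
    exact h δ hδ a _ ((natDegree_lineRes_le _ _ _).trans hR)
  · rw [← ENNReal.ofReal_mul (by positivity)]
    refine ENNReal.ofReal_le_ofReal (le_of_eq ?_)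
    rw [show (4 - ε : ℝ) = (3 : ℕ) + (1 - ε) by push_cast; ring, Real.rpow_add hδ,
      Real.rpow_natCast]
    ring

end Normals

section TripleSum

/-- The indicator function of a tube. -/
def tubeInd (δ : ℝ) (y v x : E4) : ℝ≥0∞ := (tube δ y v).indicator 1 x

lemma measurable_tubeInd (δ : ℝ) (y v : E4) : Measurable (tubeInd δ y v) :=
  measurable_one.indicator (measurableSet_tube δ y v)

lemma tubeInd_of_mem {δ : ℝ} {y v x : E4} (h : x ∈ tube δ y v) : tubeInd δ y v x = 1 := by
  simp [tubeInd, h]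

lemma tubeInd_of_notMem {δ : ℝ} {y v x : E4} (h : x ∉ tube δ y v) : tubeInd δ y v x = 0 := by
  simp [tubeInd, h]

lemma setLIntegral_tubeInd_mul (δ : ℝ) (y v : E4) (X : Set E4) (φ : E4 → ℝ≥0∞) :
    ∫⁻ x in X, tubeInd δ y v x * φ x ≤ ∫⁻ x in tube δ y v, φ x := by
  calc ∫⁻ x in X, tubeInd δ y v x * φ x ≤ ∫⁻ x, tubeInd δ y v x * φ x := setLIntegral_le_lintegral _ _
    _ = ∫⁻ x, (tube δ y v).indicator φ x := by
      refine lintegral_congr fun x => ?_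
      by_cases h : x ∈ tube δ y v
      · simp [tubeInd_of_mem h, h]
      · simp [tubeInd_of_notMem h, h]
    _ = _ := lintegral_indicator (measurableSet_tube δ y v) _

variable {ι : Type}

/-- The weighted number of triples of tubes through a point. -/
def tripleSum (δ s : ℝ) (y v : ι → E4) (A : Fin 3 → Finset ι) (x : E4) : ℝ≥0∞ :=
  ∑ i ∈ A 0, ∑ j ∈ A 1, ∑ k ∈ A 2,
    tubeInd δ (y i) (v i) x * tubeInd δ (y j) (v j) x * tubeInd δ (y k) (v k) x *
      ENNReal.ofReal (wedge3 (v i) (v j) (v k) ^ s)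

lemma measurable_tripleSum (δ s : ℝ) (y v : ι → E4) (A : Fin 3 → Finset ι) :
    Measurable (tripleSum δ s y v A) := by
  refine Finset.measurable_fun_sum _ fun i _ => Finset.measurable_fun_sum _ fun j _ =>
    Finset.measurable_fun_sum _ fun k _ => Measurable.mul_const ?_ _
  exact ((measurable_tubeInd _ _ _).mul (measurable_tubeInd _ _ _)).mul (measurable_tubeInd _ _ _)

/-- The weighted number of pairs of tubes through a point. -/
def pairSum (δ : ℝ) (y v : ι → E4) (A B : Finset ι) (x : E4) : ℝ≥0∞ :=
  ∑ i ∈ A, ∑ j ∈ B, tubeInd δ (y i) (v i) x * tubeInd δ (y j) (v j) x *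
      ENNReal.ofReal (wedge2 (v i) (v j))

lemma measurable_pairSum (δ : ℝ) (y v : ι → E4) (A B : Finset ι) :
    Measurable (pairSum δ y v A B) := by
  refine Finset.measurable_fun_sum _ fun i _ => Finset.measurable_fun_sum _ fun j _ =>
    Measurable.mul_const ?_ _
  exact (measurable_tubeInd _ _ _).mul (measurable_tubeInd _ _ _)

lemma lintegral_pairSum_le {δ : ℝ} (hδ : 0 < δ) (y v : ι → E4) (hv : ∀ i, ‖v i‖ = 1)
    (A B : Finset ι) (X : Set E4) :
    ∫⁻ x in X, pairSum δ y v A B x ≤ A.card * (B.card * ENNReal.ofReal (32 * δ ^ 4)) := by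
  have h : ∀ i j, Measurable fun x => tubeInd δ (y i) (v i) x * tubeInd δ (y j) (v j) x *
      ENNReal.ofReal (wedge2 (v i) (v j)) := fun i j =>
    ((measurable_tubeInd _ _ _).mul (measurable_tubeInd _ _ _)).mul_const _
  unfold pairSum
  rw [lintegral_finsetSum _ fun i _ => Finset.measurable_fun_sum _ fun j _ => h i j]
  rw [← nsmul_eq_mul]
  refine Finset.sum_le_card_nsmul _ _ _ fun i _ => ?_
  rw [lintegral_finsetSum _ fun j _ => h i j, ← nsmul_eq_mul]
  refine Finset.sum_le_card_nsmul _ _ _ fun j _ => ?_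
  refine le_trans ?_ (volume_tube_inter_tube_le hδ (y := y i) (y' := y j) (hv i) (hv j))
  simp only [mul_assoc]
  refine (setLIntegral_tubeInd_mul _ _ _ _ _).trans ?_
  rw [lintegral_mul_const _ (measurable_tubeInd _ _ _)]
  gcongr
  rw [Set.inter_comm]
  unfold tubeInd
  rw [lintegral_indicator_one (measurableSet_tube _ _ _),
    Measure.restrict_apply (measurableSet_tube _ _ _)]

/-- The number of tubes through a point, weighted by `φ`. -/
def weightSum (δ : ℝ) (y v : ι → E4) (φ : E4 → E4 → ℝ≥0∞) (A : Finset ι) (x : E4) : ℝ≥0∞ :=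
  ∑ i ∈ A, tubeInd δ (y i) (v i) x * φ (v i) x

lemma measurable_weightSum (δ : ℝ) (y v : ι → E4) {φ : E4 → E4 → ℝ≥0∞} (hφ : ∀ u, Measurable (φ u))
    (A : Finset ι) : Measurable (weightSum δ y v φ A) :=
  Finset.measurable_fun_sum _ fun _ _ => (measurable_tubeInd _ _ _).mul (hφ _)

lemma lintegral_weightSum_le {δ : ℝ} (y v : ι → E4) {φ : E4 → E4 → ℝ≥0∞}
    (hφ : ∀ u, Measurable (φ u)) {M : ℝ≥0∞} (hM : ∀ i, ∫⁻ x in tube δ (y i) (v i), φ (v i) x ≤ M)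
    (A : Finset ι) (X : Set E4) :
    ∫⁻ x in X, weightSum δ y v φ A x ≤ A.card * M := by
  have h : ∀ i, Measurable fun x => tubeInd δ (y i) (v i) x * φ (v i) x := fun i =>
    (measurable_tubeInd _ _ _).mul (hφ _)
  unfold weightSum
  rw [lintegral_finsetSum _ fun i _ => h i, ← nsmul_eq_mul]
  exact Finset.sum_le_card_nsmul _ _ _ fun i _ => (setLIntegral_tubeInd_mul _ _ _ _ _).trans (hM i)

lemma tripleSum_le_of_wedge3_le {δ : ℝ} (y v : ι → E4) (A : Fin 3 → Finset ι) (x : E4)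
    (φ : E4 → E4 → ℝ≥0∞) (c : ℝ≥0∞)
    (h : ∀ i j k : ι, ENNReal.ofReal (wedge3 (v i) (v j) (v k) ^ (1 : ℝ)) ≤
      c * (φ (v i) x * ENNReal.ofReal (wedge2 (v j) (v k)) +
        φ (v j) x * ENNReal.ofReal (wedge2 (v i) (v k)) +
        φ (v k) x * ENNReal.ofReal (wedge2 (v i) (v j)))) :
    tripleSum δ 1 y v A x ≤ c * (weightSum δ y v φ (A 0) x * pairSum δ y v (A 1) (A 2) x +
      weightSum δ y v φ (A 1) x * pairSum δ y v (A 0) (A 2) x +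
      weightSum δ y v φ (A 2) x * pairSum δ y v (A 0) (A 1) x) := by
  have e1 : ∀ (a : ι → ℝ≥0∞) (b : ι → ι → ℝ≥0∞),
      (∑ i ∈ A 0, a i) * (∑ j ∈ A 1, ∑ k ∈ A 2, b j k) =
        ∑ i ∈ A 0, ∑ j ∈ A 1, ∑ k ∈ A 2, a i * b j k := by
    intro a b
    rw [Finset.sum_mul]
    refine Finset.sum_congr rfl fun i _ => ?_
    simp only [Finset.mul_sum]
  have e2 : ∀ (a : ι → ℝ≥0∞) (b : ι → ι → ℝ≥0∞),
      (∑ j ∈ A 1, a j) * (∑ i ∈ A 0, ∑ k ∈ A 2, b i k) =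
        ∑ i ∈ A 0, ∑ j ∈ A 1, ∑ k ∈ A 2, a j * b i k := by
    intro a b
    rw [Finset.mul_sum]
    refine Finset.sum_congr rfl fun i _ => ?_
    rw [Finset.sum_mul]
    refine Finset.sum_congr rfl fun j _ => ?_
    rw [Finset.mul_sum]
  have e3 : ∀ (a : ι → ℝ≥0∞) (b : ι → ι → ℝ≥0∞),
      (∑ k ∈ A 2, a k) * (∑ i ∈ A 0, ∑ j ∈ A 1, b i j) =
        ∑ i ∈ A 0, ∑ j ∈ A 1, ∑ k ∈ A 2, a k * b i j := by
    intro a b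
    rw [Finset.mul_sum]
    refine Finset.sum_congr rfl fun i _ => ?_
    rw [Finset.mul_sum]
    refine Finset.sum_congr rfl fun i _ => ?_
    rw [Finset.sum_mul]
  unfold tripleSum weightSum pairSum
  rw [e1, e2, e3]
  simp only [← Finset.sum_add_distrib, Finset.mul_sum]
  refine Finset.sum_le_sum fun i _ => Finset.sum_le_sum fun j _ => Finset.sum_le_sum fun k _ => ?_
  refine (mul_le_mul_right (h i j k) _).trans (le_of_eq ?_)
  ring

/-- Trilinear estimate near the intersection of two transversal hypersurfaces. -/
theorem exists_setLIntegral_badPiece_inter_le {ε : ℝ} (hε : 0 < ε) (hε1 : ε ≤ 1) (D : ℕ) :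
    ∃ C > 0, ∀ δ : ℝ, 0 < δ → δ ≤ 1 → ∀ (ι : Type) (y v : ι → E4), (∀ i, ‖v i‖ = 1) →
      ∀ R R' : Poly4, R.totalDegree ≤ D → R'.totalDegree ≤ D → ∀ j j' : Fin 4,
      MvPolynomial.pderiv j R' = 0 → ∀ A : Fin 3 → Finset ι,
      ∫⁻ x in badPiece 24 δ R j ∩ badPiece 24 δ R' j', tripleSum δ 1 y v A x ^ (1 / 2 : ℝ) ≤
        ENNReal.ofReal (C * δ ^ (4 - ε)) *
          (((A 0).card : ℝ≥0∞) * (A 1).card * (A 2).card) ^ (1 / 2 : ℝ) := by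
  obtain ⟨C, hC, hCt⟩ := exists_setLIntegral_tube_nrm_le hε hε1 D
  let c : ℝ≥0∞ := ENNReal.ofReal (8 / (1 / 28) ^ 2)
  let C' : ℝ := 8 / (1 / 28) ^ 2 * (2 * C * 32)
  refine ⟨3 * (1 + C'), by positivity, fun δ hδ hδ1 ι y v hv R R' hR hR' j j' hjR A => ?_⟩
  let φ : E4 → E4 → ℝ≥0∞ := fun u x =>
    ENNReal.ofReal |⟪u, nrm δ R x⟫| + ENNReal.ofReal |⟪u, nrm δ R' x⟫|
  have hφ : ∀ u, Measurable (φ u) := fun u =>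
    (measurable_abs_inner_nrm δ R u).add (measurable_abs_inner_nrm δ R' u)
  let M : ℝ≥0∞ := ENNReal.ofReal (2 * C * δ ^ (4 - ε))
  have hM : ∀ i, ∫⁻ x in tube δ (y i) (v i), φ (v i) x ≤ M := by
    intro i
    change ∫⁻ x in tube δ (y i) (v i), (_ + _) ≤ _
    rw [lintegral_add_left (measurable_abs_inner_nrm δ R _)]
    refine (add_le_add (hCt δ hδ hδ1 (y i) (v i) (hv i) R hR)
      (hCt δ hδ hδ1 (y i) (v i) (hv i) R' hR')).trans ?_
    rw [← ENNReal.ofReal_add (by positivity) (by positivity)]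
    exact (congrArg ENNReal.ofReal (by ring)).le
  set X := badPiece 24 δ R j ∩ badPiece 24 δ R' j' with hX
  have hXm : MeasurableSet X := (measurableSet_badPiece _ _ _ _).inter (measurableSet_badPiece _ _ _ _)
  set W : Fin 3 → E4 → ℝ≥0∞ := fun m => weightSum δ y v φ (A m) with hW
  set P : Fin 3 → Fin 3 → E4 → ℝ≥0∞ := fun m n => pairSum δ y v (A m) (A n) with hP
  have hpt : ∀ x ∈ X, tripleSum δ 1 y v A x ^ (1 / 2 : ℝ) ≤ c ^ (1 / 2 : ℝ) *
      (W 0 x ^ (1 / 2 : ℝ) * P 1 2 x ^ (1 / 2 : ℝ) + W 1 x ^ (1 / 2 : ℝ) * P 0 2 x ^ (1 / 2 : ℝ) +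
        W 2 x ^ (1 / 2 : ℝ) * P 0 1 x ^ (1 / 2 : ℝ)) := by
    intro x hx
    have h1 := tripleSum_le_of_wedge3_le (δ := δ) y v A x φ c (fun i j₁ k => by
      have hq : nrm δ R' x j = 0 := by rw [nrm_apply, hjR]; simp
      have hp1 := le_abs_nrm_apply (by norm_num) hδ hx.1
      have hp2 := le_abs_nrm_apply (by norm_num) hδ hx.2
      norm_num at hp1 hp2
      have := wedge3_le_of_normals (v i) (v j₁) (v k) (nrm δ R x) (nrm δ R' x) (j := j) (l := j')
        (κ := 1 / 28) (by norm_num) (abs_nrm_apply_le hδ R x) hp1 hq hp2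
      have hn : ∀ b c : E4, 0 ≤ wedge2 b c := fun _ _ => Real.sqrt_nonneg _
      have n1 := hn (v j₁) (v k)
      have n2 := hn (v i) (v k)
      have n3 := hn (v i) (v j₁)
      rw [Real.rpow_one]
      refine (ENNReal.ofReal_le_ofReal this).trans (le_of_eq ?_)
      simp only [φ, c]
      rw [ENNReal.ofReal_mul (by norm_num), ENNReal.ofReal_add (by positivity) (by positivity),
        ENNReal.ofReal_add (by positivity) (by positivity), ENNReal.ofReal_mul (by positivity),
        ENNReal.ofReal_mul (by positivity), ENNReal.ofReal_mul (by positivity),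
        ENNReal.ofReal_add (by positivity) (by positivity),
        ENNReal.ofReal_add (by positivity) (by positivity),
        ENNReal.ofReal_add (by positivity) (by positivity)])
    refine (ENNReal.rpow_le_rpow h1 (by norm_num)).trans ?_
    rw [ENNReal.mul_rpow_of_nonneg _ _ (by norm_num)]
    gcongr
    refine (ENNReal.rpow_add_le_add_rpow _ _ (by norm_num) (by norm_num)).trans ?_
    rw [← ENNReal.mul_rpow_of_nonneg (W 2 x) _ (by norm_num)]
    refine add_le_add ?_ le_rfl
    refine (ENNReal.rpow_add_le_add_rpow _ _ (by norm_num) (by norm_num)).trans ?_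
    rw [← ENNReal.mul_rpow_of_nonneg (W 0 x) _ (by norm_num),
      ← ENNReal.mul_rpow_of_nonneg (W 1 x) _ (by norm_num)]
  have hWm : ∀ m, Measurable (W m) := fun m => measurable_weightSum _ _ _ hφ _
  have hPm : ∀ m n, Measurable (P m n) := fun m n => measurable_pairSum _ _ _ _ _
  have hmm : ∀ m n p, Measurable fun x => W m x ^ (1 / 2 : ℝ) * P n p x ^ (1 / 2 : ℝ) := fun m n p =>
    ((hWm m).pow_const _).mul ((hPm n p).pow_const _)
  have hterm : ∀ m n p, ∫⁻ x in X, W m x ^ (1 / 2 : ℝ) * P n p x ^ (1 / 2 : ℝ) ≤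
      (M * ENNReal.ofReal (32 * δ ^ 4)) ^ (1 / 2 : ℝ) *
        (((A m).card : ℝ≥0∞) * (A n).card * (A p).card) ^ (1 / 2 : ℝ) := by
    intro m n p
    refine (ENNReal.lintegral_mul_norm_pow_le (hWm m).aemeasurable (hPm n p).aemeasurable
      (by norm_num) (by norm_num) (by norm_num)).trans ?_
    rw [← ENNReal.mul_rpow_of_nonneg _ _ (by norm_num), ← ENNReal.mul_rpow_of_nonneg _ _ (by norm_num)]
    refine ENNReal.rpow_le_rpow ?_ (by norm_num)
    refine (mul_le_mul' (lintegral_weightSum_le y v hφ hM (A m) X)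
      (lintegral_pairSum_le hδ y v hv (A n) (A p) X)).trans (le_of_eq ?_)
    ring
  calc ∫⁻ x in X, tripleSum δ 1 y v A x ^ (1 / 2 : ℝ)
      ≤ ∫⁻ x in X, c ^ (1 / 2 : ℝ) *
      (W 0 x ^ (1 / 2 : ℝ) * P 1 2 x ^ (1 / 2 : ℝ) + W 1 x ^ (1 / 2 : ℝ) * P 0 2 x ^ (1 / 2 : ℝ) +
        W 2 x ^ (1 / 2 : ℝ) * P 0 1 x ^ (1 / 2 : ℝ)) := setLIntegral_mono_ae' hXm
          (Filter.Eventually.of_forall hpt)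
    _ = c ^ (1 / 2 : ℝ) * ((∫⁻ x in X, W 0 x ^ (1 / 2 : ℝ) * P 1 2 x ^ (1 / 2 : ℝ)) +
        (∫⁻ x in X, W 1 x ^ (1 / 2 : ℝ) * P 0 2 x ^ (1 / 2 : ℝ)) +
        ∫⁻ x in X, W 2 x ^ (1 / 2 : ℝ) * P 0 1 x ^ (1 / 2 : ℝ)) := by
      have h2 : Measurable fun x => W 0 x ^ (1 / 2 : ℝ) * P 1 2 x ^ (1 / 2 : ℝ) +
          W 1 x ^ (1 / 2 : ℝ) * P 0 2 x ^ (1 / 2 : ℝ) := (hmm _ _ _).add (hmm _ _ _)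
      have h3 : Measurable fun x => W 0 x ^ (1 / 2 : ℝ) * P 1 2 x ^ (1 / 2 : ℝ) +
          W 1 x ^ (1 / 2 : ℝ) * P 0 2 x ^ (1 / 2 : ℝ) +
          W 2 x ^ (1 / 2 : ℝ) * P 0 1 x ^ (1 / 2 : ℝ) := h2.add (hmm _ _ _)
      rw [lintegral_const_mul _ h3, lintegral_add_left h2, lintegral_add_left (hmm _ _ _)]
    _ ≤ c ^ (1 / 2 : ℝ) * (3 * ((M * ENNReal.ofReal (32 * δ ^ 4)) ^ (1 / 2 : ℝ) *
        (((A 0).card : ℝ≥0∞) * (A 1).card * (A 2).card) ^ (1 / 2 : ℝ))) := by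
      gcongr
      refine (add_le_add (add_le_add (hterm 0 1 2) (hterm 1 0 2)) (hterm 2 0 1)).trans (le_of_eq ?_)
      rw [mul_comm ((A 1).card : ℝ≥0∞) (A 0).card, mul_right_comm ((A 0).card : ℝ≥0∞) (A 1).card,
        mul_comm ((A 2).card : ℝ≥0∞) (A 0).card]
      ring
    _ = (3 * (c * (M * ENNReal.ofReal (32 * δ ^ 4))) ^ (1 / 2 : ℝ)) *
        (((A 0).card : ℝ≥0∞) * (A 1).card * (A 2).card) ^ (1 / 2 : ℝ) := by
      rw [ENNReal.mul_rpow_of_nonneg c _ (by norm_num)]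
      ring
    _ ≤ _ := by
      gcongr
      have e : c * (M * ENNReal.ofReal (32 * δ ^ 4)) = ENNReal.ofReal (C' * δ ^ (8 - ε)) := by
        simp only [c, M]
        rw [← ENNReal.ofReal_mul (by positivity), ← ENNReal.ofReal_mul (by positivity)]
        congr 1
        rw [show (8 - ε : ℝ) = (4 - ε) + (4 : ℕ) by push_cast; ring, Real.rpow_add hδ,
          Real.rpow_natCast]
        ring
      have hC' : 0 < C' := by positivity
      clear_value C'
      rw [e, ENNReal.ofReal_rpow_of_nonneg (by positivity) (by norm_num),
        ← ENNReal.ofReal_ofNat 3, ← ENNReal.ofReal_mul (by norm_num)]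
      refine ENNReal.ofReal_le_ofReal ?_
      rw [mul_assoc (3 : ℝ)]
      refine mul_le_mul_of_nonneg_left ?_ (by norm_num)
      rw [Real.mul_rpow hC'.le (Real.rpow_nonneg hδ.le _), ← Real.rpow_mul hδ.le]
      refine mul_le_mul ?_ ?_ (by positivity) (by positivity)
      · calc C' ^ (1 / 2 : ℝ) ≤ (1 + C') ^ (1 / 2 : ℝ) := by gcongr; linarith
          _ ≤ (1 + C') ^ (1 : ℝ) := Real.rpow_le_rpow_of_exponent_le (by linarith) (by norm_num)
          _ = _ := Real.rpow_one _
      · exact Real.rpow_le_rpow_of_exponent_ge hδ hδ1 (by linarith)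

end TripleSum

section TrilinearKakeya

variable {ι : Type}

lemma lintegral_tripleSum_rpow_ne_top (δ s : ℝ) {p : ℝ} (hp : 0 < p) (y v : ι → E4)
    (A : Fin 3 → Finset ι) : ∫⁻ x, tripleSum δ s y v A x ^ p ≠ ⊤ := by
  set c : ℝ≥0∞ := ∑ i ∈ A 0, ∑ j ∈ A 1, ∑ k ∈ A 2, ENNReal.ofReal (wedge3 (v i) (v j) (v k) ^ s)
    with hc
  have hctop : c ≠ ⊤ := by
    simp only [hc, ne_eq, ENNReal.sum_eq_top, ENNReal.ofReal_ne_top, and_false, exists_false,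
      not_false_eq_true]
  have hind : ∀ i x, tubeInd δ (y i) (v i) x ≤ 1 := fun i x => by
    unfold tubeInd
    exact Set.indicator_le_self' (f := (1 : E4 → ℝ≥0∞)) (fun _ _ => zero_le) x
  set S : Set E4 := ⋃ i ∈ A 0, tube δ (y i) (v i) with hS
  have hSm : IsCompact S := (A 0).isCompact_biUnion fun i _ => isCompact_tube _ _ _
  have hle : ∀ x, tripleSum δ s y v A x ^ p ≤ S.indicator (fun _ => c ^ p) x := by
    intro x
    by_cases hx : x ∈ S
    · rw [Set.indicator_of_mem hx]
      refine ENNReal.rpow_le_rpow ?_ hp.le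
      refine Finset.sum_le_sum fun i _ => Finset.sum_le_sum fun j _ =>
        Finset.sum_le_sum fun k _ => ?_
      refine mul_le_of_le_one_left (zero_le) ?_
      exact mul_le_one' (mul_le_one' (hind _ _) (hind _ _)) (hind _ _)
    · rw [Set.indicator_of_notMem hx]
      have : tripleSum δ s y v A x = 0 := by
        refine Finset.sum_eq_zero fun i hi => Finset.sum_eq_zero fun j _ =>
          Finset.sum_eq_zero fun k _ => ?_
        have : x ∉ tube δ (y i) (v i) := fun h => hx (Set.mem_iUnion₂.2 ⟨i, hi, h⟩)
        rw [tubeInd_of_notMem this]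
        simp
      rw [this, ENNReal.zero_rpow_of_pos hp]
  refine ne_top_of_le_ne_top ?_ (lintegral_mono hle)
  rw [lintegral_indicator hSm.measurableSet, setLIntegral_const]
  exact ENNReal.mul_ne_top (ENNReal.rpow_ne_top_of_nonneg hp.le hctop) hSm.measure_lt_top.ne

lemma tripleSum_le_of_forall_mem {δ s : ℝ} {y v : ι → E4} {A A' : Fin 3 → Finset ι} {x : E4}
    (h : ∀ m, ∀ t ∈ A m, x ∈ tube δ (y t) (v t) → t ∈ A' m) :
    tripleSum δ s y v A x ≤ tripleSum δ s y v A' x := by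
  have hm : ∀ m, ∀ t ∈ A m, tubeInd δ (y t) (v t) x ≠ 0 → t ∈ A' m := by
    intro m t ht h0
    refine h m t ht ?_
    by_contra h1
    exact h0 (tubeInd_of_notMem h1)
  unfold tripleSum
  refine (Finset.sum_le_sum fun i _ => ?_).trans (Finset.sum_le_sum_of_ne_zero fun i hi hi0 => ?_)
  · refine (Finset.sum_le_sum fun j _ => ?_).trans (Finset.sum_le_sum_of_ne_zero fun j hj hj0 => ?_)
    · refine Finset.sum_le_sum_of_ne_zero fun k hk hk0 => hm 2 k hk fun h0 => hk0 ?_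
      rw [h0]; simp
    · refine hm 1 j hj fun h0 => hj0 ?_
      rw [h0]; simp
  · refine hm 0 i hi fun h0 => hi0 ?_
    rw [h0]; simp

lemma exists_cell_scale (n : ℕ) (hn : 2 ≤ n) {K σ : ℝ} (hσ : (n : ℝ) < (n - 1) * σ) :
    ∃ h : ℕ, (396 * 2 ^ h / 2 ^ (n * h) : ℝ) < 1 ∧
      K * 2 ^ (n * h) * (396 * 2 ^ h / 2 ^ (n * h) : ℝ) ^ σ ≤ 1 := by
  have hn1 : (1 : ℝ) ≤ n - 1 := by
    have : (2 : ℝ) ≤ n := by exact_mod_cast hn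
    linarith
  have e0 : ∀ h : ℕ, (396 * 2 ^ h / 2 ^ (n * h) : ℝ) = 396 * ((2 : ℝ) ^ (-((n : ℝ) - 1))) ^ h := by
    intro h
    rw [← Real.rpow_natCast ((2 : ℝ) ^ (-((n : ℝ) - 1))), ← Real.rpow_mul (by norm_num),
      mul_div_assoc, ← Real.rpow_natCast 2 h, ← Real.rpow_natCast 2 (n * h),
      ← Real.rpow_sub (by norm_num)]
    push_cast
    ring_nf
  have e1 : ∀ h : ℕ, K * 2 ^ (n * h) * (396 * 2 ^ h / 2 ^ (n * h) : ℝ) ^ σ =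
      K * 396 ^ σ * ((2 : ℝ) ^ ((n : ℝ) - (n - 1) * σ)) ^ h := by
    intro h
    have a1 : (((2 : ℝ) ^ (-((n : ℝ) - 1))) ^ h) ^ σ = (2 : ℝ) ^ (-((n : ℝ) - 1) * h * σ) := by
      rw [← Real.rpow_natCast _ h, Real.rpow_mul (by norm_num), Real.rpow_mul (by norm_num)]
    have a2 : ((2 : ℝ) ^ ((n : ℝ) - (n - 1) * σ)) ^ h =
        2 ^ (n * h) * (2 : ℝ) ^ (-((n : ℝ) - 1) * h * σ) := by
      rw [← Real.rpow_natCast _ h, ← Real.rpow_mul (by norm_num), ← Real.rpow_natCast 2 (n * h),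
        ← Real.rpow_add (by norm_num)]
      push_cast
      ring_nf
    rw [e0, Real.mul_rpow (by norm_num) (pow_nonneg (Real.rpow_nonneg (by norm_num) _) _), a1, a2]
    ring
  have l0 : Filter.Tendsto (fun h : ℕ => 396 * ((2 : ℝ) ^ (-((n : ℝ) - 1))) ^ h) Filter.atTop
      (nhds (396 * 0)) := by
    refine (tendsto_pow_atTop_nhds_zero_of_lt_one (by positivity) ?_).const_mul _
    exact Real.rpow_lt_one_of_one_lt_of_neg (by norm_num) (by linarith)
  have l1 : Filter.Tendsto (fun h : ℕ => K * 396 ^ σ * ((2 : ℝ) ^ ((n : ℝ) - (n - 1) * σ)) ^ h)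
      Filter.atTop (nhds (K * 396 ^ σ * 0)) := by
    refine (tendsto_pow_atTop_nhds_zero_of_lt_one (by positivity) ?_).const_mul _
    exact Real.rpow_lt_one_of_one_lt_of_neg (by norm_num) (by linarith)
  rw [mul_zero] at l0 l1
  obtain ⟨h, h0, h1⟩ := ((l0.eventually (gt_mem_nhds one_pos)).and
    (l1.eventually (gt_mem_nhds one_pos))).exists
  exact ⟨h, by rw [e0]; exact h0, by rw [e1]; exact h1.le⟩

lemma card_le_of_cell {n h N N' : ℕ} (hN : N' * 2 ^ (n * h) ≤ 12 * (32 * 2 ^ h + 1) * N) :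
    (N' : ℝ) ≤ 396 * 2 ^ h / 2 ^ (n * h) * N := by
  have h1 : (N' : ℝ) * 2 ^ (n * h) ≤ 12 * (32 * 2 ^ h + 1) * N := by exact_mod_cast hN
  have h2 : (1 : ℝ) ≤ 2 ^ h := one_le_pow₀ (by norm_num)
  rw [div_mul_eq_mul_div, le_div_iff₀ (by positivity)]
  have h3 := mul_le_mul_of_nonneg_right h2 (Nat.cast_nonneg (α := ℝ) N)
  nlinarith

lemma mul_card_rpow_le {θ K p : ℝ} (hθ0 : 0 < θ) (hK : 0 < K) (hp : 0 < p)
    (hθ : K * θ ^ (3 * p) ≤ 1) {N N' : Fin 3 → ℕ} (h : ∀ m, (N' m : ℝ) ≤ θ * N m) :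
    ENNReal.ofReal K * ((N' 0 : ℝ≥0∞) * N' 1 * N' 2) ^ p ≤ ((N 0 : ℝ≥0∞) * N 1 * N 2) ^ p := by
  have h1 : ∀ m, (N' m : ℝ≥0∞) ≤ ENNReal.ofReal θ * N m := by
    intro m
    rw [← ENNReal.ofReal_natCast, ← ENNReal.ofReal_natCast, ← ENNReal.ofReal_mul hθ0.le]
    exact ENNReal.ofReal_le_ofReal (h m)
  calc ENNReal.ofReal K * ((N' 0 : ℝ≥0∞) * N' 1 * N' 2) ^ p
      ≤ ENNReal.ofReal K * ((ENNReal.ofReal θ * N 0) * (ENNReal.ofReal θ * N 1) *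
        (ENNReal.ofReal θ * N 2)) ^ p := by
        gcongr
        · exact h1 0
        · exact h1 1
        · exact h1 2
    _ = (ENNReal.ofReal K * (ENNReal.ofReal θ ^ 3) ^ p) * ((N 0 : ℝ≥0∞) * N 1 * N 2) ^ p := by
        rw [show (ENNReal.ofReal θ * N 0) * (ENNReal.ofReal θ * N 1) * (ENNReal.ofReal θ * N 2) =
          ENNReal.ofReal θ ^ 3 * ((N 0 : ℝ≥0∞) * N 1 * N 2) by ring,
          ENNReal.mul_rpow_of_nonneg _ _ hp.le]
        ring
    _ ≤ 1 * ((N 0 : ℝ≥0∞) * N 1 * N 2) ^ p := by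
        gcongr
        rw [← ENNReal.ofReal_pow hθ0.le, ENNReal.ofReal_rpow_of_nonneg (by positivity) hp.le,
          ← ENNReal.ofReal_mul hK.le, ← Real.rpow_natCast, ← Real.rpow_mul hθ0.le]
        exact ENNReal.ofReal_le_one.2 (by exact_mod_cast hθ)
    _ = _ := one_mul _

/-- The trilinear Kakeya estimate in `ℝ⁴`. -/
theorem exists_trilinear_kakeya {ε : ℝ} (hε : 0 < ε) (hε1 : ε ≤ 1) :
    ∃ C > 0, ∀ δ : ℝ, 0 < δ → δ ≤ 1 → ∀ (ι : Type) (y v : ι → E4), (∀ i, ‖v i‖ = 1) →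
      ∀ A : Fin 3 → Finset ι,
      ∫⁻ x, tripleSum δ 1 y v A x ^ (1 / 2 : ℝ) ≤ ENNReal.ofReal (C * δ ^ (4 - ε)) *
          (((A 0).card : ℝ≥0∞) * (A 1).card * (A 2).card) ^ (1 / 2 + ε) := by
  obtain ⟨h₁, hh₁, hK₁⟩ := exists_cell_scale 4 (by norm_num) (K := 4) (σ := 3 * (1 / 2 + ε))
    (by push_cast; linarith)
  obtain ⟨L₁, hL₁, hbad₁⟩ := exists_setLIntegral_bad_le (32 * 2 ^ h₁)
  obtain ⟨h₂, hh₂, hK₂⟩ := exists_cell_scale 3 (by norm_num) (K := 8 * L₁) (σ := 3 * (1 / 2 + ε))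
    (by push_cast; linarith)
  obtain ⟨L₂, hL₂, hbad₂⟩ := exists_setLIntegral_bad_le (32 * 2 ^ h₂)
  obtain ⟨C, hC, hCb⟩ := exists_setLIntegral_badPiece_inter_le hε hε1
    (max (32 * 2 ^ h₁) (32 * 2 ^ h₂))
  refine ⟨4 * L₁ * L₂ * C, by positivity, fun δ hδ hδ1 ι y v hv A => ?_⟩
  classical
  obtain ⟨n, hn⟩ : ∃ n, (A 0).card + (A 1).card + (A 2).card = n := ⟨_, rfl⟩
  induction n using Nat.strong_induction_on generalizing A with
  | _ n ih =>
  by_cases hpos : ∀ m, 0 < (A m).card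
  swap
  · push Not at hpos
    obtain ⟨m, hm⟩ := hpos
    have hm0 : A m = ∅ := Finset.card_eq_zero.1 (by omega)
    have hz : ∀ x, tripleSum δ 1 y v A x = 0 := by
      intro x
      unfold tripleSum
      fin_cases m <;> simp at hm0 <;> simp [hm0]
    simp [hz]
  set f : E4 → ℝ≥0∞ := fun x => tripleSum δ 1 y v A x ^ (1 / 2 : ℝ) with hf
  have hfm : Measurable f := (measurable_tripleSum _ _ _ _ _).pow_const _
  have hfin : ∫⁻ x, f x ≠ ⊤ := lintegral_tripleSum_rpow_ne_top δ 1 (by norm_num) y v A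
  -- the cellular case
  have hcell : ∀ (K : ℝ) (n h : ℕ), 0 < K → (396 * 2 ^ h / 2 ^ (n * h) : ℝ) < 1 →
      K * 2 ^ (n * h) * (396 * 2 ^ h / 2 ^ (n * h) : ℝ) ^ (3 * (1 / 2 + ε)) ≤ 1 →
      ∀ (G : Set E4) (A' : Fin 3 → Finset ι), MeasurableSet G → 
          (∀ m, (A' m).card * 2 ^ (n * h) ≤ 12 * (32 * 2 ^ h + 1) * (A m).card) →
          (∀ x ∈ G, ∀ m, ∀ t ∈ A m, x ∈ tube δ (y t) (v t) → t ∈ A' m) →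
          ∫⁻ x, f x ≤ ENNReal.ofReal (K * 2 ^ (n * h)) * ∫⁻ x in G, f x →
          ∫⁻ x, f x ≤ ENNReal.ofReal (4 * L₁ * L₂ * C * δ ^ (4 - ε)) *
          (((A 0).card : ℝ≥0∞) * (A 1).card * (A 2).card) ^ (1 / 2 + ε) := by
    intro K n' h hK hθ1 hθ G A' hG hcard hmem hbound
    have hle : ∀ m, ((A' m).card : ℝ) ≤ 396 * 2 ^ h / 2 ^ (n' * h) * (A m).card :=
      fun m => card_le_of_cell (hcard m)
    have hlt : ∀ m, (A' m).card < (A m).card := by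
      intro m
      have h1 : (0 : ℝ) < (A m).card := by exact_mod_cast hpos m
      have h2 := (hle m).trans_lt (mul_lt_of_lt_one_left h1 hθ1)
      exact_mod_cast h2
    have h3 := ih _ (by have := hlt 0; have := hlt 1; have := hlt 2; omega) A' rfl
    calc ∫⁻ x, f x ≤ _ := hbound
      _ ≤ ENNReal.ofReal (K * 2 ^ (n' * h)) * ∫⁻ x, tripleSum δ 1 y v A' x ^ (1 / 2 : ℝ) := by
        refine mul_le_mul_right ?_ _
        refine (setLIntegral_mono_ae' hG (Filter.Eventually.of_forall fun x hx => ?_)).trans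
          (setLIntegral_le_lintegral G _)
        exact ENNReal.rpow_le_rpow (tripleSum_le_of_forall_mem (hmem x hx)) (by norm_num)
      _ ≤ ENNReal.ofReal (K * 2 ^ (n' * h)) * (ENNReal.ofReal (4 * L₁ * L₂ * C * δ ^ (4 - ε)) *
          (((A' 0).card : ℝ≥0∞) * (A' 1).card * (A' 2).card) ^ (1 / 2 + ε)) := by gcongr
      _ = ENNReal.ofReal (4 * L₁ * L₂ * C * δ ^ (4 - ε)) * (ENNReal.ofReal (K * 2 ^ (n' * h)) *
          (((A' 0).card : ℝ≥0∞) * (A' 1).card * (A' 2).card) ^ (1 / 2 + ε)) := by ring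
      _ ≤ _ := by
        gcongr
        exact mul_card_rpow_le (by positivity) (by positivity) (by positivity) hθ
          (N := fun m => (A m).card) (N' := fun m => (A' m).card) hle
  obtain ⟨P, hP0, hPd, -, hP | ⟨G, A', hG, -, hcard, hmem, hbound⟩⟩ :=
    cell_reduction hδ y v (Function.Embedding.refl (Fin 4)) (by norm_num) h₁ f hfin A
  swap
  · refine hcell 4 4 h₁ (by norm_num) hh₁ hK₁ G A' hG hcard hmem (hbound.trans (le_of_eq ?_))
    congr 1
    rw [ENNReal.ofReal_mul (by norm_num), ENNReal.ofReal_pow (by norm_num)]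
    norm_num
  obtain ⟨R, j, hRd, -, hR⟩ := hbad₁ (K := 24) (by norm_num) hδ P hPd f
  set Y := badPiece 24 δ R j with hY
  have hYm : MeasurableSet Y := measurableSet_badPiece _ _ _ _
  have hfY : ∫⁻ x, f x ≤ 2 * L₁ * ∫⁻ x in Y, f x := by
    refine hP.trans ?_
    rw [mul_assoc]
    gcongr
  have hYe : ∫⁻ x, Y.indicator f x = ∫⁻ x in Y, f x := lintegral_indicator hYm _
  have hYfin : ∫⁻ x, Y.indicator f x ≠ ⊤ := by
    rw [hYe]
    exact ne_top_of_le_ne_top hfin (setLIntegral_le_lintegral _ _)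
  obtain ⟨P', hP0', hPd', hpd, hP' | ⟨G, A', hG, -, hcard, hmem, hbound⟩⟩ :=
    cell_reduction hδ y v (n := 3) (Fin.succAboveEmb j) (by norm_num) h₂ (Y.indicator f) hYfin A
  swap
  · refine hcell (8 * L₁) 3 h₂ (by positivity) hh₂ hK₂ G A' hG hcard hmem (hfY.trans ?_)
    rw [← hYe]
    have h1 : ∫⁻ x in G, Y.indicator f x ≤ ∫⁻ x in G, f x :=
      lintegral_mono fun x => Set.indicator_le_self' (fun _ _ => zero_le) x
    refine (mul_le_mul_right (hbound.trans (mul_le_mul_right h1 _)) _).trans (le_of_eq ?_)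
    rw [ENNReal.ofReal_mul (by positivity), ENNReal.ofReal_mul (by positivity),
      ENNReal.ofReal_pow (by norm_num), ENNReal.ofReal_natCast, ENNReal.ofReal_ofNat,
      ENNReal.ofReal_ofNat]
    ring
  obtain ⟨R', j', hRd', hRpd, hR'⟩ := hbad₂ (K := 24) (by norm_num) hδ P' hPd' (Y.indicator f)
  have hjR' : MvPolynomial.pderiv j R' = 0 := by
    refine hRpd j (hpd j ?_)
    simp
  have h1 : ∫⁻ x in badPiece 24 δ R' j', Y.indicator f x =
      ∫⁻ x in Y ∩ badPiece 24 δ R' j', f x := by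
    rw [lintegral_indicator hYm, Measure.restrict_restrict hYm]
  have h2 := hCb δ hδ hδ1 ι y v hv R R' (hRd.trans (le_max_left _ _)) (hRd'.trans (le_max_right _ _))
    j j' hjR' A
  calc ∫⁻ x, f x ≤ 2 * L₁ * (2 * (L₂ * ∫⁻ x in Y ∩ badPiece 24 δ R' j', f x)) := by
        refine hfY.trans ?_
        rw [← hYe, ← h1]
        exact mul_le_mul_right (hP'.trans (mul_le_mul_right hR' _)) _
    _ ≤ 2 * L₁ * (2 * (L₂ * (ENNReal.ofReal (C * δ ^ (4 - ε)) *
          (((A 0).card : ℝ≥0∞) * (A 1).card * (A 2).card) ^ (1 / 2 : ℝ)))) := by gcongr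
    _ = ENNReal.ofReal (4 * L₁ * L₂ * C * δ ^ (4 - ε)) *
          (((A 0).card : ℝ≥0∞) * (A 1).card * (A 2).card) ^ (1 / 2 : ℝ) := by
        rw [show 4 * L₁ * L₂ * C * δ ^ (4 - ε) = 4 * L₁ * L₂ * (C * δ ^ (4 - ε)) by ring,
          ENNReal.ofReal_mul (p := 4 * L₁ * L₂) (by positivity),
          ENNReal.ofReal_mul (p := 4 * L₁) (by positivity),
          ENNReal.ofReal_mul (p := 4) (by positivity), ENNReal.ofReal_natCast,
          ENNReal.ofReal_natCast, ENNReal.ofReal_ofNat]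
        ring
    _ ≤ _ := by
        gcongr
        · exact_mod_cast Nat.mul_pos (Nat.mul_pos (hpos 0) (hpos 1)) (hpos 2)
        · linarith

end TrilinearKakeya

section NullSets

lemma ev_ne_zero_of_pderiv_eq_zero {P : Poly4} (hP : P ≠ 0)
    (h : ∀ j, MvPolynomial.pderiv j P = 0) (x : E4) : ev x P ≠ 0 := by
  refine GoodPt.ev_ne_zero (K := 24) (δ := 1) (y := x) ?_ le_rfl one_pos hP (by simp)
  intro w i
  rw [show wordDeriv P (i :: w) = MvPolynomial.pderiv i (wordDeriv P w) from rfl,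
    pderiv_wordDeriv_eq_zero (h i) w]
  simp

/-- The standard coordinate direction of `E4`. -/
abbrev stdDir (j : Fin 4) : E4 := EuclideanSpace.single j 1

lemma hasDerivAt_ev_stdDir (y : E4) (P : Poly4) (j : Fin 4) (t : ℝ) :
    HasDerivAt (fun t => ev (y + t • stdDir j) P)
      (ev (y + t • stdDir j) (MvPolynomial.pderiv j P)) t := by
  have h := hasDerivAt_ev_line y (stdDir j) P t
  simpa [stdDir] using h

lemma volume_zeros_diff_pderiv (P : Poly4) (j : Fin 4) :
    volume {x : E4 | ev x P = 0 ∧ ev x (MvPolynomial.pderiv j P) ≠ 0} = 0 := by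
  set Z := {x : E4 | ev x P = 0 ∧ ev x (MvPolynomial.pderiv j P) ≠ 0} with hZ
  have hZm : MeasurableSet Z :=
    ((continuous_ev P).measurable (measurableSet_singleton 0)).inter
      ((continuous_ev (MvPolynomial.pderiv j P)).measurable (measurableSet_singleton 0).compl)
  let b : OrthonormalBasis (Fin 4) ℝ E4 := EuclideanSpace.basisFun (Fin 4) ℝ
  have hb : b j = stdDir j := by simp [b, stdDir]
  have hline : ∀ z : E4, ∀ A : Set ℝ, ∫⁻ t : ℝ in A, Z.indicator (1 : E4 → ℝ≥0∞) (z + t • b j) ≤ 0 := by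
    intro z A
    have hfin : {t : ℝ | z + t • b j ∈ Z}.Finite := by
      rw [hb]
      by_cases hr : lineRes z (stdDir j) P = 0
      · convert Set.finite_empty
        ext t
        simp only [hZ, Set.mem_ofPred_eq, Set.mem_empty_iff_false, iff_false, not_and, not_not]
        intro _
        have h0 : (fun t : ℝ => ev (z + t • stdDir j) P) = fun _ => 0 := by
          funext s; rw [← eval_lineRes, hr]; simp
        have h1 := hasDerivAt_ev_stdDir z P j t
        rw [h0] at h1
        exact h1.unique (hasDerivAt_const t 0)
      · refine ((lineRes z (stdDir j) P).roots.toFinset.finite_toSet).subset fun t ht => ?_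
        simp only [Finset.mem_coe, Multiset.mem_toFinset, Polynomial.mem_roots hr,
          Polynomial.IsRoot.def, eval_lineRes]
        exact ht.1
    refine le_of_eq ?_
    refine le_antisymm ((setLIntegral_le_lintegral _ _).trans ?_) zero_le
    have : (fun t : ℝ => Z.indicator (1 : E4 → ℝ≥0∞) (z + t • b j)) =
        {t : ℝ | z + t • b j ∈ Z}.indicator 1 := by
      funext t; simp [Set.indicator_apply]
    rw [this, lintegral_indicator_one hfin.measurableSet, hfin.measure_zero]
  have hbox : ∀ n : ℕ, volume (Z ∩ onbBox b (fun _ => -(n : ℝ)) (fun _ => n)) = 0 := by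
    intro n
    have h := setLIntegral_onbBox_le b j (fun _ => -(n : ℝ)) (fun _ => (n : ℝ))
      (g := Z.indicator 1) (measurable_one.indicator hZm) 0 (fun z => hline z _)
    rw [mul_zero, lintegral_indicator_one hZm,
      Measure.restrict_apply hZm] at h
    exact le_antisymm h zero_le
  refine measure_mono_null (t := ⋃ n : ℕ, Z ∩ onbBox b (fun _ => -(n : ℝ)) (fun _ => n)) ?_
    (measure_iUnion_null hbox)
  intro x hx
  obtain ⟨n, hn⟩ := exists_nat_ge ‖x‖
  refine Set.mem_iUnion.2 ⟨n, hx, fun i => ?_⟩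
  have : |⟪b i, x⟫| ≤ n := by
    refine (abs_real_inner_le_norm _ _).trans ?_
    simpa [b.norm_eq_one] using hn
  exact abs_le.1 this

/-- The zero set of a nonzero polynomial is a null set. -/
lemma ae_ev_ne_zero {P : Poly4} (hP : P ≠ 0) : ∀ᵐ x : E4, ev x P ≠ 0 := by
  induction hn : P.totalDegree using Nat.strong_induction_on generalizing P with
  | _ n ih =>
    by_cases h : ∀ j, MvPolynomial.pderiv j P = 0
    · exact Filter.Eventually.of_forall fun x => ev_ne_zero_of_pderiv_eq_zero hP h x
    · push Not at h
      obtain ⟨j, hj⟩ := h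
      have hd : P.totalDegree ≠ 0 := fun h0 => hj (by
        rw [MvPolynomial.totalDegree_eq_zero_iff_eq_C.1 h0]; simp)
      have h1 := ih _ (by have := totalDegree_pderiv_le P j; omega) hj rfl
      have h2 : ∀ᵐ x : E4, ¬(ev x P = 0 ∧ ev x (MvPolynomial.pderiv j P) ≠ 0) := by
        rw [ae_iff]; simpa using volume_zeros_diff_pderiv P j
      filter_upwards [h1, h2] with x hx1 hx2 h0
      exact hx2 ⟨h0, hx1⟩

end NullSets

section Multiplicity

/-- Five polynomials in four variables are algebraically dependent, with a degree bound. -/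
lemma exists_relation {e m : ℕ} (he : 1 ≤ e) (hm : m = (4 * e + 1) ^ 4) {f : Fin 4 → Poly4}
    (hf : ∀ j, (f j).totalDegree ≤ e) (i : Fin 4) :
    ∃ a : (Fin 4 → Fin m) × Fin (m + 1) → ℝ, a ≠ 0 ∧
      ∑ x, a x • ((∏ l, f l ^ (x.1 l : ℕ)) * MvPolynomial.X i ^ (x.2 : ℕ)) = 0 := by
  have hm0 : 0 < m := by rw [hm]; positivity
  let mono : (Fin 4 → Fin m) × Fin (m + 1) → Poly4 := fun x =>
    (∏ l, f l ^ (x.1 l : ℕ)) * MvPolynomial.X i ^ (x.2 : ℕ)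
  have hdeg : ∀ x, (mono x).totalDegree < (4 * e + 1) * m := by
    intro x
    have h1 : (∏ l, f l ^ (x.1 l : ℕ)).totalDegree ≤ ∑ l : Fin 4, (m - 1) * e := by
      refine (MvPolynomial.totalDegree_finsetProd _ _).trans (Finset.sum_le_sum fun l _ => ?_)
      refine (MvPolynomial.totalDegree_pow _ _).trans (Nat.mul_le_mul ?_ (hf l))
      have := (x.1 l).2; omega
    have h2 : (MvPolynomial.X i ^ (x.2 : ℕ) : Poly4).totalDegree ≤ m := by
      rw [MvPolynomial.totalDegree_X_pow]
      have := x.2.2; omega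
    have h3 := MvPolynomial.totalDegree_mul (∏ l, f l ^ (x.1 l : ℕ))
      (MvPolynomial.X i ^ (x.2 : ℕ) : Poly4)
    simp only [Finset.sum_const, Finset.card_univ, Fintype.card_fin, smul_eq_mul] at h1
    obtain ⟨k, rfl⟩ : ∃ k, m = k + 1 := ⟨m - 1, by omega⟩
    simp only [Nat.add_sub_cancel] at h1
    calc (mono x).totalDegree ≤ 4 * (k * e) + (k + 1) := by simp only [mono]; omega
      _ < (4 * e + 1) * (k + 1) := by nlinarith
  let T : ((Fin 4 → Fin m) × Fin (m + 1) → ℝ) →ₗ[ℝ]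
      ((Fin 4 → Fin ((4 * e + 1) * m)) → ℝ) :=
    { toFun := fun a n => MvPolynomial.coeff (Finsupp.equivFunOnFinite.symm fun l => (n l : ℕ))
        (∑ x, a x • mono x)
      map_add' := fun a b => by
        funext n
        simp [add_smul, Finset.sum_add_distrib]
      map_smul' := fun c a => by
        funext n
        simp [mul_smul, ← Finset.smul_sum] }
  have hker : LinearMap.ker T ≠ ⊥ := by
    apply LinearMap.ker_ne_bot_of_finrank_lt
    simp only [Module.finrank_fintype_fun_eq_card, Fintype.card_fun, Fintype.card_fin,
      Fintype.card_prod]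
    rw [mul_pow, ← hm, mul_comm]
    exact Nat.mul_lt_mul_of_pos_left (Nat.lt_succ_self m) (by positivity)
  obtain ⟨a, ha, ha0⟩ := (Submodule.ne_bot_iff _).1 hker
  refine ⟨a, ha0, ?_⟩
  ext n
  rw [MvPolynomial.coeff_zero]
  by_cases hn : ∀ l, n l < (4 * e + 1) * m
  · have := congrFun (LinearMap.mem_ker.1 ha) fun l => ⟨n l, hn l⟩
    have h2 : (Finsupp.equivFunOnFinite.symm fun l => n l) = n := by ext l; simp
    simpa [T, h2] using this
  · push Not at hn
    obtain ⟨l, hl⟩ := hn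
    apply MvPolynomial.coeff_eq_zero_of_totalDegree_lt
    have h1 : (∑ x, a x • mono x).totalDegree < (4 * e + 1) * m := by
      refine lt_of_le_of_lt (MvPolynomial.totalDegree_finsetSum_le (d := (4 * e + 1) * m - 1)
        fun x _ => (MvPolynomial.totalDegree_smul_le _ _).trans
        (Nat.le_sub_one_of_lt (hdeg x))) ?_
      have : 0 < (4 * e + 1) * m := by positivity
      omega
    refine h1.trans_le (hl.trans ?_)
    by_cases h0 : n l = 0
    · simp [h0]
    · exact Finset.single_le_sum (f := fun i => n i) (fun _ _ => Nat.zero_le _)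
        (Finsupp.mem_support_iff.2 h0)

/-- Polynomial maps `ℝ⁴ → ℝ⁴` have boundedly many preimages of almost every point. -/
lemma exists_card_preimage_le (e : ℕ) : ∃ m : ℕ, ∀ f : Fin 4 → Poly4,
    (∀ j, (f j).totalDegree ≤ e) → ∀ᵐ τ : E4, ∀ s : Finset E4,
      (∀ v ∈ s, ∀ j, ev v (f j) = τ j) → s.card ≤ m := by
  set E := e + 1
  set m := (4 * E + 1) ^ 4 with hm
  refine ⟨m ^ 4, fun f hf => ?_⟩
  have key : ∀ i : Fin 4, ∃ p : Fin (m + 1) → Poly4, (∃ j, p j ≠ 0) ∧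
      ∀ v τ : E4, (∀ j, ev v (f j) = τ j) → ∑ j, ev τ (p j) * v i ^ (j : ℕ) = 0 := by
    intro i
    obtain ⟨a, ha0, ha⟩ := exists_relation (e := E) (by omega) hm
      (fun j => (hf j).trans (Nat.le_succ e)) i
    let em : (Fin 4 → Fin m) → (Fin 4 →₀ ℕ) := fun α =>
      Finsupp.equivFunOnFinite.symm fun l => (α l : ℕ)
    have hem : Function.Injective em := by
      intro α β h
      funext l
      have := DFunLike.congr_fun h l
      simpa [em, Fin.val_inj] using this
    refine ⟨fun j => ∑ α, MvPolynomial.monomial (em α) (a (α, j)), ?_, ?_⟩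
    · obtain ⟨⟨α, j⟩, hα⟩ := Function.ne_iff.1 ha0
      refine ⟨j, fun h0 => hα ?_⟩
      have := congrArg (MvPolynomial.coeff (em α)) h0
      simpa [MvPolynomial.coeff_sum, MvPolynomial.coeff_monomial, hem.eq_iff] using this
    · intro v τ hv
      have h1 := congrArg (ev v) ha
      rw [map_sum, map_zero, Fintype.sum_prod_type_right] at h1
      rw [← h1]
      refine Finset.sum_congr rfl fun j _ => ?_
      rw [map_sum, Finset.sum_mul]
      refine Finset.sum_congr rfl fun α _ => ?_
      have h2 : ev v (MvPolynomial.X i) = v i := by simp [ev]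
      rw [MvPolynomial.smul_eq_C_mul, map_mul, map_mul, map_prod, map_pow, h2]
      simp only [map_pow, hv]
      simp [ev, MvPolynomial.eval_monomial, em, Finsupp.prod_fintype, mul_assoc]
  choose p hp0 hp using key
  have hae : ∀ i, ∀ᵐ τ : E4, ∃ j, ev τ (p i j) ≠ 0 := by
    intro i
    obtain ⟨j, hj⟩ := hp0 i
    filter_upwards [ae_ev_ne_zero hj] with τ hτ using ⟨j, hτ⟩
  filter_upwards [ae_all_iff.2 hae] with τ hτ s hs
  let r : Fin 4 → Polynomial ℝ := fun i =>
    ∑ j : Fin (m + 1), Polynomial.C (ev τ (p i j)) * Polynomial.X ^ (j : ℕ)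
  have hr0 : ∀ i, r i ≠ 0 := by
    intro i h0
    obtain ⟨j, hj⟩ := hτ i
    apply hj
    have := congrArg (fun q => Polynomial.coeff q (j : ℕ)) h0
    simpa [r, Polynomial.finsetSum_coeff, Polynomial.coeff_X_pow, Fin.val_inj] using this
  have hdeg : ∀ i, (r i).natDegree ≤ m := by
    intro i
    refine Polynomial.natDegree_sum_le_of_forall_le _ _ fun j _ => ?_
    exact (Polynomial.natDegree_C_mul_X_pow_le _ _).trans (Nat.lt_succ_iff.1 j.2)
  have hsub : s.card ≤ (Fintype.piFinset fun i => (r i).roots.toFinset).card := by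
    refine Finset.card_le_card_of_injOn (fun v => v.ofLp) (fun v hv => ?_) ?_
    · simp only [Finset.mem_coe, Fintype.mem_piFinset, Multiset.mem_toFinset]
      intro i
      rw [Polynomial.mem_roots (hr0 i), Polynomial.IsRoot.def]
      simpa [r, Polynomial.eval_finsetSum] using hp i v τ (hs v hv)
    · intro v _ w _ h
      exact WithLp.ofLp_injective _ h
  refine hsub.trans ?_
  rw [Fintype.card_piFinset]
  refine (Finset.prod_le_prod' fun i _ => (Multiset.toFinset_card_le _).trans
    ((Polynomial.card_roots' _).trans (hdeg i))).trans ?_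
  simp

end Multiplicity

section AreaInequality

lemma exists_injOn_nhds {f : E4 → E4} (hf : ContDiff ℝ 1 f) {x : E4}
    (hx : (fderiv ℝ f x).det ≠ 0) : ∃ u : Set E4, IsOpen u ∧ x ∈ u ∧ Set.InjOn f u := by
  have h : HasStrictFDerivAt f ((fderiv ℝ f x).toContinuousLinearEquivOfDetNeZero hx : E4 →L[ℝ] E4) x := by
    rw [ContinuousLinearMap.coe_toContinuousLinearEquivOfDetNeZero]
    exact hf.contDiffAt.hasStrictFDerivAt one_ne_zero
  refine ⟨(h.toOpenPartialHomeomorph f).source, (h.toOpenPartialHomeomorph f).open_source,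
    h.mem_toOpenPartialHomeomorph_source, ?_⟩
  have := (h.toOpenPartialHomeomorph f).injOn
  rwa [h.toOpenPartialHomeomorph_coe] at this

/-- If almost every point has at most `m` preimages, then the total Jacobian of `f` over `S` is at
most `m` times the measure of the target. -/
theorem setLIntegral_abs_det_fderiv_le {f : E4 → E4} (hf : ContDiff ℝ 1 f) {m : ℕ}
    (hm : ∀ᵐ τ : E4, ∀ s : Finset E4, (∀ v ∈ s, f v = τ) → s.card ≤ m)
    {S T : Set E4} (hS : MeasurableSet S) (hT : MeasurableSet T) (hST : Set.MapsTo f S T) :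
    ∫⁻ x in S, ENNReal.ofReal |(fderiv ℝ f x).det| ≤ m * volume T := by
  classical
  have hdet : Continuous fun x => (fderiv ℝ f x).det :=
    ContinuousLinearMap.continuous_det.comp (hf.continuous_fderiv one_ne_zero)
  set U := {x : E4 | (fderiv ℝ f x).det ≠ 0} with hU
  have hUo : IsOpen U := isOpen_compl_singleton.preimage hdet
  choose! u huo hxu hinj using fun x (hx : x ∈ U) => exists_injOn_nhds hf hx
  obtain ⟨t, htU, htc, ht⟩ := TopologicalSpace.countable_cover_nhdsWithin (s := U) (f := u)
    fun x hx => mem_nhdsWithin_of_mem_nhds ((huo x hx).mem_nhds (hxu x hx))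
  obtain rfl | hne := t.eq_empty_or_nonempty
  · have h0 : ∀ x, (fderiv ℝ f x).det = 0 := by
      intro x; by_contra hx
      simpa using ht hx
    simp [h0]
  obtain ⟨g, hg⟩ := htc.exists_eq_range hne
  have hgU : ∀ n, g n ∈ U := fun n => htU (hg ▸ Set.mem_range_self n)
  let A : ℕ → Set E4 := fun n => S ∩ disjointed (fun n => u (g n)) n
  have hAm : ∀ n, MeasurableSet (A n) := fun n =>
    hS.inter (MeasurableSet.disjointed (fun n => (huo _ (hgU n)).measurableSet) n)
  have hAd : Pairwise (Function.onFun Disjoint A) := fun i j hij =>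
    ((disjoint_disjointed (fun n => u (g n))) hij).mono Set.inter_subset_right
      Set.inter_subset_right
  have hAi : ∀ n, Set.InjOn f (A n) := fun n =>
    (hinj _ (hgU n)).mono (Set.inter_subset_right.trans (disjointed_subset _ n))
  have hder : ∀ n, ∀ x ∈ A n, HasFDerivWithinAt f (fderiv ℝ f x) (A n) x := fun n x _ =>
    (hf.differentiable one_ne_zero x).hasFDerivAt.hasFDerivWithinAt
  have hcover : S ∩ U ⊆ ⋃ n, A n := by
    intro x hx
    have : x ∈ ⋃ n, u (g n) := by
      have := ht hx.2
      rw [hg] at this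
      simpa using this
    rw [← iUnion_disjointed] at this
    obtain ⟨n, hn⟩ := Set.mem_iUnion.1 this
    exact Set.mem_iUnion.2 ⟨n, hx.1, hn⟩
  have himm : ∀ n, MeasurableSet (f '' A n) := fun n =>
    measurable_image_of_fderivWithin (hAm n) (hder n) (hAi n)
  calc ∫⁻ x in S, ENNReal.ofReal |(fderiv ℝ f x).det|
      = ∫⁻ x in S ∩ U, ENNReal.ofReal |(fderiv ℝ f x).det| := by
        rw [← lintegral_indicator hS, ← lintegral_indicator (hS.inter hUo.measurableSet)]
        refine lintegral_congr fun x => ?_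
        by_cases hxS : x ∈ S
        · by_cases hxU : x ∈ U
          · simp [hxS, hxU]
          · have : (fderiv ℝ f x).det = 0 := by simpa [hU] using hxU
            simp [this, Set.indicator_apply]
        · simp [hxS]
    _ ≤ ∫⁻ x in ⋃ n, A n, ENNReal.ofReal |(fderiv ℝ f x).det| :=
        lintegral_mono_set hcover
    _ = ∑' n, volume (f '' A n) := by
        rw [lintegral_iUnion hAm hAd]
        exact tsum_congr fun n =>
          lintegral_abs_det_fderiv_eq_addHaar_image volume (hAm n) (hder n) (hAi n)
    _ = ∫⁻ τ, ∑' n, (f '' A n).indicator (1 : E4 → ℝ≥0∞) τ := by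
        rw [lintegral_tsum fun n => (measurable_one.indicator (himm n)).aemeasurable]
        exact tsum_congr fun n => (lintegral_indicator_one (himm n)).symm
    _ ≤ ∫⁻ τ, T.indicator (fun _ => (m : ℝ≥0∞)) τ := by
        refine lintegral_mono_ae ?_
        filter_upwards [hm] with τ hτ
        by_cases hτT : τ ∈ T
        · rw [Set.indicator_of_mem hτT, ENNReal.tsum_eq_iSup_sum]
          refine iSup_le fun F => ?_
          have hsum : ∑ n ∈ F, (f '' A n).indicator (1 : E4 → ℝ≥0∞) τ =
              ((F.filter fun n => τ ∈ f '' A n).card : ℝ≥0∞) := by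
            rw [Finset.card_filter]
            push_cast
            exact Finset.sum_congr rfl fun n _ => by simp [Set.indicator_apply]
          rw [hsum]
          have hex : ∀ n, ∃ x, τ ∈ f '' A n → x ∈ A n ∧ f x = τ := fun n => by
            by_cases h : τ ∈ f '' A n
            · obtain ⟨x, hx⟩ := h; exact ⟨x, fun _ => hx⟩
            · exact ⟨0, fun h' => absurd h' h⟩
          choose x hx using hex
          have hcard : ((F.filter fun n => τ ∈ f '' A n).image x).card =
              (F.filter fun n => τ ∈ f '' A n).card := by
            refine Finset.card_image_of_injOn fun i hi j hj hij => ?_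
            by_contra hne'
            have h1 := (hx i (Finset.mem_filter.1 hi).2).1
            have h2 := (hx j (Finset.mem_filter.1 hj).2).1
            rw [← hij] at h2
            exact Set.disjoint_left.1 (hAd hne') h1 h2
          rw [← hcard]
          refine Nat.cast_le.2 (hτ _ fun v hv => ?_)
          obtain ⟨n, hn, rfl⟩ := Finset.mem_image.1 hv
          exact (hx n (Finset.mem_filter.1 hn).2).2
        · rw [Set.indicator_of_notMem hτT]
          refine (ENNReal.tsum_eq_zero.2 fun n => Set.indicator_of_notMem ?_ _).le
          rintro ⟨x, hx, rfl⟩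
          exact hτT (hST hx.1)
    _ = m * volume T := by rw [lintegral_indicator hT, setLIntegral_const]

end AreaInequality

section FiveSamples

/-- The sample times `0, 1/4, 1/2, 3/4, 1`. -/
def smp (k : Fin 5) : ℝ := (k : ℕ) / 4

lemma smp_mem (k : Fin 5) : smp k ∈ Set.Icc (0 : ℝ) 1 := by
  have : ((k : ℕ) : ℝ) ≤ 4 := by exact_mod_cast Nat.lt_succ_iff.1 k.2
  constructor
  · unfold smp; positivity
  · unfold smp; linarith

lemma abs_det_le_sum_matrix (M H : Matrix (Fin 4) (Fin 4) ℝ) :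
    |H.det| ≤ 64 * ∑ k, |(M - smp k • H).det| := by
  set p : Polynomial ℝ := Matrix.det ((Polynomial.X : Polynomial ℝ) • (-H).map Polynomial.C +
    M.map Polynomial.C) with hp
  have hev : ∀ t, p.eval t = (M - t • H).det := by
    intro t
    rw [hp, ← Polynomial.coe_evalRingHom, RingHom.map_det]
    congr 1
    ext i j
    simp
    ring
  have hdeg : p.natDegree < 5 := by
    have := Polynomial.natDegree_det_X_add_C_le (-H) M
    simp only [Fintype.card_fin] at this
    exact Nat.lt_succ_of_le this
  have hc : p.coeff 4 = H.det := by
    have := Polynomial.coeff_det_X_add_C_card (-H) M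
    simp only [Fintype.card_fin, Matrix.det_neg] at this
    rw [hp, this]; norm_num
  have hs : H.det = 256 / 24 * (p.eval (smp 0) - 4 * p.eval (smp 1) + 6 * p.eval (smp 2)
      - 4 * p.eval (smp 3) + p.eval (smp 4)) := by
    rw [← hc]
    simp only [Polynomial.eval_eq_sum_range' hdeg, Finset.sum_range_succ, Finset.sum_range_zero, smp]
    norm_num
    ring
  simp only [hev] at hs
  rw [hs, Fin.sum_univ_five, abs_le]
  constructor <;>
  linarith [neg_abs_le (M - smp 0 • H).det, le_abs_self (M - smp 0 • H).det,
    neg_abs_le (M - smp 1 • H).det, le_abs_self (M - smp 1 • H).det,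
    neg_abs_le (M - smp 2 • H).det, le_abs_self (M - smp 2 • H).det,
    neg_abs_le (M - smp 3 • H).det, le_abs_self (M - smp 3 • H).det,
    neg_abs_le (M - smp 4 • H).det, le_abs_self (M - smp 4 • H).det,
    abs_nonneg (M - smp 0 • H).det, abs_nonneg (M - smp 1 • H).det,
    abs_nonneg (M - smp 2 • H).det, abs_nonneg (M - smp 3 • H).det,
    abs_nonneg (M - smp 4 • H).det]

lemma abs_det_le_sum (M H : E4 →L[ℝ] E4) :
    |H.det| ≤ 64 * ∑ k, |(M - smp k • H).det| := by
  let b := (EuclideanSpace.basisFun (Fin 4) ℝ).toBasis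
  have h : ∀ A : E4 →L[ℝ] E4, A.det = (LinearMap.toMatrix b b (A : E4 →ₗ[ℝ] E4)).det :=
    fun A => (LinearMap.det_toMatrix b _).symm
  simp only [h]
  have := abs_det_le_sum_matrix (LinearMap.toMatrix b b (M : E4 →ₗ[ℝ] E4))
    (LinearMap.toMatrix b b (H : E4 →ₗ[ℝ] E4))
  simpa using this

/-- Substitution of the affine map `v ↦ x + s v`. -/
def affSubst (x : E4) (s : ℝ) : Poly4 →ₐ[ℝ] Poly4 :=
  MvPolynomial.aeval fun i => MvPolynomial.C (x i) + MvPolynomial.C s * MvPolynomial.X i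

lemma ev_affSubst (x v : E4) (s : ℝ) (P : Poly4) :
    ev v (affSubst x s P) = ev (x + s • v) P := by
  induction P using MvPolynomial.induction_on with
  | C a => simp [affSubst, ev]
  | add p q hp hq => simp [hp, hq]
  | mul_X p i hp =>
    rw [map_mul, map_mul, map_mul, hp]
    simp [affSubst, ev]

lemma totalDegree_affSubst_le (x : E4) (s : ℝ) (P : Poly4) :
    (affSubst x s P).totalDegree ≤ P.totalDegree := by
  rw [affSubst, MvPolynomial.aeval_def, MvPolynomial.eval₂_eq]
  refine MvPolynomial.totalDegree_finsetSum_le fun d hd => ?_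
  refine (MvPolynomial.totalDegree_mul _ _).trans ?_
  rw [MvPolynomial.algebraMap_eq, MvPolynomial.totalDegree_C, zero_add]
  refine (MvPolynomial.totalDegree_finsetProd _ _).trans ?_
  refine le_trans (Finset.sum_le_sum (g := fun i => d i) fun i _ => ?_)
    (MvPolynomial.le_totalDegree hd)
  refine (MvPolynomial.totalDegree_pow _ _).trans ?_
  have h1 : (MvPolynomial.C (x i) + MvPolynomial.C s * MvPolynomial.X i : Poly4).totalDegree ≤ 1 := by
    refine (MvPolynomial.totalDegree_add _ _).trans (max_le ?_ ?_)
    · simp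
    · refine (MvPolynomial.totalDegree_mul _ _).trans ?_
      simp
  simpa using Nat.mul_le_mul_left (d i) h1

lemma contDiff_ev (P : Poly4) : ContDiff ℝ 1 fun x : E4 => ev x P := by
  induction P using MvPolynomial.induction_on with
  | C a => simpa [ev] using contDiff_const
  | add p q hp hq => simpa using hp.add hq
  | mul_X p i hp =>
    have h2 : ContDiff ℝ 1 fun x : E4 => x i := contDiff_euclidean.1 contDiff_id i
    simpa [ev] using hp.mul h2

/-- The product of five polynomials sampled along the segment from `y` to `y + v`. -/
def smpProd (g : Fin 5 → Poly4) (v y : E4) : ℝ := ∏ k, ev (y + smp k • v) (g k)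

/-- The gradient of `smpProd g v` in its base point. -/
def smpGrad (g : Fin 5 → Poly4) (v y : E4) : E4 :=
  WithLp.toLp 2 fun j => ∑ k, (∏ l ∈ Finset.univ.erase k, ev (y + smp l • v) (g l)) *
    ev (y + smp k • v) (MvPolynomial.pderiv j (g k))

lemma smpGrad_apply (g : Fin 5 → Poly4) (v y : E4) (j : Fin 4) : smpGrad g v y j =
    ∑ k, (∏ l ∈ Finset.univ.erase k, ev (y + smp l • v) (g l)) *
      ev (y + smp k • v) (MvPolynomial.pderiv j (g k)) := rfl

lemma hasDerivAt_smpProd (g : Fin 5 → Poly4) (v y : E4) (j : Fin 4) :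
    HasDerivAt (fun t : ℝ => smpProd g v (y + t • stdDir j)) (smpGrad g v y j) 0 := by
  have h : ∀ k ∈ (Finset.univ : Finset (Fin 5)),
      HasDerivAt (fun t : ℝ => ev (y + t • stdDir j + smp k • v) (g k))
        (ev (y + smp k • v) (MvPolynomial.pderiv j (g k))) 0 := by
    intro k _
    have := hasDerivAt_ev_stdDir (y + smp k • v) (g k) j 0
    simp only [zero_smul, add_zero] at this
    convert this using 4
    abel
  have := HasDerivAt.fun_finsetProd h
  simp only [zero_smul, add_zero, smul_eq_mul] at this
  exact this

lemma continuous_smpProd (g : Fin 5 → Poly4) : Continuous fun p : E4 × E4 => smpProd g p.1 p.2 := by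
  refine continuous_finsetProd _ fun k _ => (continuous_ev (g k)).comp ?_
  fun_prop

lemma contDiff_smpGrad (g : Fin 5 → Poly4) :
    ContDiff ℝ 1 fun p : E4 × E4 => smpGrad g p.1 p.2 := by
  refine contDiff_euclidean.2 fun j => ?_
  simp only [smpGrad_apply]
  have h : ∀ (k : Fin 5) (P : Poly4),
      ContDiff ℝ 1 fun p : E4 × E4 => ev (p.2 + smp k • p.1) P := fun k P =>
    (contDiff_ev P).comp (contDiff_snd.add (contDiff_fst.const_smul (smp k)))
  exact ContDiff.sum fun k _ => (contDiff_prod fun l _ => h l (g l)).mul (h k _)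

lemma exists_smpGrad_sheared (D : ℕ) (g : Fin 5 → Poly4) (hg : ∀ k, (g k).totalDegree ≤ D)
    (x : E4) (k₀ : Fin 5) : ∃ f : Fin 4 → Poly4, (∀ j, (f j).totalDegree ≤ 5 * D) ∧
      ∀ v j, ev v (f j) = smpGrad g v (x - smp k₀ • v) j := by
  refine ⟨fun j => ∑ k, (∏ l ∈ Finset.univ.erase k, affSubst x (smp l - smp k₀) (g l)) *
    affSubst x (smp k - smp k₀) (MvPolynomial.pderiv j (g k)), fun j => ?_, fun v j => ?_⟩
  · refine MvPolynomial.totalDegree_finsetSum_le fun k _ => ?_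
    refine (MvPolynomial.totalDegree_mul _ _).trans ?_
    have h1 : (∏ l ∈ Finset.univ.erase k, affSubst x (smp l - smp k₀) (g l)).totalDegree ≤ 4 * D := by
      refine (MvPolynomial.totalDegree_finsetProd _ _).trans ?_
      refine (Finset.sum_le_card_nsmul _ _ D fun l _ =>
        (totalDegree_affSubst_le _ _ _).trans (hg l)).trans ?_
      simp
    have h2 := (totalDegree_affSubst_le x (smp k - smp k₀) (MvPolynomial.pderiv j (g k))).trans
      ((totalDegree_pderiv_le (g k) j).trans ((Nat.sub_le _ _).trans (hg k)))
    omega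
  · have h : ∀ k : Fin 5, x + (smp k - smp k₀) • v = x - smp k₀ • v + smp k • v := fun k => by
      rw [sub_smul]; abel
    simp only [map_sum, map_mul, map_prod, ev_affSubst, smpGrad_apply, h]

end FiveSamples

section PolynomialWolff

/-- The polynomial `ρ² - |x - b|²`. -/
def ballPoly (b : E4) (ρ : ℝ) : Poly4 :=
  MvPolynomial.C (ρ ^ 2) - ∑ i, (MvPolynomial.X i - MvPolynomial.C (b i)) ^ 2

lemma ev_ballPoly (b : E4) (ρ : ℝ) (x : E4) : ev x (ballPoly b ρ) = ρ ^ 2 - dist x b ^ 2 := by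
  rw [EuclideanSpace.dist_eq, Real.sq_sqrt (Finset.sum_nonneg fun i _ => sq_nonneg _)]
  simp [ballPoly, ev, Real.dist_eq, sq_abs]

lemma totalDegree_ballPoly_le (b : E4) (ρ : ℝ) : (ballPoly b ρ).totalDegree ≤ 2 := by
  refine (MvPolynomial.totalDegree_sub _ _).trans (max_le (by rw [MvPolynomial.totalDegree_C]; omega) ?_)
  refine MvPolynomial.totalDegree_finsetSum_le fun i _ => ?_
  refine (MvPolynomial.totalDegree_pow _ _).trans ?_
  have : (MvPolynomial.X i - MvPolynomial.C (b i) : Poly4).totalDegree ≤ 1 :=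
    (MvPolynomial.totalDegree_sub _ _).trans (max_le (by simp) (by simp))
  omega

/-- The part of the ball `B(b, ρ)` where `q` is positive. -/
def posRegion (b : E4) (ρ : ℝ) (q : Poly4) : Set E4 := {x | 0 < ev x q ∧ dist x b < ρ}

lemma isOpen_posRegion (b : E4) (ρ : ℝ) (q : Poly4) : IsOpen (posRegion b ρ q) :=
  (isOpen_lt continuous_const (continuous_ev q)).inter
    (isOpen_lt (continuous_id.dist continuous_const) continuous_const)

lemma ev_mul_ballPoly_pos {b : E4} {ρ : ℝ} (hρ : 0 < ρ) {q : Poly4} {x : E4}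
    (hx : x ∈ posRegion b ρ q) : 0 < ev x (q * ballPoly b ρ) := by
  rw [map_mul, ev_ballPoly]
  exact mul_pos hx.1 (by nlinarith [hx.2, dist_nonneg (x := x) (y := b)])

/-- The base points whose five samples in direction `v` lie in the prescribed sets. -/
def smpBase (b : E4) (ρ : ℝ) (q : Fin 5 → Poly4) (v : E4) : Set E4 :=
  {y | ∀ k, y + smp k • v ∈ posRegion b ρ (q k)}

lemma exists_smpGrad_eq {b : E4} {ρ : ℝ} {q : Fin 5 → Poly4} {v y₀ c : E4} {η : ℝ}
    (hy₀ : y₀ ∈ smpBase b ρ q v)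
    (hη : η < smpProd (fun k => q k * ballPoly b ρ) v y₀) (hc : ‖c‖ * (2 * ρ) ≤ η) :
    ∃ y ∈ smpBase b ρ q v, smpGrad (fun k => q k * ballPoly b ρ) v y = c := by
  set g := fun k => q k * ballPoly b ρ with hg
  have hcF : Continuous fun y => smpProd g v y :=
    Continuous.comp (g := fun p : E4 × E4 => smpProd g p.1 p.2) (f := fun y => (v, y))
      (continuous_smpProd g) (by fun_prop)
  set K : Set E4 := {y | ∀ k, 0 ≤ ev (y + smp k • v) (q k) ∧ dist (y + smp k • v) b ≤ ρ} with hK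
  have hK0 : y₀ ∈ K := fun k => ⟨(hy₀ k).1.le, (hy₀ k).2.le⟩
  have hs0 : smp 0 = 0 := by simp [smp]
  have hKb : ∀ y ∈ K, dist y b ≤ ρ := fun y hy => by simpa [hs0] using (hy 0).2
  have hKc : IsClosed K := by
    have : K = ⋂ k, {y | 0 ≤ ev (y + smp k • v) (q k) ∧ dist (y + smp k • v) b ≤ ρ} := by
      ext y; simp [hK]
    rw [this]
    refine isClosed_iInter fun k => ?_
    have h1 : Continuous fun y : E4 => y + smp k • v := by fun_prop
    exact (isClosed_le continuous_const ((continuous_ev (q k)).comp h1)).inter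
      (isClosed_le (h1.dist continuous_const) continuous_const)
  have hKcomp : IsCompact K := by
    refine (isCompact_closedBall b ρ).of_isClosed_subset hKc fun y hy => ?_
    exact hKb y hy
  obtain ⟨y, hyK, hmax⟩ := hKcomp.exists_isMaxOn ⟨y₀, hK0⟩
    (f := fun y => smpProd g v y - ⟪c, y⟫) (hcF.sub (by fun_prop)).continuousOn
  have hpos : 0 < smpProd g v y := by
    have h1 : smpProd g v y₀ - ⟪c, y₀⟫ ≤ smpProd g v y - ⟪c, y⟫ := hmax hK0
    have h2 : |⟪c, y - y₀⟫| ≤ ‖c‖ * (2 * ρ) := by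
      refine (abs_real_inner_le_norm _ _).trans (mul_le_mul_of_nonneg_left ?_ (norm_nonneg _))
      rw [← dist_eq_norm]
      have := dist_triangle_right y y₀ b
      linarith [hKb y hyK, hKb y₀ hK0]
    rw [inner_sub_right] at h2
    linarith [neg_abs_le (⟪c, y⟫ - ⟪c, y₀⟫)]
  have hyG : y ∈ smpBase b ρ q v := by
    intro k
    have hne : ev (y + smp k • v) (g k) ≠ 0 := fun h0 =>
      hpos.ne' (Finset.prod_eq_zero (Finset.mem_univ k) h0)
    simp only [hg, map_mul, ev_ballPoly] at hne
    have h1 := left_ne_zero_of_mul hne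
    have h2 := right_ne_zero_of_mul hne
    refine ⟨lt_of_le_of_ne (hyK k).1 (Ne.symm h1), lt_of_le_of_ne (hyK k).2 fun h => h2 ?_⟩
    rw [h]; ring
  refine ⟨y, hyG, ?_⟩
  have hGo : IsOpen (smpBase b ρ q v) := by
    have : smpBase b ρ q v = ⋂ k, (fun y => y + smp k • v) ⁻¹' posRegion b ρ (q k) := by
      ext y; simp [smpBase]
    rw [this]
    exact isOpen_iInter_of_finite fun k => (isOpen_posRegion b ρ (q k)).preimage (by fun_prop)
  have hGK : smpBase b ρ q v ⊆ K := fun z hz k => ⟨(hz k).1.le, (hz k).2.le⟩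
  ext j
  have hloc : IsLocalMax (fun t : ℝ => smpProd g v (y + t • stdDir j) - ⟪c, y + t • stdDir j⟫) 0 := by
    have hcont : Continuous fun t : ℝ => y + t • stdDir j := by fun_prop
    have hn : {t : ℝ | y + t • stdDir j ∈ smpBase b ρ q v} ∈ nhds (0 : ℝ) :=
      (hGo.preimage hcont).mem_nhds (by simpa using hyG)
    filter_upwards [hn] with t ht
    simpa using hmax (hGK ht)
  have hd : HasDerivAt (fun t : ℝ => smpProd g v (y + t • stdDir j) - ⟪c, y + t • stdDir j⟫)
      (smpGrad g v y j - c j) 0 := by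
    refine (hasDerivAt_smpProd g v y j).sub ?_
    have h1 : (fun t : ℝ => ⟪c, y + t • stdDir j⟫) = fun t : ℝ => ⟪c, y⟫ + t * c j := by
      funext t
      rw [inner_add_right, inner_smul_right, stdDir, EuclideanSpace.inner_single_right]
      simp
    rw [h1]
    simpa using ((hasDerivAt_id (0 : ℝ)).mul_const (c j)).const_add ⟪c, y⟫
  have := hloc.hasDerivAt_eq_zero hd
  linarith

end PolynomialWolff

section PolynomialWolff

lemma smpGrad_inr_hasFDerivAt (g : Fin 5 → Poly4) (v y : E4) :
    HasFDerivAt (smpGrad g v) ((fderiv ℝ (fun p : E4 × E4 => smpGrad g p.1 p.2) (v, y)).comp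
      (ContinuousLinearMap.inr ℝ E4 E4)) y := by
  have h := ((contDiff_smpGrad g).differentiable one_ne_zero (v, y)).hasFDerivAt
  exact HasFDerivAt.comp (g := fun p : E4 × E4 => smpGrad g p.1 p.2) (f := fun y => (v, y)) y h
    (hasFDerivAt_prodMk_right v y)

lemma fderiv_smpGrad_sheared (g : Fin 5 → Poly4) (x v : E4) (s : ℝ) :
    fderiv ℝ (fun v => smpGrad g v (x - s • v)) v =
      (fderiv ℝ (fun p : E4 × E4 => smpGrad g p.1 p.2) (v, x - s • v)).comp
        (ContinuousLinearMap.inl ℝ E4 E4) -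
      s • (fderiv ℝ (fun p : E4 × E4 => smpGrad g p.1 p.2) (v, x - s • v)).comp
        (ContinuousLinearMap.inr ℝ E4 E4) := by
  have h := ((contDiff_smpGrad g).differentiable one_ne_zero (v, x - s • v)).hasFDerivAt
  have h1 : HasFDerivAt (fun v : E4 => (v, x - s • v))
      ((ContinuousLinearMap.id ℝ E4).prod (-(s • ContinuousLinearMap.id ℝ E4))) v := by
    refine (hasFDerivAt_id v).prodMk ?_
    exact ((hasFDerivAt_id v).const_smul s).const_sub x
  have h2 := HasFDerivAt.comp (g := fun p : E4 × E4 => smpGrad g p.1 p.2)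
    (f := fun v => (v, x - s • v)) v h h1
  refine h2.fderiv.trans ?_
  generalize fderiv ℝ (fun p : E4 × E4 => smpGrad g p.1 p.2) (v, x - s • v) = L
  ext1 u
  simp only [ContinuousLinearMap.comp_apply, ContinuousLinearMap.prod_apply,
    sub_apply, smul_apply, ContinuousLinearMap.inl_apply,
    ContinuousLinearMap.inr_apply, neg_apply, ContinuousLinearMap.id_apply]
  rw [← map_smul, ← map_sub]
  congr 1
  ext1 <;> simp

/-- The Jacobian integrand sampled at the `k`-th point. -/
def smpJac (g : Fin 5 → Poly4) (k : Fin 5) (p : E4 × E4) : ℝ≥0∞ :=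
  ENNReal.ofReal |((fderiv ℝ (fun p : E4 × E4 => smpGrad g p.1 p.2) p).comp
        (ContinuousLinearMap.inl ℝ E4 E4) -
      smp k • (fderiv ℝ (fun p : E4 × E4 => smpGrad g p.1 p.2) p).comp
        (ContinuousLinearMap.inr ℝ E4 E4)).det|

lemma continuous_smpJac (g : Fin 5 → Poly4) (k : Fin 5) : Continuous (smpJac g k) := by
  have h : Continuous (fderiv ℝ (fun p : E4 × E4 => smpGrad g p.1 p.2)) :=
    (contDiff_smpGrad g).continuous_fderiv one_ne_zero
  refine ENNReal.continuous_ofReal.comp (continuous_abs.comp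
    (ContinuousLinearMap.continuous_det.comp ?_))
  exact (h.clm_comp continuous_const).sub ((h.clm_comp continuous_const).const_smul (smp k))

lemma lintegral_smpJac_le {D m : ℕ}
    (hm : ∀ f : Fin 4 → Poly4, (∀ j, (f j).totalDegree ≤ 5 * D) → ∀ᵐ τ : E4, ∀ s : Finset E4,
      (∀ v ∈ s, ∀ j, ev v (f j) = τ j) → s.card ≤ m)
    (g : Fin 5 → Poly4) (hg : ∀ k, (g k).totalDegree ≤ D) (k : Fin 5) (x : E4) {B : Set E4}
    (hB : MeasurableSet B) :
    ∫⁻ v, {p : E4 × E4 | smpGrad g p.1 p.2 ∈ B}.indicator (smpJac g k) (v, x - smp k • v) ≤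
      m * volume B := by
  obtain ⟨f, hf, hfe⟩ := exists_smpGrad_sheared D g hg x k
  set c : E4 → E4 := fun v => smpGrad g v (x - smp k • v) with hc
  have hcd : ContDiff ℝ 1 c :=
    ContDiff.comp (g := fun p : E4 × E4 => smpGrad g p.1 p.2) (f := fun v => (v, x - smp k • v))
      (contDiff_smpGrad g) (contDiff_id.prodMk (contDiff_const.sub (contDiff_id.const_smul _)))
  have hS : MeasurableSet (c ⁻¹' B) := hcd.continuous.measurable hB
  have hmc : ∀ᵐ τ : E4, ∀ s : Finset E4, (∀ v ∈ s, c v = τ) → s.card ≤ m := by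
    filter_upwards [hm f hf] with τ hτ s hs
    refine hτ s fun v hv j => ?_
    rw [hfe, ← hs v hv]
  have h := setLIntegral_abs_det_fderiv_le hcd hmc hS hB (fun v hv => hv)
  rw [← lintegral_indicator hS] at h
  refine le_of_eq_of_le (lintegral_congr fun v => ?_) h
  by_cases hv : c v ∈ B
  · rw [Set.indicator_of_mem (by exact hv), Set.indicator_of_mem (by exact hv), hc,
      fderiv_smpGrad_sheared]
    rfl
  · rw [Set.indicator_of_notMem (by exact hv), Set.indicator_of_notMem (by exact hv)]

lemma volume_le_sum_smpJac {b : E4} {ρ : ℝ} (hρ : 0 < ρ) (q : Fin 5 → Poly4) {η : ℝ} (v : E4)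
    (hv : ∃ y ∈ smpBase b ρ q v, η < smpProd (fun k => q k * ballPoly b ρ) v y) :
    volume (Metric.ball (0 : E4) (η / (2 * ρ))) ≤ 64 * ∑ k, ∫⁻ y,
      {p : E4 × E4 | p.2 + smp k • p.1 ∈ posRegion b ρ (q k)}.indicator
        ({p : E4 × E4 | smpGrad (fun k => q k * ballPoly b ρ) p.1 p.2 ∈
          Metric.ball 0 (η / (2 * ρ))}.indicator (smpJac (fun k => q k * ballPoly b ρ) k)) (v, y) := by
  obtain ⟨y₀, hy₀, hη⟩ := hv
  set g := fun k => q k * ballPoly b ρ with hg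
  set B := Metric.ball (0 : E4) (η / (2 * ρ)) with hB
  have hgc : Continuous (smpGrad g v) :=
    continuous_iff_continuousAt.2 fun y => (smpGrad_inr_hasFDerivAt g v y).continuousAt
  set A := smpBase b ρ q v ∩ smpGrad g v ⁻¹' B with hA
  have hGm : MeasurableSet (smpBase b ρ q v) := by
    have : smpBase b ρ q v = ⋂ k, (fun y => y + smp k • v) ⁻¹' posRegion b ρ (q k) := by
      ext y; simp [smpBase]
    rw [this]
    exact MeasurableSet.iInter fun k =>
      ((isOpen_posRegion b ρ (q k)).preimage (by fun_prop)).measurableSet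
  have hAm : MeasurableSet A := hGm.inter (hgc.measurable Metric.isOpen_ball.measurableSet)
  have hsub : B ⊆ smpGrad g v '' A := by
    intro c hc
    have hc' : ‖c‖ * (2 * ρ) ≤ η := by
      rw [hB, mem_ball_zero_iff, lt_div_iff₀ (by positivity)] at hc
      exact hc.le
    obtain ⟨y, hy, hyc⟩ := exists_smpGrad_eq hy₀ hη hc'
    exact ⟨y, ⟨hy, by rw [Set.mem_preimage]; rw [← hyc] at hc; exact hc⟩, hyc⟩
  refine (measure_mono hsub).trans ((addHaar_image_le_lintegral_abs_det_fderiv volume hAm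
    fun y _ => (smpGrad_inr_hasFDerivAt g v y).hasFDerivWithinAt).trans ?_)
  have hpt : ∀ y, ENNReal.ofReal |((fderiv ℝ (fun p : E4 × E4 => smpGrad g p.1 p.2) (v, y)).comp
      (ContinuousLinearMap.inr ℝ E4 E4)).det| ≤ 64 * ∑ k, smpJac g k (v, y) := by
    intro y
    refine (ENNReal.ofReal_le_ofReal (abs_det_le_sum ((fderiv ℝ (fun p : E4 × E4 =>
      smpGrad g p.1 p.2) (v, y)).comp (ContinuousLinearMap.inl ℝ E4 E4)) _)).trans ?_
    rw [ENNReal.ofReal_mul (by norm_num), ENNReal.ofReal_sum_of_nonneg fun k _ => abs_nonneg _]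
    simp [smpJac]
  have hJm : ∀ k, Measurable fun y => smpJac g k (v, y) := fun k =>
    (continuous_smpJac g k).measurable.comp (measurable_const.prodMk measurable_id)
  calc ∫⁻ y in A, ENNReal.ofReal |((fderiv ℝ (fun p : E4 × E4 => smpGrad g p.1 p.2) (v, y)).comp
      (ContinuousLinearMap.inr ℝ E4 E4)).det|
      ≤ ∫⁻ y in A, 64 * ∑ k, smpJac g k (v, y) := lintegral_mono hpt
    _ = 64 * ∑ k, ∫⁻ y in A, smpJac g k (v, y) := by
        rw [lintegral_const_mul _ (Finset.measurable_fun_sum _ fun k _ => hJm k),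
          lintegral_finsetSum _ fun k _ => hJm k]
    _ ≤ _ := by
        refine mul_le_mul_right (Finset.sum_le_sum fun k _ => ?_) _
        rw [← lintegral_indicator hAm]
        refine lintegral_mono fun y => ?_
        refine Set.indicator_apply_le' (fun hy => ?_) fun _ => zero_le
        rw [Set.indicator_of_mem (show (v, y) ∈ _ from hy.1 k),
          Set.indicator_of_mem (show (v, y) ∈ _ from hy.2)]

lemma isOpen_smpDir (b : E4) (ρ : ℝ) (q : Fin 5 → Poly4) (g : Fin 5 → Poly4) (η : ℝ) :
    IsOpen {v : E4 | ∃ y ∈ smpBase b ρ q v, η < smpProd g v y} := by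
  have h : IsOpen {p : E4 × E4 | p.2 ∈ smpBase b ρ q p.1 ∧ η < smpProd g p.1 p.2} := by
    refine IsOpen.inter ?_ (isOpen_lt continuous_const (continuous_smpProd g))
    have : {p : E4 × E4 | p.2 ∈ smpBase b ρ q p.1} =
        ⋂ k, (fun p : E4 × E4 => p.2 + smp k • p.1) ⁻¹' posRegion b ρ (q k) := by
      ext y; simp [smpBase]
    refine (congrArg IsOpen this).mpr ?_
    exact isOpen_iInter_of_finite fun k => (isOpen_posRegion b ρ (q k)).preimage (by fun_prop)
  convert isOpenMap_fst _ h
  ext v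
  simp

lemma volume_smpDir_level_le {D m : ℕ}
    (hm : ∀ f : Fin 4 → Poly4, (∀ j, (f j).totalDegree ≤ 5 * D) → ∀ᵐ τ : E4, ∀ s : Finset E4,
      (∀ v ∈ s, ∀ j, ev v (f j) = τ j) → s.card ≤ m)
    {b : E4} {ρ : ℝ} (hρ : 0 < ρ) (q : Fin 5 → Poly4)
    (hq : ∀ k, (q k * ballPoly b ρ).totalDegree ≤ D) {η : ℝ} (hη : 0 < η) :
    volume {v : E4 | ∃ y ∈ smpBase b ρ q v, η < smpProd (fun k => q k * ballPoly b ρ) v y} ≤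
      64 * m * ∑ k, volume (posRegion b ρ (q k)) := by
  set g := fun k => q k * ballPoly b ρ with hg
  set V := {v : E4 | ∃ y ∈ smpBase b ρ q v, η < smpProd g v y} with hV
  set B := Metric.ball (0 : E4) (η / (2 * ρ)) with hB
  have hBm : MeasurableSet B := Metric.isOpen_ball.measurableSet
  have hVm : MeasurableSet V := (isOpen_smpDir b ρ q g η).measurableSet
  have hB0 : volume B ≠ 0 := (Metric.measure_ball_pos volume _ (by positivity)).ne'
  have hBt : volume B ≠ ⊤ := measure_ball_lt_top.ne
  have hcont : Continuous fun p : E4 × E4 => smpGrad g p.1 p.2 := (contDiff_smpGrad g).continuous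
  set Ψ : Fin 5 → E4 × E4 → ℝ≥0∞ := fun k =>
    {p : E4 × E4 | p.2 + smp k • p.1 ∈ posRegion b ρ (q k)}.indicator
      ({p : E4 × E4 | smpGrad g p.1 p.2 ∈ B}.indicator (smpJac g k)) with hΨ
  have hΨm : ∀ k, Measurable (Ψ k) := by
    intro k
    refine Measurable.indicator (Measurable.indicator (continuous_smpJac g k).measurable ?_) ?_
    · exact hcont.measurable hBm
    · exact ((isOpen_posRegion b ρ (q k)).preimage (by fun_prop)).measurableSet
  have hk : ∀ k, ∫⁻ v, ∫⁻ y, Ψ k (v, y) ≤ volume (posRegion b ρ (q k)) * (m * volume B) := by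
    intro k
    have hW : MeasurableSet (posRegion b ρ (q k)) := (isOpen_posRegion b ρ (q k)).measurableSet
    calc ∫⁻ v, ∫⁻ y, Ψ k (v, y) = ∫⁻ v, ∫⁻ x, Ψ k (v, x - smp k • v) :=
          lintegral_congr fun v => (lintegral_sub_right_eq_self (fun y => Ψ k (v, y)) _).symm
      _ = ∫⁻ x, ∫⁻ v, Ψ k (v, x - smp k • v) := by
          refine lintegral_lintegral_swap (Measurable.aemeasurable ?_)
          exact (hΨm k).comp (f := fun p : E4 × E4 => (p.1, p.2 - smp k • p.1)) (by fun_prop)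
      _ ≤ ∫⁻ x, (posRegion b ρ (q k)).indicator (fun _ => m * volume B) x := by
          refine lintegral_mono fun x => ?_
          by_cases hx : x ∈ posRegion b ρ (q k)
          · rw [Set.indicator_of_mem hx]
            refine le_trans (lintegral_mono fun v => ?_) (lintegral_smpJac_le hm g hq k x hBm)
            exact Set.indicator_le_self _ _ _
          · rw [Set.indicator_of_notMem hx]
            refine (lintegral_eq_zero_of_ae_eq_zero (Filter.Eventually.of_forall fun v => ?_)).le
            simp [hΨ, hx]
      _ = volume (posRegion b ρ (q k)) * (m * volume B) := by
          rw [lintegral_indicator hW, setLIntegral_const, mul_comm]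
  have hmain : volume V * volume B ≤ (64 * m * ∑ k, volume (posRegion b ρ (q k))) * volume B := by
    calc volume V * volume B = ∫⁻ v in V, volume B := by rw [setLIntegral_const, mul_comm]
      _ ≤ ∫⁻ v in V, 64 * ∑ k, ∫⁻ y, Ψ k (v, y) :=
          setLIntegral_mono' hVm fun v hv => volume_le_sum_smpJac hρ q v hv
      _ ≤ ∫⁻ v, 64 * ∑ k, ∫⁻ y, Ψ k (v, y) := setLIntegral_le_lintegral _ _
      _ = 64 * ∑ k, ∫⁻ v, ∫⁻ y, Ψ k (v, y) := by
          have h : ∀ k, Measurable fun v => ∫⁻ y, Ψ k (v, y) := fun k =>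
            (hΨm k).lintegral_prod_right'
          rw [lintegral_const_mul _ (Finset.measurable_fun_sum _ fun k _ => h k),
            lintegral_finsetSum _ fun k _ => h k]
      _ ≤ 64 * ∑ k, volume (posRegion b ρ (q k)) * (m * volume B) :=
          mul_le_mul_right (Finset.sum_le_sum fun k _ => hk k) _
      _ = _ := by rw [← Finset.sum_mul]; ring
  exact (ENNReal.mul_le_mul_iff_left hB0 hBt).1 hmain

/-- The set of directions `v` admitting a segment `y + [0,1] v` whose five equally spaced samples
lie in given polynomial positivity sets is controlled by the volumes of these sets. -/
theorem exists_volume_smpDir_le (d : ℕ) : ∃ C : ℕ, ∀ (b : E4) (ρ : ℝ), 0 < ρ →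
    ∀ q : Fin 5 → Poly4, (∀ k, (q k).totalDegree ≤ d) →
      volume {v : E4 | (smpBase b ρ q v).Nonempty} ≤ C * ∑ k, volume (posRegion b ρ (q k)) := by
  obtain ⟨m, hm⟩ := exists_card_preimage_le (5 * (d + 2))
  refine ⟨64 * m, fun b ρ hρ q hq => ?_⟩
  have hq' : ∀ k, (q k * ballPoly b ρ).totalDegree ≤ d + 2 := fun k =>
    (MvPolynomial.totalDegree_mul _ _).trans (add_le_add (hq k) (totalDegree_ballPoly_le b ρ))
  set S : ℕ → Set E4 := fun n => {v : E4 | ∃ y ∈ smpBase b ρ q v,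
    1 / ((n : ℝ) + 1) < smpProd (fun k => q k * ballPoly b ρ) v y} with hS
  have hmono : Monotone S := by
    intro n k hnk v hv
    obtain ⟨y, hy, h⟩ := hv
    refine ⟨y, hy, lt_of_le_of_lt ?_ h⟩
    exact one_div_le_one_div_of_le (by positivity) (by simpa using hnk)
  have hU : {v : E4 | (smpBase b ρ q v).Nonempty} ⊆ ⋃ n, S n := by
    rintro v ⟨y, hy⟩
    have hpos : 0 < smpProd (fun k => q k * ballPoly b ρ) v y :=
      Finset.prod_pos fun k _ => ev_mul_ballPoly_pos hρ (hy k)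
    obtain ⟨n, hn⟩ := exists_nat_one_div_lt hpos
    exact Set.mem_iUnion.2 ⟨n, y, hy, hn⟩
  refine (measure_mono hU).trans ?_
  rw [hmono.measure_iUnion]
  refine iSup_le fun n => ?_
  push_cast
  exact volume_smpDir_level_le hm hρ q hq' (by positivity)

end PolynomialWolff

section SmallSets

/-- A polynomial that is positive exactly where `|R| < K δ |∂ⱼ R|`. -/
def gradPoly (K δ : ℝ) (R : Poly4) (j : Fin 4) : Poly4 :=
  MvPolynomial.C ((K * δ) ^ 2) * MvPolynomial.pderiv j R ^ 2 - R ^ 2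

lemma ev_gradPoly_pos_iff {K δ : ℝ} (hK : 0 < K) (hδ : 0 < δ) (R : Poly4) (j : Fin 4) (x : E4) :
    0 < ev x (gradPoly K δ R j) ↔ |ev x R| < K * δ * |ev x (MvPolynomial.pderiv j R)| := by
  have h : ev x (gradPoly K δ R j) =
      (K * δ * |ev x (MvPolynomial.pderiv j R)|) ^ 2 - |ev x R| ^ 2 := by
    rw [mul_pow, sq_abs, sq_abs]
    simp [gradPoly, ev]
  rw [h, sub_pos, sq_lt_sq₀ (abs_nonneg _) (by positivity)]

lemma totalDegree_gradPoly_le (K δ : ℝ) {R : Poly4} {D : ℕ} (hR : R.totalDegree ≤ D) (j : Fin 4) :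
    (gradPoly K δ R j).totalDegree ≤ 2 * D := by
  have h1 := totalDegree_pderiv_le R j
  refine (MvPolynomial.totalDegree_sub _ _).trans (max_le ?_ ?_)
  · refine (MvPolynomial.totalDegree_mul _ _).trans ?_
    rw [MvPolynomial.totalDegree_C, zero_add]
    exact (MvPolynomial.totalDegree_pow _ _).trans (by omega)
  · exact (MvPolynomial.totalDegree_pow _ _).trans (by omega)

lemma exists_ev_gradPoly_pos {K δ : ℝ} (hK : 0 < K) (hδ : 0 < δ) {P : Poly4} {D : ℕ}
    (hD : P.totalDegree ≤ D) {x : E4} (hx : ¬ GoodPt K δ P x) :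
    ∃ c : Word D × Fin 4, 0 < ev x (gradPoly K δ (wordDeriv P (List.ofFn c.1.2)) c.2) := by
  obtain ⟨w, j, h⟩ := exists_mem_badPiece hK hδ hD hx
  exact ⟨(w, j), (ev_gradPoly_pos_iff hK hδ _ _ _).2 h.1⟩

lemma not_goodPt_of_ev_gradPoly_pos {K δ : ℝ} (hK : 0 < K) (hδ : 0 < δ) {P : Poly4} {D : ℕ} {x : E4}
    {c : Word D × Fin 4}
    (hc : 0 < ev x (gradPoly K δ (wordDeriv P (List.ofFn c.1.2)) c.2)) : ¬ GoodPt K δ P x := by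
  intro h
  have h1 := (ev_gradPoly_pos_iff hK hδ _ _ _).1 hc
  exact absurd (h (List.ofFn c.1.2) c.2) (not_le.2 h1)

lemma exists_volume_posRegion_gradPoly_le {ε : ℝ} (hε : 0 < ε) (hε1 : ε ≤ 1) (D : ℕ) {K : ℝ}
    (hK : 0 < K) : ∃ C > (0 : ℝ), ∀ δ > 0, ∀ R : Poly4, R.totalDegree ≤ D → ∀ j b ρ, 0 < ρ → ρ ≤ 5 →
      volume (posRegion b ρ (gradPoly K δ R j)) ≤ ENNReal.ofReal (C * δ ^ (1 - ε) * ρ ^ 3) := by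
  obtain ⟨C, hC, hmain⟩ := exists_lintegral_logDeriv_le hε hε1 D
  refine ⟨8 * ((K + 1) * C), by positivity, fun δ hδ R hR j b ρ hρ hρ5 => ?_⟩
  set Z := posRegion b ρ (gradPoly K δ R j) with hZ
  have hZm : MeasurableSet Z := (isOpen_posRegion b ρ _).measurableSet
  let B : OrthonormalBasis (Fin 4) ℝ E4 := EuclideanSpace.basisFun (Fin 4) ℝ
  have hB : ∀ i, B i = stdDir i := fun i => by simp [B, stdDir]
  have hline : ∀ z : E4, ∫⁻ t : ℝ in Set.Icc (b j - ρ) (b j + ρ),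
      Z.indicator (1 : E4 → ℝ≥0∞) (z + t • B j) ≤ ENNReal.ofReal ((K + 1) * (C * δ ^ (1 - ε))) := by
    intro z
    rw [hB]
    set r := lineRes z (stdDir j) R with hr
    have hr1 : ∀ t, r.eval t = ev (z + t • stdDir j) R := fun t => eval_lineRes _ _ _ _
    have hr2 : ∀ t, r.derivative.eval t = ev (z + t • stdDir j) (MvPolynomial.pderiv j R) := by
      intro t
      have h := r.hasDerivAt t
      simp only [hr1] at h
      exact h.unique (hasDerivAt_ev_stdDir z R j t)
    have hφm : Measurable fun t : ℝ => ENNReal.ofReal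
        (δ * |r.derivative.eval t| / (|r.eval t| + δ * |r.derivative.eval t|)) := by
      have h1 : Measurable fun t : ℝ => r.eval t := r.continuous.measurable
      have h2 : Measurable fun t : ℝ => r.derivative.eval t := r.derivative.continuous.measurable
      fun_prop
    calc ∫⁻ t : ℝ in Set.Icc (b j - ρ) (b j + ρ), Z.indicator (1 : E4 → ℝ≥0∞) (z + t • stdDir j)
        ≤ ∫⁻ t : ℝ in Set.Icc (b j - ρ) (b j - ρ + 10), ENNReal.ofReal (K + 1) * ENNReal.ofReal
          (δ * |r.derivative.eval t| / (|r.eval t| + δ * |r.derivative.eval t|)) := by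
          refine (lintegral_mono_set (Set.Icc_subset_Icc_right (by linarith))).trans
            (lintegral_mono fun t => ?_)
          refine Set.indicator_apply_le' (fun ht => ?_) fun _ => zero_le
          have h1 := (ev_gradPoly_pos_iff hK hδ _ _ _).1 ht.1
          rw [hr1, hr2, ← ENNReal.ofReal_mul (by positivity)]
          rw [Pi.one_apply, ENNReal.one_le_ofReal, ← mul_div_assoc]
          set a := |ev (z + t • stdDir j) R|
          set d := |ev (z + t • stdDir j) (MvPolynomial.pderiv j R)|
          have ha : 0 ≤ a := abs_nonneg _
          have hd : 0 ≤ d := abs_nonneg _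
          have hpos : 0 < a + δ * d := by
            rcases hd.eq_or_lt with h0 | h0
            · rw [← h0] at h1; simp at h1; linarith
            · positivity
          rw [one_le_div hpos]
          nlinarith
      _ ≤ ENNReal.ofReal (K + 1) * ENNReal.ofReal (C * δ ^ (1 - ε)) := by
          rw [lintegral_const_mul _ hφm]
          exact mul_le_mul_right (hmain δ hδ _ r ((natDegree_lineRes_le _ _ _).trans hR)) _
      _ = _ := (ENNReal.ofReal_mul (by positivity)).symm
  have hsub : Z ⊆ onbBox B (fun i => b i - ρ) (fun i => b i + ρ) := by
    intro x hx i
    have h1 : ⟪B i, x⟫ = x i := by rw [hB, stdDir, EuclideanSpace.inner_single_left]; simp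
    have h2 := abs_coord_le (x - b) i
    rw [← dist_eq_norm] at h2
    have h3 := abs_le.1 (h2.trans hx.2.le)
    rw [h1]
    simp only [PiLp.sub_apply] at h3
    constructor <;> linarith [h3.1, h3.2]
  have h := setLIntegral_onbBox_le B j (fun i => b i - ρ) (fun i => b i + ρ)
    (measurable_one.indicator hZm) _ hline
  rw [lintegral_indicator_one hZm, Measure.restrict_apply hZm,
    Set.inter_eq_left.2 hsub] at h
  refine h.trans (le_of_eq ?_)
  have h2 : ∀ i : Fin 3, b (j.succAbove i) + ρ - (b (j.succAbove i) - ρ) = 2 * ρ := fun i => by ring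
  simp only [h2, Finset.prod_const, Finset.card_univ, Fintype.card_fin]
  rw [← ENNReal.ofReal_pow (by positivity), ← ENNReal.ofReal_mul (by positivity)]
  congr 1
  ring

end SmallSets

section Directions

lemma half_le_norm_sub_of_le_angle {v w : E4} (hv : ‖v‖ = 1) (hw : ‖w‖ = 1) {δ : ℝ} (hδ : 0 ≤ δ)
    (h : δ ≤ angle v w) : δ / 2 ≤ ‖v - w‖ := by
  have h1 : Real.cos (angle v w) ≤ 1 - 2 / Real.pi ^ 2 * angle v w ^ 2 :=
    Real.cos_le_one_sub_mul_cos_sq (by rw [abs_of_nonneg (angle_nonneg v w)]; exact angle_le_pi v w)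
  have h2 : ⟪v, w⟫ = Real.cos (angle v w) := by
    have := cos_angle_mul_norm_mul_norm v w
    rw [hv, hw] at this; linarith
  have h3 : ‖v - w‖ ^ 2 = 2 - 2 * ⟪v, w⟫ := by
    rw [norm_sub_sq_real, hv, hw]; ring
  have h4 : (1 : ℝ) / 8 ≤ 2 / Real.pi ^ 2 := by
    rw [div_le_div_iff₀ (by norm_num) (by positivity)]
    nlinarith [Real.pi_le_four, Real.pi_pos]
  have h5 : δ ^ 2 ≤ angle v w ^ 2 := by gcongr
  refine (sq_le_sq₀ (by positivity) (norm_nonneg _)).1 ?_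
  rw [h3, h2]
  nlinarith [sq_nonneg (angle v w)]

/-- A box around the ray in direction `b 0`, of length `s / 2` and angular width about `δ`. -/
def rayBox (b : OrthonormalBasis (Fin 4) ℝ E4) (s δ : ℝ) : Set E4 :=
  onbBox b (Fin.cons (s / 2) fun _ => -(δ * s / 64)) (Fin.cons s fun _ => δ * s / 64)

lemma volume_rayBox (b : OrthonormalBasis (Fin 4) ℝ E4) {s δ : ℝ} (hs : 0 < s) (hδ : 0 < δ) :
    volume (rayBox b s δ) = ENNReal.ofReal (s ^ 4 * δ ^ 3 / 65536) := by
  rw [rayBox, volume_onbBox, Fin.prod_univ_succ]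
  simp only [Fin.cons_zero, Fin.cons_succ, Finset.prod_const, Finset.card_univ, Fintype.card_fin]
  rw [← ENNReal.ofReal_pow (by rw [sub_neg_eq_add]; positivity), ← ENNReal.ofReal_mul (by linarith)]
  congr 1
  ring

lemma exists_of_mem_rayBox {b : OrthonormalBasis (Fin 4) ℝ E4} {s δ : ℝ} (hs : 0 < s) (hδ : 0 < δ)
    {x : E4} (hx : x ∈ rayBox b s δ) : ∃ l ∈ Set.Icc (s / 2) s, ‖x - l • b 0‖ ≤ δ * s / 32 := by
  rw [rayBox, onbBox, Set.mem_ofPred_eq, Fin.forall_fin_succ] at hx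
  simp only [Fin.cons_zero, Fin.cons_succ] at hx
  refine ⟨⟪b 0, x⟫, hx.1, ?_⟩
  refine (sq_le_sq₀ (norm_nonneg _) (by positivity)).1 ?_
  have h1 : ∀ i, ⟪b i, x - ⟪b 0, x⟫ • b 0⟫ = if i = 0 then 0 else ⟪b i, x⟫ := by
    intro i
    rw [inner_sub_right, inner_smul_right, b.inner_eq_ite]
    split_ifs with h
    · subst h; ring
    · ring
  rw [← b.sum_sq_norm_inner_right, Fin.sum_univ_succ]
  simp only [h1, Fin.succ_ne_zero, if_true, if_false, Real.norm_eq_abs, sq_abs]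
  have h2 : ∀ i : Fin 3, ⟪b i.succ, x⟫ ^ 2 ≤ (δ * s / 64) ^ 2 := fun i =>
    sq_le_sq' (hx.2 i).1 (hx.2 i).2
  have h3 := Finset.sum_le_sum fun i (_ : i ∈ (Finset.univ : Finset (Fin 3))) => h2 i
  simp only [Finset.sum_const, Finset.card_univ, Fintype.card_fin, nsmul_eq_mul] at h3
  push_cast at h3
  nlinarith [sq_nonneg (δ * s)]

lemma disjoint_rayBox {b b' : OrthonormalBasis (Fin 4) ℝ E4} {s δ : ℝ} (hs : 0 < s) (hδ : 0 < δ)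
    (h : δ / 2 ≤ ‖b 0 - b' 0‖) : Disjoint (rayBox b s δ) (rayBox b' s δ) := by
  refine Set.disjoint_left.2 fun x hx hx' => ?_
  obtain ⟨l, hl, h1⟩ := exists_of_mem_rayBox hs hδ hx
  obtain ⟨m, hm, h2⟩ := exists_of_mem_rayBox hs hδ hx'
  have h3 : ‖l • b 0 - m • b' 0‖ ≤ δ * s / 16 := by
    have : l • b 0 - m • b' 0 = (x - m • b' 0) - (x - l • b 0) := by abel
    rw [this]
    exact (norm_sub_le _ _).trans (by linarith)
  have h4 : |l - m| ≤ δ * s / 16 := by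
    have := abs_norm_sub_norm_le (l • b 0) (m • b' 0)
    rw [norm_smul, norm_smul, b.norm_eq_one, b'.norm_eq_one, mul_one, mul_one, Real.norm_eq_abs,
      Real.norm_eq_abs, abs_of_pos (a := l) (by linarith [hl.1]),
      abs_of_pos (a := m) (by linarith [hm.1])] at this
    exact this.trans h3
  have h5 : ‖l • (b 0 - b' 0)‖ ≤ δ * s / 8 := by
    have : l • (b 0 - b' 0) = (l • b 0 - m • b' 0) - (l - m) • b' 0 := by
      rw [smul_sub, sub_smul]; abel
    rw [this]
    refine (norm_sub_le _ _).trans ?_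
    rw [norm_smul (l - m), b'.norm_eq_one, mul_one, Real.norm_eq_abs]
    linarith
  rw [norm_smul, Real.norm_eq_abs, abs_of_pos (by linarith [hl.1])] at h5
  have : s / 2 * (δ / 2) ≤ l * ‖b 0 - b' 0‖ :=
    mul_le_mul hl.1 h (by positivity) (by linarith [hl.1])
  nlinarith [mul_pos hs hδ]

lemma measurableSet_rayBox (b : OrthonormalBasis (Fin 4) ℝ E4) (s δ : ℝ) :
    MeasurableSet (rayBox b s δ) := measurableSet_onbBox _ _ _

/-- Separated directions whose ray boxes lie in a given set are few. -/
lemma card_mul_le_of_rayBox_subset {ι : Type} {v : ι → E4} (hv : ∀ i, ‖v i‖ = 1) {δ s : ℝ}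
    (hδ : 0 < δ) (hs : 0 < s) (A : Finset ι)
    (hsep : ∀ i ∈ A, ∀ j ∈ A, i ≠ j → δ ≤ angle (v i) (v j)) {Z : Set E4}
    (hZ : ∀ i ∈ A, ∀ x, (∃ l ∈ Set.Icc (s / 2) s, ‖x - l • v i‖ ≤ δ * s / 32) → x ∈ Z) :
    (A.card : ℝ≥0∞) * ENNReal.ofReal (s ^ 4 * δ ^ 3 / 65536) ≤ volume Z := by
  choose b hb using fun i => exists_onb_first (hv i)
  have hd : (A : Set ι).PairwiseDisjoint fun i => rayBox (b i) s δ := by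
    intro i hi j hj hij
    refine disjoint_rayBox hs hδ ?_
    rw [hb, hb]
    exact half_le_norm_sub_of_le_angle (hv i) (hv j) hδ.le (hsep i hi j hj hij)
  have h1 := measure_biUnion_finset (μ := volume) hd fun i _ => measurableSet_rayBox (b i) s δ
  simp only [volume_rayBox _ hs hδ, Finset.sum_const, nsmul_eq_mul] at h1
  rw [← h1]
  refine measure_mono (Set.iUnion₂_subset fun i hi x hx => hZ i hi x ?_)
  have := exists_of_mem_rayBox hs hδ hx
  rwa [hb] at this

/-- There are at most `O(δ⁻³)` directions that are `δ`-separated. -/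
lemma exists_card_le_of_separated : ∃ C > (0 : ℝ), ∀ {ι : Type} {v : ι → E4}, (∀ i, ‖v i‖ = 1) →
    ∀ {δ : ℝ}, 0 < δ → δ ≤ 1 → ∀ A : Finset ι,
      (∀ i ∈ A, ∀ j ∈ A, i ≠ j → δ ≤ angle (v i) (v j)) → (A.card : ℝ) * δ ^ 3 ≤ C := by
  refine ⟨65536 * (volume (Metric.ball (0 : E4) 2)).toReal, mul_pos (by norm_num)
    (ENNReal.toReal_pos (Metric.measure_ball_pos volume _ (by norm_num)).ne'
      measure_ball_lt_top.ne), fun {ι v} hv {δ} hδ hδ1 A hsep => ?_⟩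
  have h := card_mul_le_of_rayBox_subset hv hδ one_pos A hsep (Z := Metric.ball 0 2) ?_
  · have h2 := ENNReal.toReal_mono measure_ball_lt_top.ne h
    rw [ENNReal.toReal_mul, ENNReal.toReal_natCast, ENNReal.toReal_ofReal (by positivity)] at h2
    linarith
  · rintro i _ x ⟨l, hl, hx⟩
    rw [mem_ball_zero_iff]
    have h1 : ‖x‖ ≤ ‖x - l • v i‖ + ‖l • v i‖ := by
      have := norm_add_le (x - l • v i) (l • v i)
      simpa using this
    rw [norm_smul, hv, mul_one, Real.norm_eq_abs, abs_of_pos (by linarith [hl.1])] at h1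
    linarith [hl.2]

end Directions

section Segments

/-- Few separated tubes contain a long segment near the zero set of a polynomial, inside a ball. -/
theorem exists_card_bad_segments_le {ε : ℝ} (hε : 0 < ε) (hε1 : ε ≤ 1) (D : ℕ) :
    ∃ C > (0 : ℝ), ∀ {ι : Type} {y v : ι → E4}, (∀ i, ‖v i‖ = 1) → ∀ {δ R : ℝ}, 0 < δ → δ ≤ R →
      R ≤ 1 / 2 → ∀ P : Poly4, P.totalDegree ≤ D → ∀ (b : E4) (A : Finset ι),
      (∀ i ∈ A, ∀ j ∈ A, i ≠ j → δ ≤ angle (v i) (v j)) →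
      (∀ i ∈ A, ∃ a : ℝ, ∀ t ∈ Set.Icc a (a + R),
        ¬ GoodPt 72 δ P (y i + t • v i) ∧ dist (y i + t • v i) b ≤ 4 * R) →
      (A.card : ℝ) * R ≤ C * δ ^ (-2 - ε) := by
  obtain ⟨C₁, hC₁⟩ := exists_volume_smpDir_le (2 * D)
  obtain ⟨C₂, hC₂, hvol⟩ := exists_volume_posRegion_gradPoly_le hε hε1 D (K := 216) (by norm_num)
  set N : ℕ := Fintype.card (Fin 5 → Word D × Fin 4) with hN
  refine ⟨65536 * (N * (C₁ * 5)) * C₂ * 216 + 1, by positivity,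
    fun {ι y v} hv {δ R} hδ hδR hR P hP b A hsep hseg => ?_⟩
  have hR0 : 0 < R := hδ.trans_le hδR
  set q : Word D × Fin 4 → Poly4 := fun c => gradPoly 216 δ (wordDeriv P (List.ofFn c.1.2)) c.2 with hq
  have hwd : ∀ c : Word D × Fin 4, (wordDeriv P (List.ofFn c.1.2)).totalDegree ≤ D := fun c =>
    (totalDegree_wordDeriv_le P _).trans ((Nat.sub_le _ _).trans hP)
  set Z : Set E4 := ⋃ c : Fin 5 → Word D × Fin 4,
    {v | (smpBase b (6 * R) (fun k => q (c k)) v).Nonempty} with hZ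
  have hcard := card_mul_le_of_rayBox_subset hv hδ hR0 A hsep (Z := Z) ?_
  · have hZv : volume Z ≤ N * (C₁ * (5 * ENNReal.ofReal (C₂ * δ ^ (1 - ε) * (6 * R) ^ 3))) := by
      refine (measure_iUnion_fintype_le volume _).trans ?_
      have h1 : ∀ c : Fin 5 → Word D × Fin 4,
          volume {v | (smpBase b (6 * R) (fun k => q (c k)) v).Nonempty} ≤
            C₁ * (5 * ENNReal.ofReal (C₂ * δ ^ (1 - ε) * (6 * R) ^ 3)) := by
        intro c
        refine (hC₁ b (6 * R) (by positivity) (fun k => q (c k))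
          fun k => totalDegree_gradPoly_le _ _ (hwd (c k)) _).trans (mul_le_mul_right ?_ _)
        refine (Finset.sum_le_card_nsmul _ _ _ fun k _ => hvol δ hδ _ (hwd (c k)) (c k).2 b (6 * R)
          (by positivity) (by linarith)).trans (le_of_eq ?_)
        simp
      refine (Finset.sum_le_card_nsmul _ _ _ fun c _ => h1 c).trans (le_of_eq ?_)
      rw [nsmul_eq_mul, Finset.card_univ, hN]
    have h2 := ENNReal.toReal_mono ?_ (hcard.trans hZv)
    · simp only [ENNReal.toReal_mul, ENNReal.toReal_natCast, ENNReal.toReal_ofNat] at h2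
      rw [ENNReal.toReal_ofReal (by positivity), ENNReal.toReal_ofReal (by positivity)] at h2
      have h3 : δ ^ (1 - ε) = δ ^ (-2 - ε) * δ ^ 3 := by
        rw [← Real.rpow_natCast, ← Real.rpow_add hδ]; congr 1; push_cast; ring
      rw [h3] at h2
      have hp : 0 < R ^ 3 * δ ^ 3 := by positivity
      have h4 : ((A.card : ℝ) * R) * (R ^ 3 * δ ^ 3) ≤
          (65536 * (N * (C₁ * 5)) * C₂ * 216 * δ ^ (-2 - ε)) * (R ^ 3 * δ ^ 3) := by
        nlinarith [h2]
      have h5 := le_of_mul_le_mul_right h4 hp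
      have h6 : 0 < δ ^ (-2 - ε) := Real.rpow_pos_of_pos hδ _
      linarith
    · exact ENNReal.mul_ne_top (ENNReal.natCast_ne_top _) (ENNReal.mul_ne_top
        (ENNReal.natCast_ne_top _) (ENNReal.mul_ne_top (by norm_num) ENNReal.ofReal_ne_top))
  · rintro i hi x ⟨l, hl, hx⟩
    obtain ⟨a, ha⟩ := hseg i hi
    have hnear : ∀ k : Fin 5, dist (y i + (a + smp k * l) • v i) (y i + a • v i + smp k • x) ≤
        δ * R / 32 := by
      intro k
      have h1 : y i + (a + smp k * l) • v i - (y i + a • v i + smp k • x) =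
          -(smp k • (x - l • v i)) := by
        rw [add_smul, mul_smul, smul_sub]; abel
      rw [dist_eq_norm, h1, norm_neg, norm_smul, Real.norm_eq_abs, abs_of_nonneg (smp_mem k).1]
      calc smp k * ‖x - l • v i‖ ≤ 1 * ‖x - l • v i‖ := by gcongr; exact (smp_mem k).2
        _ ≤ _ := by linarith
    have hmem : ∀ k : Fin 5, a + smp k * l ∈ Set.Icc a (a + R) := by
      intro k
      have h1 := (smp_mem k).1
      have h2 := (smp_mem k).2
      have h3 : 0 ≤ l := by linarith [hl.1]
      exact ⟨by nlinarith, by nlinarith [hl.2]⟩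
    have hRδ : δ * R / 32 ≤ 2 * δ := by nlinarith
    have hbad : ∀ k : Fin 5, ¬ GoodPt 216 δ P (y i + a • v i + smp k • x) := by
      intro k hg
      refine (ha _ (hmem k)).1 (GoodPt.of_near (K := 72) (by norm_num; exact hg) (by norm_num) hδ
        ((hnear k).trans hRδ))
    choose c hc using fun k => exists_ev_gradPoly_pos (by norm_num) hδ hP (hbad k)
    refine Set.mem_iUnion.2 ⟨c, y i + a • v i, fun k => ⟨hc k, ?_⟩⟩
    have h1 := dist_triangle_left (y i + a • v i + smp k • x) b (y i + (a + smp k * l) • v i)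
    have h2 := (ha _ (hmem k)).2
    have h3 := hnear k
    nlinarith

end Segments

section LocalEstimate

variable {ι : Type}

lemma sum_mul_rpow_le {α : Type*} (s : Finset α) (a w : α → ℝ≥0∞) :
    ∑ i ∈ s, a i * w i ^ (12 / 13 : ℝ) ≤
      (∑ i ∈ s, a i * w i) ^ (12 / 13 : ℝ) * (∑ i ∈ s, a i) ^ (1 / 13 : ℝ) := by
  have h := ENNReal.inner_le_Lp_mul_Lq s (fun i => (a i * w i) ^ (12 / 13 : ℝ))
    (fun i => a i ^ (1 / 13 : ℝ)) (p := 13 / 12) (q := 13)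
    (Real.holderConjugate_iff.2 ⟨by norm_num, by norm_num⟩)
  simp only [← ENNReal.rpow_mul] at h
  norm_num at h
  norm_num
  refine le_trans (Finset.sum_le_sum fun i _ => ?_) h
  rw [ENNReal.mul_rpow_of_nonneg _ _ (by norm_num), mul_right_comm,
    ← ENNReal.rpow_add_of_nonneg _ _ (by norm_num) (by norm_num)]
  norm_num

/-- The number of tubes through a point. -/
def tubeCount (δ : ℝ) (y v : ι → E4) (A : Finset ι) (x : E4) : ℝ≥0∞ :=
  ∑ i ∈ A, tubeInd δ (y i) (v i) x

lemma measurable_tubeCount (δ : ℝ) (y v : ι → E4) (A : Finset ι) :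
    Measurable (tubeCount δ y v A) :=
  Finset.measurable_fun_sum _ fun _ _ => measurable_tubeInd _ _ _

lemma setLIntegral_tubeCount_le {δ : ℝ} (hδ : 0 < δ) {y v : ι → E4} (hv : ∀ i, ‖v i‖ = 1)
    (A : Finset ι) (z : E4) {ρ : ℝ} (hρ : 0 ≤ ρ) :
    ∫⁻ x in Metric.closedBall z ρ, tubeCount δ y v A x ≤
      A.card * ENNReal.ofReal (16 * δ ^ 3 * ρ) := by
  unfold tubeCount
  rw [lintegral_finsetSum _ fun i _ => measurable_tubeInd _ _ _, ← nsmul_eq_mul]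
  refine Finset.sum_le_card_nsmul _ _ _ fun i _ => ?_
  unfold tubeInd
  rw [lintegral_indicator_one (measurableSet_tube _ _ _),
    Measure.restrict_apply (measurableSet_tube _ _ _)]
  exact volume_tube_inter_le hδ (hv i) z hρ

lemma tripleSum_rpow_le (δ : ℝ) (y v : ι → E4) (A : Fin 3 → Finset ι) (x : E4) :
    tripleSum δ (12 / 13) y v A x ^ (13 / 27 : ℝ) ≤
      (tripleSum δ 1 y v A x ^ (1 / 2 : ℝ)) ^ (8 / 9 : ℝ) *
        ∏ m, tubeCount δ y v (A m) x ^ (1 / 27 : ℝ) := by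
  have h := sum_mul_rpow_le (A 0 ×ˢ A 1 ×ˢ A 2)
    (fun p => tubeInd δ (y p.1) (v p.1) x * tubeInd δ (y p.2.1) (v p.2.1) x *
      tubeInd δ (y p.2.2) (v p.2.2) x) (fun p => ENNReal.ofReal (wedge3 (v p.1) (v p.2.1) (v p.2.2)))
  simp only [Finset.sum_product] at h
  have e1 : ∑ i ∈ A 0, ∑ j ∈ A 1, ∑ k ∈ A 2, tubeInd δ (y i) (v i) x * tubeInd δ (y j) (v j) x *
      tubeInd δ (y k) (v k) x =
      tubeCount δ y v (A 0) x * tubeCount δ y v (A 1) x * tubeCount δ y v (A 2) x := by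
    unfold tubeCount
    rw [Finset.sum_mul_sum, Finset.sum_mul]
    refine Finset.sum_congr rfl fun i _ => ?_
    rw [Finset.sum_mul]
    refine Finset.sum_congr rfl fun j _ => ?_
    rw [Finset.mul_sum]
  rw [e1] at h
  have e2 : tripleSum δ (12 / 13) y v A x ≤ tripleSum δ 1 y v A x ^ (12 / 13 : ℝ) *
      (tubeCount δ y v (A 0) x * tubeCount δ y v (A 1) x * tubeCount δ y v (A 2) x) ^ (1 / 13 : ℝ) := by
    refine le_trans (le_of_eq ?_) (h.trans (le_of_eq ?_))
    · unfold tripleSum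
      refine Finset.sum_congr rfl fun i _ => Finset.sum_congr rfl fun j _ =>
        Finset.sum_congr rfl fun k _ => ?_
      rw [ENNReal.ofReal_rpow_of_nonneg (wedge3_nonneg _ _ _) (by norm_num)]
    · simp only [tripleSum, Real.rpow_one]
  refine (ENNReal.rpow_le_rpow e2 (by norm_num)).trans (le_of_eq ?_)
  rw [ENNReal.mul_rpow_of_nonneg _ _ (by norm_num), ← ENNReal.rpow_mul, ← ENNReal.rpow_mul,
    ← ENNReal.rpow_mul, Fin.prod_univ_three,
    ← ENNReal.mul_rpow_of_nonneg _ _ (by norm_num), ← ENNReal.mul_rpow_of_nonneg _ _ (by norm_num)]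
  norm_num

/-- Multilinear estimate inside a ball of radius comparable to `R`. -/
theorem exists_setLIntegral_closedBall_le {ε : ℝ} (hε : 0 < ε) (hε1 : ε ≤ 1) :
    ∃ C > 0, ∀ δ : ℝ, 0 < δ → δ ≤ 1 → ∀ (ι : Type) (y v : ι → E4), (∀ i, ‖v i‖ = 1) →
      ∀ (A : Fin 3 → Finset ι) (z : E4) (R : ℝ), 0 < R →
      ∫⁻ x in Metric.closedBall z (2 * R), tripleSum δ (12 / 13) y v A x ^ (13 / 27 : ℝ) ≤
        ENNReal.ofReal (C * δ ^ (35 / 9 - 8 / 9 * ε) * R ^ (1 / 9 : ℝ) *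
          (((A 0).card : ℝ) * (A 1).card * (A 2).card) ^ (13 / 27 + 8 / 9 * ε)) := by
  obtain ⟨C, hC, hCk⟩ := exists_trilinear_kakeya hε hε1
  refine ⟨C ^ (8 / 9 : ℝ) * 32 ^ (1 / 9 : ℝ), by positivity, fun δ hδ hδ1 ι y v hv A z R hR => ?_⟩
  set Bl := Metric.closedBall z (2 * R)
  set Q : ℝ := ((A 0).card : ℝ) * (A 1).card * (A 2).card with hQ
  have hQ0 : 0 ≤ Q := by positivity
  have hQe : ((A 0).card : ℝ≥0∞) * (A 1).card * (A 2).card = ENNReal.ofReal Q := by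
    rw [hQ, ENNReal.ofReal_mul (by positivity), ENNReal.ofReal_mul (by positivity)]
    simp
  have h1 : ∫⁻ x in Bl, tripleSum δ 1 y v A x ^ (1 / 2 : ℝ) ≤
      ENNReal.ofReal (C * δ ^ (4 - ε) * Q ^ (1 / 2 + ε)) := by
    refine (setLIntegral_le_lintegral _ _).trans ((hCk δ hδ hδ1 ι y v hv A).trans (le_of_eq ?_))
    rw [hQe, ENNReal.ofReal_rpow_of_nonneg hQ0 (by positivity), ← ENNReal.ofReal_mul (by positivity)]
  have h2 : ∀ m, ∫⁻ x in Bl, tubeCount δ y v (A m) x ≤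
      ENNReal.ofReal ((A m).card * (32 * δ ^ 3 * R)) := by
    intro m
    refine (setLIntegral_tubeCount_le hδ hv (A m) z (by positivity)).trans (le_of_eq ?_)
    rw [ENNReal.ofReal_mul (p := ((A m).card : ℝ)) (by positivity), ENNReal.ofReal_natCast]
    congr 2
    ring
  calc ∫⁻ x in Bl, tripleSum δ (12 / 13) y v A x ^ (13 / 27 : ℝ)
      ≤ ∫⁻ x in Bl, (tripleSum δ 1 y v A x ^ (1 / 2 : ℝ)) ^ (8 / 9 : ℝ) *
        ∏ m, tubeCount δ y v (A m) x ^ (1 / 27 : ℝ) := lintegral_mono fun x => tripleSum_rpow_le _ _ _ _ _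
    _ ≤ (∫⁻ x in Bl, tripleSum δ 1 y v A x ^ (1 / 2 : ℝ)) ^ (8 / 9 : ℝ) *
        ∏ m, (∫⁻ x in Bl, tubeCount δ y v (A m) x) ^ (1 / 27 : ℝ) := by
      refine ENNReal.lintegral_mul_prod_norm_pow_le Finset.univ
        ((measurable_tripleSum _ _ _ _ _).pow_const _).aemeasurable
        (fun m _ => (measurable_tubeCount _ _ _ _).aemeasurable) _ ?_ (by norm_num)
        (fun _ _ => by norm_num)
      rw [Fin.sum_univ_three]; norm_num
    _ ≤ (ENNReal.ofReal (C * δ ^ (4 - ε) * Q ^ (1 / 2 + ε))) ^ (8 / 9 : ℝ) *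
        ∏ m, (ENNReal.ofReal ((A m).card * (32 * δ ^ 3 * R))) ^ (1 / 27 : ℝ) := by
      gcongr with m
      exact h2 m
    _ = ENNReal.ofReal ((C * δ ^ (4 - ε) * Q ^ (1 / 2 + ε)) ^ (8 / 9 : ℝ) *
        ∏ m, ((A m).card * (32 * δ ^ 3 * R)) ^ (1 / 27 : ℝ)) := by
      rw [ENNReal.ofReal_mul (p := (C * δ ^ (4 - ε) * Q ^ (1 / 2 + ε)) ^ (8 / 9 : ℝ)) (by positivity),
        ENNReal.ofReal_prod_of_nonneg fun m _ => by positivity,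
        ENNReal.ofReal_rpow_of_nonneg (by positivity) (by norm_num)]
      congr 1
      refine Finset.prod_congr rfl fun m _ => ?_
      rw [ENNReal.ofReal_rpow_of_nonneg (by positivity) (by norm_num)]
    _ = _ := by
      congr 1
      rw [Fin.prod_univ_three, ← Real.mul_rpow (by positivity) (by positivity),
        ← Real.mul_rpow (by positivity) (by positivity)]
      rw [show ((A 0).card * (32 * δ ^ 3 * R)) * ((A 1).card * (32 * δ ^ 3 * R)) *
        ((A 2).card * (32 * δ ^ 3 * R)) = Q * (32 * δ ^ (3 : ℝ) * R) ^ (3 : ℝ) by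
          rw [hQ]
          simp only [Real.rpow_ofNat]
          ring]
      clear_value Q
      have t1 : δ ^ (35 / 9 - 8 / 9 * ε) = δ ^ ((4 - ε) * (8 / 9)) * δ ^ (3 * 3 * (1 / 27) : ℝ) := by
        rw [← Real.rpow_add hδ]; congr 1; ring
      have t2 : Q ^ (13 / 27 + 8 / 9 * ε) = Q ^ ((1 / 2 + ε) * (8 / 9)) * Q ^ (1 / 27 : ℝ) := by
        rw [← Real.rpow_add_of_nonneg hQ0 (by positivity) (by norm_num)]; congr 1; ring
      rw [Real.mul_rpow (by positivity) (by positivity), Real.mul_rpow (by positivity) (by positivity),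
        Real.mul_rpow (by positivity) (by positivity), ← Real.rpow_mul hδ.le, ← Real.rpow_mul hQ0,
        ← Real.rpow_mul (by positivity), Real.mul_rpow (by positivity) hR.le,
        Real.mul_rpow (by norm_num) (by positivity), ← Real.rpow_mul hδ.le, t1, t2]
      norm_num
      ring

end LocalEstimate

section LocalNumerics

lemma mul_mul_rpow_le_add {a b c : ℝ} (ha : 0 ≤ a) (hb : 0 ≤ b) (hc : 0 ≤ c) :
    (a * b * c) ^ (1 / 3 : ℝ) ≤ a + b + c := by
  calc (a * b * c) ^ (1 / 3 : ℝ) ≤ ((a + b + c) ^ (3 : ℝ)) ^ (1 / 3 : ℝ) := by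
        refine Real.rpow_le_rpow (by positivity) ?_ (by norm_num)
        rw [Real.rpow_ofNat, show (a + b + c) ^ 3 = (a + b + c) * (a + b + c) * (a + b + c) by ring]
        gcongr <;> linarith
    _ = a + b + c := by
        rw [← Real.rpow_mul (by positivity)]
        norm_num

lemma rpow_mul_prod_rpow_le {e δ R N M Q : ℝ} (he : 0 < e) (he1 : e ≤ 1) (hδ : 0 < δ)
    (hR : 0 < R) (hM : 0 < M) (hQ : 1 ≤ Q) {n : Fin 3 → ℝ} (hn : ∀ m, 0 ≤ n m) (hnN : ∀ m, n m ≤ N)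
    (hN : N * δ ^ 3 ≤ Q) (m : Fin 3) (hm : n m * R ≤ M * δ ^ (-2 - e)) :
    δ ^ (35 / 9 - 8 / 9 * e) * R ^ (1 / 9 : ℝ) * (n 0 * n 1 * n 2) ^ (13 / 27 + 8 / 9 * e) ≤
      Q ^ (8 / 3 : ℝ) * M ^ (1 / 9 : ℝ) * (δ ^ (11 / 3 - 9 * e) * N ^ (1 / 3 : ℝ) *
        (n 0 + n 1 + n 2)) := by
  have hN0 : 0 ≤ N := (hn 0).trans (hnN 0)
  have hn0 := hn 0
  have hn1 := hn 1
  have hn2 := hn 2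
  set T := n 0 * n 1 * n 2 with hT
  have hT0 : 0 ≤ T := by positivity
  have hT1 : T ≤ N ^ 2 * n m := by
    rw [hT, sq]
    fin_cases m
    · calc n 0 * n 1 * n 2 = n 1 * n 2 * n 0 := by ring
        _ ≤ _ := by
          have := hnN 1
          have := hnN 2
          simp only [Fin.zero_eta]
          gcongr
    · calc n 0 * n 1 * n 2 = n 0 * n 2 * n 1 := by ring
        _ ≤ _ := by
          have := hnN 0
          have := hnN 2
          simp only [Fin.mk_one]
          gcongr
    · have := hnN 0
      have := hnN 1
      simp only [Fin.reduceFinMk]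
      gcongr
  have hT2 : T ≤ N ^ 3 := by
    refine hT1.trans ?_
    rw [pow_succ N 2]
    gcongr
    exact hnN m
  have hnm := hn m
  have a1 : T ^ (1 / 3 : ℝ) ≤ n 0 + n 1 + n 2 := mul_mul_rpow_le_add hn0 hn1 hn2
  have a2 : T ^ (4 / 27 : ℝ) ≤ N ^ (1 / 3 : ℝ) * n m ^ (1 / 9 : ℝ) := by
    calc T ^ (4 / 27 : ℝ) ≤ (N ^ (2 : ℝ) * n m) ^ (4 / 27 : ℝ) := by
          rw [Real.rpow_ofNat]
          gcongr
      _ = N ^ (8 / 27 : ℝ) * (n m ^ (1 / 27 : ℝ) * n m ^ (1 / 9 : ℝ)) := by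
          rw [Real.mul_rpow (by positivity) hnm, ← Real.rpow_mul hN0,
            ← Real.rpow_add_of_nonneg hnm (by norm_num) (by norm_num)]
          norm_num
      _ ≤ N ^ (8 / 27 : ℝ) * (N ^ (1 / 27 : ℝ) * n m ^ (1 / 9 : ℝ)) := by
          have := hnN m
          gcongr
      _ = _ := by
          rw [← mul_assoc, ← Real.rpow_add_of_nonneg hN0 (by norm_num) (by norm_num)]
          norm_num
  have a3 : T ^ (8 / 9 * e) ≤ Q ^ (8 / 3 : ℝ) * δ ^ (-8 * e) := by
    have hNle : N ≤ Q * δ ^ (-3 : ℝ) := by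
      rw [Real.rpow_neg hδ.le, ← div_eq_mul_inv, le_div_iff₀ (by positivity), Real.rpow_ofNat]
      exact hN
    calc T ^ (8 / 9 * e) ≤ (N ^ (3 : ℝ)) ^ (8 / 9 * e) := by
          rw [Real.rpow_ofNat]
          gcongr
      _ = N ^ (8 / 3 * e) := by
          rw [← Real.rpow_mul hN0]
          ring_nf
      _ ≤ (Q * δ ^ (-3 : ℝ)) ^ (8 / 3 * e) := by gcongr
      _ = Q ^ (8 / 3 * e) * δ ^ (-8 * e) := by
          rw [Real.mul_rpow (by positivity) (by positivity), ← Real.rpow_mul hδ.le]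
          ring_nf
      _ ≤ _ := by
          gcongr
          linarith
  have a4 : R ^ (1 / 9 : ℝ) * n m ^ (1 / 9 : ℝ) ≤ M ^ (1 / 9 : ℝ) * δ ^ (-2 / 9 - e / 9) := by
    rw [← Real.mul_rpow hR.le hnm, mul_comm R]
    refine (Real.rpow_le_rpow (by positivity) hm (by norm_num)).trans (le_of_eq ?_)
    rw [Real.mul_rpow hM.le (by positivity), ← Real.rpow_mul hδ.le]
    ring_nf
  have eT : T ^ (13 / 27 + 8 / 9 * e) = T ^ (1 / 3 : ℝ) * T ^ (4 / 27 : ℝ) * T ^ (8 / 9 * e) := by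
    rw [← Real.rpow_add_of_nonneg hT0 (by norm_num) (by norm_num),
      ← Real.rpow_add_of_nonneg hT0 (by norm_num) (by positivity)]
    norm_num
  have eδ : δ ^ (11 / 3 - 9 * e) = δ ^ (35 / 9 - 8 / 9 * e) * δ ^ (-2 / 9 - e / 9) * δ ^ (-8 * e) := by
    rw [← Real.rpow_add hδ, ← Real.rpow_add hδ]
    ring_nf
  rw [eT, eδ]
  clear_value T
  calc δ ^ (35 / 9 - 8 / 9 * e) * R ^ (1 / 9 : ℝ) * (T ^ (1 / 3 : ℝ) * T ^ (4 / 27 : ℝ) *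
        T ^ (8 / 9 * e))
      ≤ δ ^ (35 / 9 - 8 / 9 * e) * R ^ (1 / 9 : ℝ) * ((n 0 + n 1 + n 2) *
        (N ^ (1 / 3 : ℝ) * n m ^ (1 / 9 : ℝ)) * (Q ^ (8 / 3 : ℝ) * δ ^ (-8 * e))) := by gcongr
    _ = δ ^ (35 / 9 - 8 / 9 * e) * (R ^ (1 / 9 : ℝ) * n m ^ (1 / 9 : ℝ)) * (n 0 + n 1 + n 2) *
        N ^ (1 / 3 : ℝ) * (Q ^ (8 / 3 : ℝ) * δ ^ (-8 * e)) := by ring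
    _ ≤ δ ^ (35 / 9 - 8 / 9 * e) * (M ^ (1 / 9 : ℝ) * δ ^ (-2 / 9 - e / 9)) * (n 0 + n 1 + n 2) *
        N ^ (1 / 3 : ℝ) * (Q ^ (8 / 3 : ℝ) * δ ^ (-8 * e)) := by gcongr
    _ = _ := by ring

end LocalNumerics

section TubeClass

/-- The polynomials whose positivity locates the bad points, restricted to a line. -/
def corePoly (δ : ℝ) (P : Poly4) {D : ℕ} (y v : E4) (c : Word D × Fin 4) : Polynomial ℝ :=
  lineRes y v (gradPoly 72 δ (wordDeriv P (List.ofFn c.1.2)) c.2)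

/-- The parameters on a line where badness may change, together with `0`. -/
def coreRoots (δ : ℝ) (P : Poly4) (D : ℕ) (y v : E4) : Finset ℝ :=
  insert 0 (Finset.univ.biUnion fun c : Word D × Fin 4 => (corePoly δ P y v c).roots.toFinset)

lemma zero_mem_coreRoots (δ : ℝ) (P : Poly4) (D : ℕ) (y v : E4) : 0 ∈ coreRoots δ P D y v :=
  Finset.mem_insert_self _ _

lemma card_coreRoots_le (δ : ℝ) {P : Poly4} {D : ℕ} (hP : P.totalDegree ≤ D) (y v : E4) :
    (coreRoots δ P D y v).card ≤ Fintype.card (Word D × Fin 4) * (2 * D) + 1 := by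
  refine (Finset.card_insert_le _ _).trans (Nat.succ_le_succ ?_)
  refine Finset.card_biUnion_le_card_mul _ _ _ fun c _ => ?_
  refine (Multiset.toFinset_card_le _).trans ((Polynomial.card_roots' _).trans ?_)
  refine (natDegree_lineRes_le _ _ _).trans (totalDegree_gradPoly_le _ _ ?_ _)
  exact (totalDegree_wordDeriv_le _ _).trans ((Nat.sub_le _ _).trans hP)

lemma infDist_coreRoots_le_one (δ : ℝ) (P : Poly4) (D : ℕ) (y v : E4) {τ : ℝ}
    (hτ : τ ∈ Set.Icc (0 : ℝ) 1) : Metric.infDist τ (coreRoots δ P D y v : Set ℝ) ≤ 1 := by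
  refine (Metric.infDist_le_dist_of_mem
    (Finset.mem_coe.2 (zero_mem_coreRoots δ P D y v))).trans ?_
  rw [Real.dist_eq, sub_zero, abs_of_nonneg hτ.1]
  exact hτ.2

lemma not_goodPt_of_lt_infDist {δ : ℝ} (hδ : 0 < δ) {P : Poly4} {D : ℕ} (hP : P.totalDegree ≤ D)
    {x y v : E4} {τ R : ℝ} (hx : ¬GoodPt 24 δ P x) (hxτ : dist x (y + τ • v) ≤ δ)
    (hR : R < Metric.infDist τ (coreRoots δ P D y v : Set ℝ)) {t : ℝ} (ht : t ∈ Set.Icc τ (τ + R)) :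
    ¬GoodPt 72 δ P (y + t • v) := by
  have h1 : ¬GoodPt 72 δ P (y + τ • v) := fun h => hx
    (GoodPt.of_near (K := 24) (by norm_num; exact h) (by norm_num) hδ (by linarith))
  obtain ⟨c, hc⟩ := exists_ev_gradPoly_pos (by norm_num) hδ hP h1
  refine not_goodPt_of_ev_gradPoly_pos (D := D) (c := c) (by norm_num) hδ ?_
  rw [← eval_lineRes] at hc ⊢
  by_contra! hneg
  have hcont : ContinuousOn (fun s => (corePoly δ P y v c).eval s) (Set.Icc τ t) :=
    (Polynomial.continuous _).continuousOn
  obtain ⟨s, hs, hs0⟩ := intermediate_value_Icc' ht.1 hcont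
    (show (0 : ℝ) ∈ Set.Icc ((corePoly δ P y v c).eval t) ((corePoly δ P y v c).eval τ) from
      ⟨hneg, hc.le⟩)
  have hne : corePoly δ P y v c ≠ 0 := by
    intro h0
    have : (corePoly δ P y v c).eval τ = 0 := by rw [h0, Polynomial.eval_zero]
    exact hc.ne' this
  have hmem : s ∈ coreRoots δ P D y v := by
    refine Finset.mem_insert_of_mem (Finset.mem_biUnion.2 ⟨c, Finset.mem_univ _, ?_⟩)
    rw [Multiset.mem_toFinset, Polynomial.mem_roots hne]
    exact hs0
  have h2 := Metric.infDist_le_dist_of_mem (x := τ) (Finset.mem_coe.2 hmem)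
  rw [Real.dist_eq, abs_sub_comm, abs_of_nonneg (by linarith [hs.1])] at h2
  linarith [hs.2, ht.2]

/-- The points of a tube near a core parameter whose distance to `F` lies in `[lo, hi]`. -/
def tubeClass (F : Finset ℝ) (δ lo hi : ℝ) (y v : E4) : Set E4 :=
  {x | ∃ τ ∈ Set.Icc (0 : ℝ) 1, dist x (y + τ • v) ≤ δ ∧
    lo ≤ Metric.infDist τ (F : Set ℝ) ∧ Metric.infDist τ (F : Set ℝ) ≤ hi}

lemma tubeClass_subset (F : Finset ℝ) (δ lo hi : ℝ) (y v : E4) :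
    tubeClass F δ lo hi y v ⊆ tube δ y v := fun _ ⟨τ, hτ, h, _⟩ => ⟨τ, hτ, h⟩

lemma measurableSet_tubeClass (F : Finset ℝ) (δ lo hi : ℝ) (y v : E4) :
    MeasurableSet (tubeClass F δ lo hi y v) := by
  set U : Set ℝ := Set.Icc (0 : ℝ) 1 ∩ {τ | lo ≤ Metric.infDist τ (F : Set ℝ) ∧
    Metric.infDist τ (F : Set ℝ) ≤ hi}
  have hU : IsCompact U := isCompact_Icc.inter_right
    ((isClosed_le continuous_const (Metric.continuous_infDist_pt _)).inter
      (isClosed_le (Metric.continuous_infDist_pt _) continuous_const))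
  have hc : Continuous fun p : ℝ × E4 => y + p.1 • v + p.2 := by fun_prop
  have h := ((hU.prod (isCompact_closedBall (0 : E4) δ)).image hc).measurableSet
  convert h using 1
  ext x
  constructor
  · rintro ⟨τ, hτ, hd, hb⟩
    refine ⟨(τ, x - (y + τ • v)), ⟨⟨hτ, hb⟩, ?_⟩, by simp⟩
    rwa [mem_closedBall_zero_iff, ← dist_eq_norm]
  · rintro ⟨⟨τ, w⟩, ⟨⟨hτ, hb⟩, hw⟩, rfl⟩
    refine ⟨τ, hτ, ?_, hb⟩
    rw [mem_closedBall_zero_iff] at hw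
    simpa [dist_eq_norm] using hw

/-- The lower end of the dyadic range of distances with index `a`. -/
def classLo (δ : ℝ) (a : ℕ) : ℝ := if a = 0 then 0 else 32 * (2 ^ a * δ)

lemma exists_mem_tubeClass {δ : ℝ} (P : Poly4) (D : ℕ) {m : ℕ} (hm : 1 ≤ 2 ^ m * δ)
    {x y v : E4} (hx : x ∈ tube δ y v) : ∃ a : Fin (m + 1),
      x ∈ tubeClass (coreRoots δ P D y v) δ (classLo δ a) (64 * (2 ^ (a : ℕ) * δ)) y v := by
  classical
  obtain ⟨τ, hτ, hd⟩ := hx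
  set d := Metric.infDist τ (coreRoots δ P D y v : Set ℝ) with hdd
  have hd1 : d ≤ 1 := infDist_coreRoots_le_one δ P D y v hτ
  have hex : ∃ a : ℕ, d ≤ 64 * (2 ^ a * δ) := ⟨m, by linarith⟩
  have hle : Nat.find hex ≤ m := Nat.find_min' hex (by linarith)
  refine ⟨⟨Nat.find hex, Nat.lt_succ_of_le hle⟩, τ, hτ, hd, ?_, Nat.find_spec hex⟩
  unfold classLo
  split_ifs with h0
  · exact Metric.infDist_nonneg
  · have h1 := Nat.find_min hex (m := Nat.find hex - 1) (by simp only at h0; omega)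
    simp only at h0 ⊢
    obtain ⟨b, hb⟩ := Nat.exists_eq_succ_of_ne_zero h0
    rw [hb] at h1 ⊢
    simp only [Nat.succ_eq_add_one, Nat.add_sub_cancel, not_le] at h1
    rw [Nat.succ_eq_add_one, pow_succ]
    linarith

/-- Few tubes of one class can be bad inside a given ball. -/
theorem exists_card_tubeClass_le {ε : ℝ} (hε : 0 < ε) (hε1 : ε ≤ 1) (D : ℕ) :
    ∃ M > 0, ∀ {ι : Type} {y v : ι → E4}, (∀ i, ‖v i‖ = 1) → ∀ {δ R lo hi : ℝ}, 0 < δ → δ ≤ 1 →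
      δ ≤ R → (R ≤ δ ∨ 32 * R ≤ lo) → ∀ P : Poly4, P.totalDegree ≤ D → ∀ (b : E4) (A : Finset ι),
      (∀ i ∈ A, ∀ j ∈ A, i ≠ j → δ ≤ angle (v i) (v j)) →
      (∀ i ∈ A, ∃ x ∈ tubeClass (coreRoots δ P D (y i) (v i)) δ lo hi (y i) (v i),
        ¬GoodPt 24 δ P x ∧ dist x b ≤ 2 * R) →
      (A.card : ℝ) * R ≤ M * δ ^ (-2 - ε) := by
  obtain ⟨C, hC, hCs⟩ := exists_card_bad_segments_le hε hε1 D
  obtain ⟨C', hC', hCp⟩ := exists_card_le_of_separated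
  refine ⟨C + C', by positivity, ?_⟩
  intro ι y v hv δ R lo hi hδ hδ1 hδR hlo P hP b A hsep hA
  rcases hlo with hR | hlo
  · have h1 := hCp hv hδ hδ1 A hsep
    calc (A.card : ℝ) * R ≤ A.card * δ := by gcongr
      _ = A.card * δ ^ 3 * δ ^ (-2 : ℝ) := by
        rw [Real.rpow_neg hδ.le, Real.rpow_ofNat]
        field_simp
      _ ≤ (C + C') * δ ^ (-2 - ε) := by
        refine mul_le_mul (by linarith) ?_ (by positivity) (by positivity)
        exact Real.rpow_le_rpow_of_exponent_ge hδ hδ1 (by linarith)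
  · rcases A.eq_empty_or_nonempty with rfl | ⟨i₀, hi₀⟩
    · simp only [Finset.card_empty, Nat.cast_zero, zero_mul]
      positivity
    have hR1 : R ≤ 1 / 2 := by
      obtain ⟨x, ⟨τ, hτ, -, h, -⟩, -⟩ := hA i₀ hi₀
      have := infDist_coreRoots_le_one δ P D (y i₀) (v i₀) hτ
      linarith
    refine (hCs (y := y) hv hδ hδR hR1 P hP b A hsep fun i hi => ?_).trans ?_
    · obtain ⟨x, ⟨τ, hτ, hd, h, -⟩, hx, hxb⟩ := hA i hi
      refine ⟨τ, fun t ht => ⟨not_goodPt_of_lt_infDist hδ hP hx hd (by linarith) ht, ?_⟩⟩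
      have h1 : dist (y i + t • v i) (y i + τ • v i) ≤ R := by
        rw [dist_add_left, dist_eq_norm, ← sub_smul, norm_smul, hv i, mul_one, Real.norm_eq_abs,
          abs_of_nonneg (by linarith [ht.1])]
        linarith [ht.2]
      have h2 := dist_triangle4 (y i + t • v i) (y i + τ • v i) x b
      rw [dist_comm (y i + τ • v i) x] at h2
      linarith
    · gcongr
      linarith

end TubeClass

section GridCubes

/-- The half-open grid cube of side `R` with index `B`. -/
def gridCube (R : ℝ) (B : Fin 4 → ℤ) : Set E4 := {x | ∀ l, ⌊x l / R⌋ = B l}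

/-- The corner of a grid cube. -/
def gridCorner (R : ℝ) (B : Fin 4 → ℤ) : E4 := WithLp.toLp 2 fun l => R * B l

lemma measurableSet_gridCube (R : ℝ) (B : Fin 4 → ℤ) : MeasurableSet (gridCube R B) := by
  have h : gridCube R B = ⋂ l, {x : E4 | ⌊x l / R⌋ = B l} := by
    ext x; simp [gridCube]
  rw [h]
  refine MeasurableSet.iInter fun l => ?_
  have hm : Measurable fun x : E4 => ⌊x l / R⌋ := by
    refine Int.measurable_floor.comp (Measurable.div_const ?_ _)
    exact (EuclideanSpace.proj l : E4 →L[ℝ] ℝ).continuous.measurable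
  exact hm (measurableSet_singleton (B l))

lemma iUnion_gridCube (R : ℝ) : ⋃ B, gridCube R B = Set.univ :=
  Set.eq_univ_of_forall fun x => Set.mem_iUnion.2 ⟨fun l => ⌊x l / R⌋, fun _ => rfl⟩

lemma norm_le_two_mul {h : E4} {r : ℝ} (hr : 0 ≤ r) (hh : ∀ l, |h l| ≤ r) : ‖h‖ ≤ 2 * r := by
  rw [EuclideanSpace.norm_eq, Fin.sum_univ_four]
  refine Real.sqrt_le_iff.2 ⟨by positivity, ?_⟩
  have : ∀ l, ‖h l‖ ^ 2 ≤ r ^ 2 := fun l => pow_le_pow_left₀ (norm_nonneg _) (hh l) 2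
  linarith [this 0, this 1, this 2, this 3]

lemma gridCube_subset_closedBall {R : ℝ} (hR : 0 < R) (B : Fin 4 → ℤ) :
    gridCube R B ⊆ Metric.closedBall (gridCorner R B) (2 * R) := by
  intro x hx
  rw [Metric.mem_closedBall, dist_eq_norm]
  refine norm_le_two_mul hR.le fun l => ?_
  have h1 := Int.floor_le (x l / R)
  have h2 := Int.lt_floor_add_one (x l / R)
  rw [hx l] at h1 h2
  rw [le_div_iff₀ hR] at h1
  rw [div_lt_iff₀ hR] at h2
  change |x l - R * B l| ≤ R
  rw [abs_le]
  constructor <;> linarith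

/-- Indices of the grid cubes of side `R` near `p`. -/
def nearCubes (R : ℝ) (p : E4) : Finset (Fin 4 → ℤ) :=
  Fintype.piFinset fun l => Finset.Icc (⌊p l / R⌋ - 66) (⌊p l / R⌋ + 66)

lemma card_nearCubes (R : ℝ) (p : E4) : (nearCubes R p).card = 133 ^ 4 := by
  have h : ∀ a : ℤ, (a + 66 + 1 - (a - 66)).toNat = 133 := fun a => by
    rw [show a + 66 + 1 - (a - 66) = 133 by ring]; rfl
  simp only [nearCubes, Fintype.card_piFinset, Int.card_Icc, h, Finset.prod_const,
    Finset.card_univ, Fintype.card_fin]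

lemma mem_nearCubes {R : ℝ} (hR : 0 < R) {x p : E4} {B : Fin 4 → ℤ} (hx : x ∈ gridCube R B)
    (hxp : dist x p ≤ 65 * R) : B ∈ nearCubes R p := by
  refine Fintype.mem_piFinset.2 fun l => ?_
  rw [← hx l, Finset.mem_Icc]
  have h : |x l - p l| ≤ 65 * R := (abs_coord_le (x - p) l).trans (by rwa [← dist_eq_norm])
  have e : |x l / R - p l / R| ≤ 65 := by
    rw [← sub_div, abs_div, abs_of_pos hR, div_le_iff₀ hR]
    exact h
  rw [abs_le] at e
  have a1 := Int.floor_le (x l / R)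
  have a2 := Int.lt_floor_add_one (x l / R)
  have b1 := Int.floor_le (p l / R)
  have b2 := Int.lt_floor_add_one (p l / R)
  have c1 : ((⌊p l / R⌋ - 66 : ℤ) : ℝ) < (⌊x l / R⌋ + 1 : ℤ) := by push_cast; linarith
  have c2 : ((⌊x l / R⌋ : ℤ) : ℝ) < (⌊p l / R⌋ + 66 + 1 : ℤ) := by push_cast; linarith
  have d1 := Int.cast_lt.1 c1
  have d2 := Int.cast_lt.1 c2
  omega

lemma tsum_card_filter_le {ι β : Type*} (A : Finset ι) (p : β → ι → Prop)
    [∀ B, DecidablePred (p B)] (S : ι → Finset β) (L : ℕ)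
    (hS : ∀ i ∈ A, ∀ B, p B i → B ∈ S i) (hL : ∀ i ∈ A, (S i).card ≤ L) :
    ∑' B, ((A.filter (p B)).card : ℝ≥0∞) ≤ A.card * L := by
  classical
  calc ∑' B, ((A.filter (p B)).card : ℝ≥0∞)
      = ∑' B, ∑ i ∈ A, (if p B i then 1 else 0 : ℝ≥0∞) := by
        refine tsum_congr fun B => ?_
        rw [Finset.sum_boole]
    _ = ∑ i ∈ A, ∑' B, (if p B i then 1 else 0 : ℝ≥0∞) :=
        Summable.tsum_finsetSum fun _ _ => ENNReal.summable
    _ ≤ ∑ _i ∈ A, (L : ℝ≥0∞) := by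
        refine Finset.sum_le_sum fun i hi => ?_
        rw [tsum_eq_sum (s := S i) fun B hB => if_neg fun h => hB (hS i hi B h)]
        refine (Finset.sum_le_sum (g := fun _ => (1 : ℝ≥0∞)) fun B _ => ?_).trans ?_
        · split_ifs <;> simp
        · rw [Finset.sum_const, nsmul_eq_mul, mul_one]
          exact_mod_cast hL i hi
    _ = _ := by rw [Finset.sum_const, nsmul_eq_mul]

/-- Grid cubes which can meet the class of points within `64 R` of a core parameter in `F`. -/
def classCubes (F : Finset ℝ) (R : ℝ) (y v : E4) : Finset (Fin 4 → ℤ) :=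
  F.biUnion fun z => nearCubes R (y + z • v)

lemma card_classCubes_le (F : Finset ℝ) (R : ℝ) (y v : E4) :
    (classCubes F R y v).card ≤ F.card * 133 ^ 4 :=
  Finset.card_biUnion_le_card_mul _ _ _ fun _ _ => (card_nearCubes _ _).le

lemma mem_classCubes {F : Finset ℝ} (hF : F.Nonempty) {δ lo hi R : ℝ} (hR : 0 < R) (hδR : δ ≤ R)
    (hhi : hi ≤ 64 * R) {x y v : E4} (hv : ‖v‖ = 1) (hx : x ∈ tubeClass F δ lo hi y v)
    {B : Fin 4 → ℤ} (hB : x ∈ gridCube R B) : B ∈ classCubes F R y v := by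
  obtain ⟨τ, -, hd, -, h⟩ := hx
  obtain ⟨z, hz, hzd⟩ := F.finite_toSet.isCompact.exists_infDist_eq_dist hF τ
  refine Finset.mem_biUnion.2 ⟨z, hz, mem_nearCubes hR hB ?_⟩
  have h1 : dist (y + τ • v) (y + z • v) = dist τ z := by
    rw [dist_add_left, dist_eq_norm, ← sub_smul, norm_smul, hv, mul_one, ← dist_eq_norm]
  have h2 := dist_triangle x (y + τ • v) (y + z • v)
  linarith

end GridCubes

section ClassSum

variable {ι : Type}

/-- The weighted number of triples of sets through a point. -/
def classSum (s : ℝ) (v : ι → E4) (A : Finset ι) (T : Fin 3 → ι → Set E4) (x : E4) : ℝ≥0∞ :=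
  ∑ i ∈ A, ∑ j ∈ A, ∑ k ∈ A, (T 0 i).indicator 1 x * (T 1 j).indicator 1 x *
    (T 2 k).indicator 1 x * ENNReal.ofReal (wedge3 (v i) (v j) (v k) ^ s)

lemma measurable_classSum (s : ℝ) (v : ι → E4) (A : Finset ι) {T : Fin 3 → ι → Set E4}
    (hT : ∀ l i, MeasurableSet (T l i)) : Measurable (classSum s v A T) := by
  have h : ∀ l i, Measurable fun x => (T l i).indicator (1 : E4 → ℝ≥0∞) x := fun l i =>
    measurable_one.indicator (hT l i)
  exact Finset.measurable_fun_sum _ fun i _ => Finset.measurable_fun_sum _ fun j _ =>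
    Finset.measurable_fun_sum _ fun k _ => (((h 0 i).mul (h 1 j)).mul (h 2 k)).mul_const _

lemma tripleSum_le_sum_classSum {δ s : ℝ} {y v : ι → E4} {A : Finset ι} {m : ℕ}
    {T : Fin m → ι → Set E4} {x : E4} (h : ∀ i, x ∈ tube δ (y i) (v i) → ∃ a, x ∈ T a i) :
    tripleSum δ s y v (fun _ => A) x ≤
      ∑ κ : Fin 3 → Fin m, classSum s v A (fun l i => T (κ l) i) x := by
  unfold tripleSum classSum
  conv_rhs => rw [Finset.sum_comm]
  refine Finset.sum_le_sum fun i _ => ?_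
  conv_rhs => rw [Finset.sum_comm]
  refine Finset.sum_le_sum fun j _ => ?_
  conv_rhs => rw [Finset.sum_comm]
  refine Finset.sum_le_sum fun k _ => ?_
  by_cases hi : x ∈ tube δ (y i) (v i)
  swap
  · simp [tubeInd_of_notMem hi]
  by_cases hj : x ∈ tube δ (y j) (v j)
  swap
  · simp [tubeInd_of_notMem hj]
  by_cases hk : x ∈ tube δ (y k) (v k)
  swap
  · simp [tubeInd_of_notMem hk]
  obtain ⟨a, ha⟩ := h i hi
  obtain ⟨b, hb⟩ := h j hj
  obtain ⟨c, hc⟩ := h k hk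
  refine le_trans (le_of_eq ?_) (Finset.single_le_sum (f := fun κ : Fin 3 → Fin m =>
    (T (κ 0) i).indicator (1 : E4 → ℝ≥0∞) x * (T (κ 1) j).indicator (1 : E4 → ℝ≥0∞) x *
    (T (κ 2) k).indicator (1 : E4 → ℝ≥0∞) x * ENNReal.ofReal (wedge3 (v i) (v j) (v k) ^ s))
    (fun _ _ => zero_le) (Finset.mem_univ ![a, b, c]))
  simp [tubeInd_of_mem hi, tubeInd_of_mem hj, tubeInd_of_mem hk, ha, hb, hc]

lemma classSum_le_tripleSum {δ s : ℝ} {y v : ι → E4} {A : Finset ι} {T : Fin 3 → ι → Set E4}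
    (hT : ∀ l i, T l i ⊆ tube δ (y i) (v i)) {x : E4} {A' : Fin 3 → Finset ι}
    (hA : ∀ l, ∀ i ∈ A, x ∈ T l i → i ∈ A' l) :
    classSum s v A T x ≤ tripleSum δ s y v A' x := by
  have hle : ∀ l i, (T l i).indicator (1 : E4 → ℝ≥0∞) x ≤ tubeInd δ (y i) (v i) x := fun l i =>
    Set.indicator_le_indicator_of_subset (hT l i) (fun _ => zero_le) x
  have hm : ∀ l, ∀ i ∈ A, (T l i).indicator (1 : E4 → ℝ≥0∞) x ≠ 0 → i ∈ A' l := fun l i hi h0 =>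
    hA l i hi (Set.mem_of_indicator_ne_zero h0)
  unfold classSum tripleSum
  refine (Finset.sum_le_sum_of_ne_zero (s := A) (t := A' 0) fun i hi hi0 => ?_).trans
    (Finset.sum_le_sum fun i _ => (Finset.sum_le_sum_of_ne_zero (s := A) (t := A' 1)
      fun j hj hj0 => ?_).trans (Finset.sum_le_sum fun j _ =>
        (Finset.sum_le_sum_of_ne_zero (s := A) (t := A' 2) fun k hk hk0 => ?_).trans
          (Finset.sum_le_sum fun k _ => ?_)))
  · exact hm 0 i hi fun h0 => hi0 (by simp [h0])
  · exact hm 1 j hj fun h0 => hj0 (by simp [h0])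
  · exact hm 2 k hk fun h0 => hk0 (by simp [h0])
  · gcongr
    · exact hle 0 i
    · exact hle 1 j
    · exact hle 2 k

lemma sum_rpow_le_sum_rpow {α : Type*} (s : Finset α) (f : α → ℝ≥0∞) {p : ℝ} (hp : 0 < p)
    (hp1 : p ≤ 1) : (∑ i ∈ s, f i) ^ p ≤ ∑ i ∈ s, f i ^ p :=
  Finset.le_sum_of_subadditive (fun a : ℝ≥0∞ => a ^ p) (ENNReal.zero_rpow_of_pos hp).le
    (fun a b => ENNReal.rpow_add_le_add_rpow a b hp.le hp1) s f

/-- The tubes of the class with index `a`. -/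
def dyadicClass (δ : ℝ) (P : Poly4) (D : ℕ) (a : ℕ) (y v : E4) : Set E4 :=
  tubeClass (coreRoots δ P D y v) δ (classLo δ a) (64 * (2 ^ a * δ)) y v

/-- The bad part of the integral, for one triple of dyadic classes. -/
theorem exists_setLIntegral_classSum_le {ε : ℝ} (hε : 0 < ε) (hε1 : ε ≤ 1) (D : ℕ) :
    ∃ C > 0, ∀ δ : ℝ, 0 < δ → δ ≤ 1 → ∀ (ι : Type) (y v : ι → E4), (∀ i, ‖v i‖ = 1) →
      ∀ A : Finset ι, (∀ i ∈ A, ∀ j ∈ A, i ≠ j → δ ≤ angle (v i) (v j)) →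
      ∀ P : Poly4, P.totalDegree ≤ D → ∀ κ : Fin 3 → ℕ,
      ∫⁻ x in {x | ¬GoodPt 24 δ P x}, classSum (12 / 13) v A
        (fun l i => dyadicClass δ P D (κ l) (y i) (v i)) x ^ (13 / 27 : ℝ) ≤
        ENNReal.ofReal (C * δ ^ (11 / 3 - 9 * ε) * (A.card : ℝ) ^ (4 / 3 : ℝ)) := by
  classical
  obtain ⟨C, hC, hCl⟩ := exists_setLIntegral_closedBall_le hε hε1
  obtain ⟨M, hM, hMc⟩ := exists_card_tubeClass_le hε hε1 D
  obtain ⟨Q', hQ', hQs⟩ := exists_card_le_of_separated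
  set Q := Q' + 1 with hQ
  set L := (Fintype.card (Word D × Fin 4) * (2 * D) + 1) * 133 ^ 4 with hL
  refine ⟨C * (Q ^ (8 / 3 : ℝ) * M ^ (1 / 9 : ℝ)) * (3 * L), by positivity, ?_⟩
  intro δ hδ hδ1 ι y v hv A hsep P hP κ
  set X : Set E4 := {x | ¬GoodPt 24 δ P x} with hX
  set T : Fin 3 → ι → Set E4 := fun l i => dyadicClass δ P D (κ l) (y i) (v i) with hT
  obtain ⟨m, hm⟩ : ∃ m, ∀ l, κ l ≤ κ m := Finite.exists_max κ
  have hsub : ∀ l i, T l i ⊆ tube δ (y i) (v i) := fun l i => tubeClass_subset _ _ _ _ _ _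
  have hcard : ∀ i, (classCubes (coreRoots δ P D (y i) (v i)) (2 ^ κ m * δ) (y i) (v i)).card ≤ L :=
    fun i => (card_classCubes_le _ _ _ _).trans
      (Nat.mul_le_mul_right _ (card_coreRoots_le δ hP _ _))
  clear_value L
  clear hL
  have hXm : MeasurableSet X := (isClosed_goodPt 24 δ P).measurableSet.compl
  set R : ℝ := 2 ^ κ m * δ with hR
  have hδR : δ ≤ R := le_mul_of_one_le_left hδ.le (one_le_pow₀ (by norm_num))
  have hR0 : 0 < R := by positivity
  set AB : (Fin 4 → ℤ) → Fin 3 → Finset ι := fun B l =>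
    A.filter fun i => (T l i ∩ gridCube R B ∩ X).Nonempty with hAB
  set N : ℝ := (A.card : ℝ) with hN
  have hN0 : 0 ≤ N := Nat.cast_nonneg _
  have hNQ : N * δ ^ 3 ≤ Q := by linarith [hQs hv hδ hδ1 A hsep]
  set K : ℝ := C * (Q ^ (8 / 3 : ℝ) * M ^ (1 / 9 : ℝ) * (δ ^ (11 / 3 - 9 * ε) * N ^ (1 / 3 : ℝ)))
    with hK
  have hK0 : 0 ≤ K := by positivity
  have hcube : ∀ B, ∫⁻ x in X ∩ gridCube R B, classSum (12 / 13) v A T x ^ (13 / 27 : ℝ) ≤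
      ENNReal.ofReal K * ∑ l, ((AB B l).card : ℝ≥0∞) := by
    intro B
    have hm1 : ((AB B m).card : ℝ) * R ≤ M * δ ^ (-2 - ε) := by
      refine hMc (y := y) hv hδ hδ1 hδR (lo := classLo δ (κ m)) (hi := 64 * (2 ^ κ m * δ)) ?_ P hP
        (gridCorner R B) (AB B m) ?_ ?_
      · by_cases h0 : κ m = 0
        · left; rw [hR, h0]; simp
        · right; simp only [classLo, h0, if_false]; exact le_rfl
      · intro i hi j hj
        exact hsep i (Finset.mem_filter.1 hi).1 j (Finset.mem_filter.1 hj).1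
      · intro i hi
        obtain ⟨x, ⟨hx1, hx2⟩, hx3⟩ := (Finset.mem_filter.1 hi).2
        exact ⟨x, hx1, hx3, gridCube_subset_closedBall hR0 B hx2⟩
    have hnum := rpow_mul_prod_rpow_le hε hε1 hδ hR0 hM (Q := Q) (by linarith)
      (n := fun l => ((AB B l).card : ℝ)) (N := N) (fun _ => by positivity)
      (fun l => by
        rw [hN]
        exact_mod_cast Finset.card_le_card (Finset.filter_subset _ _)) hNQ m hm1
    calc ∫⁻ x in X ∩ gridCube R B, classSum (12 / 13) v A T x ^ (13 / 27 : ℝ)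
        ≤ ∫⁻ x in X ∩ gridCube R B, tripleSum δ (12 / 13) y v (AB B) x ^ (13 / 27 : ℝ) := by
          refine setLIntegral_mono_ae' (hXm.inter (measurableSet_gridCube R B))
            (Filter.Eventually.of_forall fun x hx => ?_)
          refine ENNReal.rpow_le_rpow (classSum_le_tripleSum hsub
            fun l i hi hxi => ?_) (by norm_num)
          exact Finset.mem_filter.2 ⟨hi, x, ⟨hxi, hx.2⟩, hx.1⟩
      _ ≤ ∫⁻ x in Metric.closedBall (gridCorner R B) (2 * R),
            tripleSum δ (12 / 13) y v (AB B) x ^ (13 / 27 : ℝ) :=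
          lintegral_mono_set (Set.inter_subset_right.trans (gridCube_subset_closedBall hR0 B))
      _ ≤ _ := hCl δ hδ hδ1 ι y v hv (AB B) _ R hR0
      _ ≤ ENNReal.ofReal (K * ∑ l, ((AB B l).card : ℝ)) := by
          refine ENNReal.ofReal_le_ofReal ?_
          rw [Fin.sum_univ_three, mul_assoc, mul_assoc, hK, mul_assoc C]
          refine mul_le_mul_of_nonneg_left ?_ hC.le
          rw [← mul_assoc]
          refine hnum.trans (le_of_eq ?_)
          ring
      _ = _ := by
          rw [ENNReal.ofReal_mul hK0, ENNReal.ofReal_sum_of_nonneg fun _ _ => by positivity]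
          simp
  have hcount : ∀ l, ∑' B, ((AB B l).card : ℝ≥0∞) ≤ A.card * L := by
    intro l
    refine tsum_card_filter_le A _ (fun i => classCubes (coreRoots δ P D (y i) (v i)) R (y i) (v i))
      L ?_ ?_
    · rintro i - B ⟨x, ⟨hx1, hx2⟩, -⟩
      refine mem_classCubes ⟨0, zero_mem_coreRoots δ P D _ _⟩ hR0 hδR ?_ (hv i) hx1 hx2
      have : (2 : ℝ) ^ κ l ≤ 2 ^ κ m := pow_le_pow_right₀ (by norm_num) (hm l)
      rw [hR]
      gcongr
    · exact fun i _ => hcard i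
  have hXe : X = ⋃ B, X ∩ gridCube R B := by
    rw [← Set.inter_iUnion, iUnion_gridCube, Set.inter_univ]
  calc ∫⁻ x in X, classSum (12 / 13) v A T x ^ (13 / 27 : ℝ)
      ≤ ∑' B, ∫⁻ x in X ∩ gridCube R B, classSum (12 / 13) v A T x ^ (13 / 27 : ℝ) := by
        conv_lhs => rw [hXe]
        exact lintegral_iUnion_le _ _
    _ ≤ ∑' B, ENNReal.ofReal K * ∑ l, ((AB B l).card : ℝ≥0∞) := ENNReal.tsum_le_tsum hcube
    _ = ENNReal.ofReal K * ∑ l, ∑' B, ((AB B l).card : ℝ≥0∞) := by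
        rw [ENNReal.tsum_mul_left, Summable.tsum_finsetSum fun _ _ => ENNReal.summable]
    _ ≤ ENNReal.ofReal K * ∑ _l : Fin 3, (A.card * L : ℝ≥0∞) := by
        gcongr with l
        exact hcount l
    _ = ENNReal.ofReal (K * (3 * (N * L))) := by
        rw [ENNReal.ofReal_mul hK0, ENNReal.ofReal_mul (p := 3) (by norm_num),
          ENNReal.ofReal_mul (p := N) hN0, hN, ENNReal.ofReal_natCast,
          ENNReal.ofReal_natCast, ENNReal.ofReal_ofNat, Finset.sum_const, Finset.card_univ,
          Fintype.card_fin, nsmul_eq_mul, Nat.cast_ofNat]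
    _ = _ := by
        congr 1
        have : N ^ (4 / 3 : ℝ) = N ^ (1 / 3 : ℝ) * N := by
          rw [show (4 / 3 : ℝ) = 1 / 3 + 1 by norm_num,
            Real.rpow_add_of_nonneg hN0 (by norm_num) (by norm_num), Real.rpow_one]
        rw [this, hK]
        ring

end ClassSum

section MainInduction

lemma exists_dyadic_count {δ ε : ℝ} (hδ : 0 < δ) (hδ1 : δ ≤ 1) (hε : 0 < ε) :
    ∃ m : ℕ, 1 ≤ 2 ^ m * δ ∧ (m + 1 : ℝ) ≤ (2 + 2 / ε) * δ ^ (-ε) := by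
  obtain ⟨n, hn1, hn2⟩ := exists_nat_pow_near ((one_le_inv₀ hδ).2 hδ1) (one_lt_two (α := ℝ))
  refine ⟨n + 1, ?_, ?_⟩
  · have := mul_le_mul_of_nonneg_right hn2.le hδ.le
    rwa [inv_mul_cancel₀ hδ.ne'] at this
  · have h1 : 1 ≤ δ ^ (-ε) := Real.one_le_rpow_of_pos_of_le_one_of_nonpos hδ hδ1 (by linarith)
    have h2 : ((2 : ℝ) ^ n) ^ ε ≤ δ ^ (-ε) := by
      rw [Real.rpow_neg hδ.le, ← Real.inv_rpow hδ.le]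
      gcongr
    have h3 : (n : ℝ) * ε / 2 ≤ ((2 : ℝ) ^ n) ^ ε := by
      rw [← Real.rpow_natCast, ← Real.rpow_mul (by norm_num), Real.rpow_def_of_pos (by norm_num)]
      have h4 := Real.add_one_le_exp (Real.log 2 * (n * ε))
      have h5 := Real.log_two_gt_d9
      have h6 : 0 ≤ (n : ℝ) * ε := by positivity
      nlinarith
    have h7 : (n : ℝ) ≤ 2 / ε * δ ^ (-ε) := by
      rw [div_mul_eq_mul_div, le_div_iff₀ hε]
      linarith
    push_cast
    linarith

/-- The contribution of the points where a polynomial of bounded degree is not good. -/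
theorem exists_setLIntegral_not_goodPt_le {ε : ℝ} (hε : 0 < ε) (hε1 : ε ≤ 1) (D : ℕ) :
    ∃ C > 0, ∀ δ : ℝ, 0 < δ → δ ≤ 1 → ∀ (ι : Type) (y v : ι → E4), (∀ i, ‖v i‖ = 1) →
      ∀ A : Finset ι, (∀ i ∈ A, ∀ j ∈ A, i ≠ j → δ ≤ angle (v i) (v j)) →
      ∀ P : Poly4, P.totalDegree ≤ D →
      ∫⁻ x in {x | ¬GoodPt 24 δ P x}, tripleSum δ (12 / 13) y v (fun _ => A) x ^ (13 / 27 : ℝ) ≤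
        ENNReal.ofReal (C * δ ^ (11 / 3 - 12 * ε) * (A.card : ℝ) ^ (4 / 3 : ℝ)) := by
  obtain ⟨C, hC, hCs⟩ := exists_setLIntegral_classSum_le hε hε1 D
  refine ⟨(2 + 2 / ε) ^ 3 * C, by positivity, ?_⟩
  intro δ hδ hδ1 ι y v hv A hsep P hP
  obtain ⟨m, hm, hmc⟩ := exists_dyadic_count hδ hδ1 hε
  set X : Set E4 := {x | ¬GoodPt 24 δ P x} with hX
  have hmeas : ∀ κ : Fin 3 → Fin (m + 1), Measurable fun x => classSum (12 / 13) v A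
      (fun l i => dyadicClass δ P D (κ l) (y i) (v i)) x ^ (13 / 27 : ℝ) := fun κ =>
    (measurable_classSum _ _ _ fun _ _ => measurableSet_tubeClass _ _ _ _ _ _).pow_const _
  set b : ℝ := C * δ ^ (11 / 3 - 9 * ε) * (A.card : ℝ) ^ (4 / 3 : ℝ) with hb
  calc ∫⁻ x in X, tripleSum δ (12 / 13) y v (fun _ => A) x ^ (13 / 27 : ℝ)
      ≤ ∫⁻ x in X, ∑ κ : Fin 3 → Fin (m + 1), classSum (12 / 13) v A
          (fun l i => dyadicClass δ P D (κ l) (y i) (v i)) x ^ (13 / 27 : ℝ) := by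
        refine lintegral_mono fun x => ?_
        refine le_trans (ENNReal.rpow_le_rpow ?_ (by norm_num))
          (sum_rpow_le_sum_rpow _ _ (by norm_num) (by norm_num))
        exact tripleSum_le_sum_classSum (T := fun a i => dyadicClass δ P D a (y i) (v i))
          fun i hi => exists_mem_tubeClass P D hm hi
    _ = ∑ κ : Fin 3 → Fin (m + 1), ∫⁻ x in X, classSum (12 / 13) v A
          (fun l i => dyadicClass δ P D (κ l) (y i) (v i)) x ^ (13 / 27 : ℝ) :=
        lintegral_finsetSum _ fun κ _ => hmeas κ
    _ ≤ ∑ _κ : Fin 3 → Fin (m + 1), ENNReal.ofReal b :=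
        Finset.sum_le_sum fun κ _ => hCs δ hδ hδ1 ι y v hv A hsep P hP fun l => κ l
    _ = ENNReal.ofReal ((m + 1 : ℝ) ^ 3 * b) := by
        rw [Finset.sum_const, Finset.card_univ, Fintype.card_fun, Fintype.card_fin,
          Fintype.card_fin, nsmul_eq_mul, ENNReal.ofReal_mul (p := (m + 1 : ℝ) ^ 3) (by positivity),
          ← ENNReal.ofReal_natCast]
        push_cast
        rfl
    _ ≤ ENNReal.ofReal (((2 + 2 / ε) * δ ^ (-ε)) ^ 3 * b) := by
        have : 0 ≤ b := by positivity
        gcongr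
    _ = _ := by
        congr 1
        have h : δ ^ (11 / 3 - 12 * ε) = (δ ^ (-ε)) ^ 3 * δ ^ (11 / 3 - 9 * ε) := by
          rw [← Real.rpow_natCast, ← Real.rpow_mul hδ.le, ← Real.rpow_add hδ]
          congr 1
          push_cast
          ring
        rw [h, hb]
        ring

/-- The multilinear estimate, up to a power loss in the number of tubes. -/
theorem exists_lintegral_tripleSum_le {ε η : ℝ} (hε : 0 < ε) (hε1 : ε ≤ 1) (hη : 0 < η) :
    ∃ C > 0, ∀ δ : ℝ, 0 < δ → δ ≤ 1 → ∀ (ι : Type) (y v : ι → E4), (∀ i, ‖v i‖ = 1) →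
      ∀ A : Finset ι, (∀ i ∈ A, ∀ j ∈ A, i ≠ j → δ ≤ angle (v i) (v j)) →
      ∫⁻ x, tripleSum δ (12 / 13) y v (fun _ => A) x ^ (13 / 27 : ℝ) ≤
        ENNReal.ofReal (C * δ ^ (11 / 3 - 12 * ε) * (A.card : ℝ) ^ (4 / 3 + η)) := by
  obtain ⟨h, hh1, hh⟩ := exists_cell_scale 4 (by norm_num) (K := 4) (σ := 4 / 3 + η)
    (by push_cast; linarith)
  obtain ⟨C, hC, hCb⟩ := exists_setLIntegral_not_goodPt_le hε hε1 (32 * 2 ^ h)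
  refine ⟨2 * C, by positivity, fun δ hδ hδ1 ι y v hv A => ?_⟩
  classical
  induction hN : A.card using Nat.strong_induction_on generalizing A with
  | _ N ih =>
  intro hsep
  subst hN
  rcases A.eq_empty_or_nonempty with rfl | hne
  · simp [tripleSum]
  have hcard : 0 < A.card := Finset.card_pos.2 hne
  set f : E4 → ℝ≥0∞ := fun x => tripleSum δ (12 / 13) y v (fun _ => A) x ^ (13 / 27 : ℝ) with hf
  have hfin : ∫⁻ x, f x ≠ ⊤ := lintegral_tripleSum_rpow_ne_top δ _ (by norm_num) y v _
  set θ : ℝ := 396 * 2 ^ h / 2 ^ (4 * h) with hθ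
  have hθ0 : 0 ≤ θ := by positivity
  obtain ⟨P, -, hPd, -, hP | ⟨G, A', hG, hsub, hc, hmem, hbound⟩⟩ :=
    cell_reduction hδ y v (Function.Embedding.refl (Fin 4)) (by norm_num) h f hfin fun _ => A
  · calc ∫⁻ x, f x ≤ _ := hP
      _ ≤ 2 * ENNReal.ofReal (C * δ ^ (11 / 3 - 12 * ε) * (A.card : ℝ) ^ (4 / 3 : ℝ)) :=
        mul_le_mul_right (hCb δ hδ hδ1 ι y v hv A hsep P hPd) _
      _ = ENNReal.ofReal (2 * (C * δ ^ (11 / 3 - 12 * ε) * (A.card : ℝ) ^ (4 / 3 : ℝ))) := by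
        rw [ENNReal.ofReal_mul (p := 2) (by norm_num), ENNReal.ofReal_ofNat]
      _ ≤ _ := by
        refine ENNReal.ofReal_le_ofReal ?_
        rw [← mul_assoc, ← mul_assoc]
        gcongr
        · exact_mod_cast hcard
        · linarith
  · have hle : ((A' 0).card : ℝ) ≤ θ * A.card := card_le_of_cell (hc 0)
    have hlt : (A' 0).card < A.card := by
      have h1 : (0 : ℝ) < A.card := by exact_mod_cast hcard
      exact_mod_cast hle.trans_lt (mul_lt_of_lt_one_left h1 hh1)
    have h3 := ih _ hlt (A' 0) rfl fun i hi j hj => hsep i (hsub 0 hi) j (hsub 0 hj)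
    calc ∫⁻ x, f x ≤ _ := hbound
      _ ≤ 4 * 2 ^ (4 * h) * ∫⁻ x, tripleSum δ (12 / 13) y v (fun _ => A' 0) x ^ (13 / 27 : ℝ) := by
        refine mul_le_mul_right ?_ _
        refine (setLIntegral_mono_ae' hG (Filter.Eventually.of_forall fun x hx => ?_)).trans
          (setLIntegral_le_lintegral G _)
        exact ENNReal.rpow_le_rpow (tripleSum_le_of_forall_mem fun m => hmem x hx 0) (by norm_num)
      _ ≤ 4 * 2 ^ (4 * h) * ENNReal.ofReal
          (2 * C * δ ^ (11 / 3 - 12 * ε) * ((A' 0).card : ℝ) ^ (4 / 3 + η)) := by gcongr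
      _ = ENNReal.ofReal (4 * 2 ^ (4 * h) *
          (2 * C * δ ^ (11 / 3 - 12 * ε) * ((A' 0).card : ℝ) ^ (4 / 3 + η))) := by
        rw [ENNReal.ofReal_mul (p := 4 * 2 ^ (4 * h)) (by positivity),
          ENNReal.ofReal_mul (p := 4) (by positivity), ENNReal.ofReal_pow (by norm_num)]
        simp
      _ ≤ _ := by
        refine ENNReal.ofReal_le_ofReal ?_
        calc 4 * 2 ^ (4 * h) * (2 * C * δ ^ (11 / 3 - 12 * ε) * ((A' 0).card : ℝ) ^ (4 / 3 + η))
            ≤ 4 * 2 ^ (4 * h) * (2 * C * δ ^ (11 / 3 - 12 * ε) * (θ * A.card) ^ (4 / 3 + η)) := by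
              gcongr
          _ = (4 * 2 ^ (4 * h) * θ ^ (4 / 3 + η)) *
              (2 * C * δ ^ (11 / 3 - 12 * ε) * (A.card : ℝ) ^ (4 / 3 + η)) := by
              rw [Real.mul_rpow hθ0 (by positivity)]
              ring
          _ ≤ _ := mul_le_of_le_one_left (by positivity) hh

lemma ofReal_indicator_tube (δ : ℝ) (y v x : E4) :
    ENNReal.ofReal ((tube δ y v).indicator (fun _ => (1 : ℝ)) x) = tubeInd δ y v x := by
  by_cases h : x ∈ tube δ y v
  · simp [tubeInd_of_mem h, h]
  · simp [tubeInd_of_notMem h, h]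

lemma ofReal_sum_indicator_eq_tripleSum {ι : Type} [Fintype ι] (δ s : ℝ) (y v : ι → E4) (x : E4) :
    0 ≤ (∑ i, ∑ j, ∑ k, (tube δ (y i) (v i)).indicator (fun _ => (1 : ℝ)) x *
      (tube δ (y j) (v j)).indicator (fun _ => (1 : ℝ)) x *
      (tube δ (y k) (v k)).indicator (fun _ => (1 : ℝ)) x * wedge3 (v i) (v j) (v k) ^ s) ∧
    ENNReal.ofReal (∑ i, ∑ j, ∑ k, (tube δ (y i) (v i)).indicator (fun _ => (1 : ℝ)) x *
      (tube δ (y j) (v j)).indicator (fun _ => (1 : ℝ)) x *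
      (tube δ (y k) (v k)).indicator (fun _ => (1 : ℝ)) x * wedge3 (v i) (v j) (v k) ^ s) =
      tripleSum δ s y v (fun _ => Finset.univ) x := by
  have h1 : ∀ i, 0 ≤ (tube δ (y i) (v i)).indicator (fun _ => (1 : ℝ)) x := fun i =>
    Set.indicator_nonneg (fun _ _ => zero_le_one) x
  have h2 : ∀ i j k, 0 ≤ (tube δ (y i) (v i)).indicator (fun _ => (1 : ℝ)) x *
      (tube δ (y j) (v j)).indicator (fun _ => (1 : ℝ)) x *
      (tube δ (y k) (v k)).indicator (fun _ => (1 : ℝ)) x * wedge3 (v i) (v j) (v k) ^ s :=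
    fun i j k => mul_nonneg (mul_nonneg (mul_nonneg (h1 i) (h1 j)) (h1 k))
      (Real.rpow_nonneg (wedge3_nonneg _ _ _) _)
  have h3 := fun i j => Finset.sum_nonneg fun k (_ : k ∈ Finset.univ) => h2 i j k
  have h4 := fun i => Finset.sum_nonneg fun j (_ : j ∈ Finset.univ) => h3 i j
  refine ⟨Finset.sum_nonneg fun i _ => h4 i, ?_⟩
  unfold tripleSum
  rw [ENNReal.ofReal_sum_of_nonneg fun i _ => h4 i]
  refine Finset.sum_congr rfl fun i _ => ?_
  rw [ENNReal.ofReal_sum_of_nonneg fun j _ => h3 i j]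
  refine Finset.sum_congr rfl fun j _ => ?_
  rw [ENNReal.ofReal_sum_of_nonneg fun k _ => h2 i j k]
  refine Finset.sum_congr rfl fun k _ => ?_
  rw [ENNReal.ofReal_mul (mul_nonneg (mul_nonneg (h1 i) (h1 j)) (h1 k)),
    ENNReal.ofReal_mul (mul_nonneg (h1 i) (h1 j)), ENNReal.ofReal_mul (h1 i),
    ofReal_indicator_tube, ofReal_indicator_tube, ofReal_indicator_tube]

end MainInduction

/-- the Guth–Zahl trilinear Kakeya estimate in ℝ⁴. -/
theorem statement_13 :
    ∀ ε > (0 : ℝ), ∃ C > (0 : ℝ), ∀ δ ∈ Set.Ioo (0 : ℝ) 1,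
      ∀ (ι : Type) [Fintype ι], ∀ y v : ι → EuclideanSpace ℝ (Fin 4),
        (∀ i, ‖v i‖ = 1) →
        (∀ i j, i ≠ j → δ ≤ angle (v i) (v j)) →
        (∫⁻ x, ENNReal.ofReal
            ((∑ i : ι, ∑ j : ι, ∑ k : ι,
              (tube δ (y i) (v i)).indicator (fun _ => (1 : ℝ)) x *
                (tube δ (y j) (v j)).indicator (fun _ => (1 : ℝ)) x *
                (tube δ (y k) (v k)).indicator (fun _ => (1 : ℝ)) x *
                wedge3 (v i) (v j) (v k) ^ ((12 : ℝ) / 13)) ^ ((13 : ℝ) / 27))) ≤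
          ENNReal.ofReal (C * δ ^ (-(1 : ℝ) / 3 - ε) *
            (δ ^ (3 : ℝ) * (Fintype.card ι : ℝ)) ^ ((4 : ℝ) / 3)) := by
  intro ε hε
  have hη : 0 < ε / 6 := by positivity
  set e : ℝ := min 1 (ε / 24) with he
  have he0 : 0 < e := lt_min one_pos (by positivity)
  have heε : e ≤ ε / 24 := min_le_right _ _
  obtain ⟨C, hC, hCb⟩ := exists_lintegral_tripleSum_le he0 (min_le_left _ _) hη
  obtain ⟨Q, hQ, hQb⟩ := exists_card_le_of_separated
  refine ⟨C * Q ^ (ε / 6), by positivity, ?_⟩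
  rintro δ ⟨hδ, hδ1⟩ ι _ y v hv hsep
  have hN0 : (0 : ℝ) ≤ Fintype.card ι := Nat.cast_nonneg _
  have hN : (Fintype.card ι : ℝ) ≤ Q * δ ^ (-3 : ℝ) := by
    have h := hQb hv hδ hδ1.le Finset.univ fun i _ j _ => hsep i j
    rw [Finset.card_univ] at h
    rw [Real.rpow_neg hδ.le, ← div_eq_mul_inv, le_div_iff₀ (by positivity)]
    exact_mod_cast h
  have hNη : (Fintype.card ι : ℝ) ^ (ε / 6) ≤ Q ^ (ε / 6) * δ ^ (-(ε / 2)) := by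
    calc (Fintype.card ι : ℝ) ^ (ε / 6) ≤ (Q * δ ^ (-3 : ℝ)) ^ (ε / 6) := by gcongr
      _ = _ := by
        rw [Real.mul_rpow hQ.le (by positivity), ← Real.rpow_mul hδ.le]
        ring_nf
  have hbound : ∀ x, ENNReal.ofReal ((∑ i, ∑ j, ∑ k,
      (tube δ (y i) (v i)).indicator (fun _ => (1 : ℝ)) x *
      (tube δ (y j) (v j)).indicator (fun _ => (1 : ℝ)) x *
      (tube δ (y k) (v k)).indicator (fun _ => (1 : ℝ)) x *
      wedge3 (v i) (v j) (v k) ^ ((12 : ℝ) / 13)) ^ ((13 : ℝ) / 27)) =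
      tripleSum δ (12 / 13) y v (fun _ => Finset.univ) x ^ ((13 : ℝ) / 27) := fun x => by
    obtain ⟨h0, h⟩ := ofReal_sum_indicator_eq_tripleSum δ (12 / 13) y v x
    rw [← h, ENNReal.ofReal_rpow_of_nonneg h0 (by norm_num)]
  simp_rw [hbound]
  refine (hCb δ hδ hδ1.le ι y v hv Finset.univ fun i _ j _ => hsep i j).trans
    (ENNReal.ofReal_le_ofReal ?_)
  rw [Finset.card_univ, Real.rpow_add_of_nonneg hN0 (by norm_num) hη.le]
  calc C * δ ^ (11 / 3 - 12 * e) *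
        ((Fintype.card ι : ℝ) ^ (4 / 3 : ℝ) * (Fintype.card ι : ℝ) ^ (ε / 6))
      ≤ C * δ ^ (11 / 3 - ε / 2) *
        ((Fintype.card ι : ℝ) ^ (4 / 3 : ℝ) * (Q ^ (ε / 6) * δ ^ (-(ε / 2)))) := by
        gcongr C * ?_ * (_ * ?_)
        exact Real.rpow_le_rpow_of_exponent_ge hδ hδ1.le (by linarith)
    _ = C * Q ^ (ε / 6) * (δ ^ (11 / 3 - ε / 2) * δ ^ (-(ε / 2))) *
        (Fintype.card ι : ℝ) ^ (4 / 3 : ℝ) := by ring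
    _ = C * Q ^ (ε / 6) * (δ ^ (-(1 : ℝ) / 3 - ε) * (δ ^ (3 : ℝ)) ^ (4 / 3 : ℝ)) *
        (Fintype.card ι : ℝ) ^ (4 / 3 : ℝ) := by
        rw [← Real.rpow_mul hδ.le, ← Real.rpow_add hδ, ← Real.rpow_add hδ]
        ring_nf
    _ = _ := by
        rw [Real.mul_rpow (by positivity) hN0]
        ring

end
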